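/- Near-axis Hamada coordinates (Theorem 2): Let (B,J,p) be an integrable magnetic field on an open set U ⊆ ℝ³ and let γ ⊆ U be a nondegenerate elliptic magnetic axis. Then there exist r > 0, δ > 0, a C^∞ map Φ : D_r × ℝ → U where D_r = {(x,y) ∈ ℝ² : x² + y² < r²}, and C^∞ functions P, F, G, K, L : (−δ, r²/2) → ℝ such that: (i) Φ(x,y,φ+2π) = Φ(x,y,φ); (ii) Φ has everywhere invertible differential, its image is an open neighborhood of γ, Φ({(0,0)} × ℝ) = γ, and Φ(x,y,φ) = Φ(x',y',φ') iff (x,y) = (x',y') and φ − φ' ∈ 2πℤ; (iii) for all (x,y,φ) ∈ D_r × ℝ, writing ψ = (x² + y²)/2: p(Φ(x,y,φ)) = P(ψ), det(DΦ) · (DΦ)⁻¹ (B∘Φ) = (−G′(ψ)·y, G′(ψ)·x, F′(ψ)), and det(DΦ) · (DΦ)⁻¹ (J∘Φ) = (−L′(ψ)·y, L′(ψ)·x, K′(ψ)) at (x,y,φ). -/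

import Mathlib

noncomputable section

open RealInnerProductSpace

/-- `ℝ³` as a Euclidean space. -/
abbrev R3 : Type := EuclideanSpace ℝ (Fin 3)

/-- The point `(x, y, z)` of `ℝ³`. -/
def pt (x y z : ℝ) : R3 := !₂[x, y, z]

/-- Divergence of a vector field: the trace of its derivative. -/
def divg (v : R3 → R3) (z : R3) : ℝ :=
  LinearMap.trace ℝ R3 (fderiv ℝ v z).toLinearMap

/-- Cross product on `ℝ³`. -/
def cross3 (u v : R3) : R3 :=
  pt (u 1 * v 2 - u 2 * v 1) (u 2 * v 0 - u 0 * v 2) (u 0 * v 1 - u 1 * v 0)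

/-- Standard basis vectors of `ℝ³`. -/
def e3 (i : Fin 3) : R3 := EuclideanSpace.single i 1

/-- Curl of a vector field on `ℝ³`. -/
def curl (v : R3 → R3) (z : R3) : R3 :=
  pt (fderiv ℝ v z (e3 1) 2 - fderiv ℝ v z (e3 2) 1)
     (fderiv ℝ v z (e3 2) 0 - fderiv ℝ v z (e3 0) 2)
     (fderiv ℝ v z (e3 0) 1 - fderiv ℝ v z (e3 1) 0)

/-- The Hessian of `p` at `z`, as a bilinear form. -/
def hess (p : R3 → ℝ) (z : R3) (u v : R3) : ℝ :=
  (iteratedFDeriv ℝ 2 p z) ![u, v]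

/-- `γ` is the image of a periodic integral curve of `B` lying in `U`. -/
def IsPeriodicOrbit (U : Set R3) (B : R3 → R3) (γ : Set R3) : Prop :=
  ∃ (c : ℝ → R3) (T : ℝ), 0 < T ∧ (∀ t, c t ∈ U) ∧
    (∀ t, c (t + T) = c t) ∧ (∀ t, HasDerivAt c (B (c t)) t) ∧ Set.range c = γ

/-- An integrable magnetic field `(B, J, p)` on an open set `U ⊆ ℝ³`. -/
structure IntegrableMagneticField (U : Set R3) (B J : R3 → R3) (p : R3 → ℝ) : Prop where
  isOpen_U : IsOpen U
  smooth_B : ContDiffOn ℝ (⊤ : ℕ∞) B U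
  smooth_J : ContDiffOn ℝ (⊤ : ℕ∞) J U
  smooth_p : ContDiffOn ℝ (⊤ : ℕ∞) p U
  B_ne_zero : ∀ z ∈ U, B z ≠ 0
  div_B : ∀ z ∈ U, divg B z = 0
  div_J : ∀ z ∈ U, divg J z = 0
  hamiltonian : ∀ z ∈ U, cross3 (J z) (B z) = gradient p z

/-- A nondegenerate elliptic magnetic axis: a compact image of a periodic integral
curve of `B` on which `∇p = 0` and the Hessian of `p`, restricted to the plane
orthogonal to `B`, is positive or negative definite. -/
def IsNondegenerateEllipticAxis (U : Set R3) (B : R3 → R3) (p : R3 → ℝ)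
    (γ : Set R3) : Prop :=
  IsCompact γ ∧ γ ⊆ U ∧ IsPeriodicOrbit U B γ ∧
  (∀ z ∈ γ, gradient p z = 0) ∧
  ∀ z ∈ γ,
    (∀ u : R3, u ≠ 0 → ⟪u, B z⟫ = 0 → 0 < hess p z u u) ∨
    (∀ u : R3, u ≠ 0 → ⟪u, B z⟫ = 0 → hess p z u u < 0)

/-- The solid cylinder `D_r × ℝ = {(x,y,φ) : x² + y² < r²}` in `ℝ³`. -/
def Dset (r : ℝ) : Set R3 := {q | (q 0) ^ 2 + (q 1) ^ 2 < r ^ 2}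

section

open Set Filter Topology
open scoped ContDiff

/-- Differentiation under the integral sign for a jointly smooth integrand. -/
theorem hasFDerivAt_intervalIntegral_param {E G : Type} [NormedAddCommGroup E] [NormedSpace ℝ E]
    [NormedAddCommGroup G] [NormedSpace ℝ G] {s : Set E} (hs : IsOpen s) {F : E × ℝ → G}
    (hF : ContDiffOn ℝ ∞ F (s ×ˢ univ)) (a b : ℝ) {x : E} (hx : x ∈ s) :
    HasFDerivAt (fun x => ∫ t in a..b, F (x, t))
      (∫ t in a..b, (fderiv ℝ F (x, t)).comp (ContinuousLinearMap.inl ℝ E ℝ)) x := by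
  have ho : IsOpen (s ×ˢ (univ : Set ℝ)) := hs.prod isOpen_univ
  set F' : E × ℝ → (E →L[ℝ] G) :=
    fun z => (fderiv ℝ F z).comp (ContinuousLinearMap.inl ℝ E ℝ) with hF'
  have hF'c : ContinuousOn F' (s ×ˢ univ) := by
    have h1 : ContinuousOn (fderiv ℝ F) (s ×ˢ univ) :=
      hF.continuousOn_fderiv_of_isOpen ho (by simp)
    exact h1.clm_comp continuousOn_const
  have hsl : ∀ y ∈ s, ∀ t : ℝ, HasFDerivAt (fun y => F (y, t)) (F' (y, t)) y := by
    intro y hy t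
    have h1 : HasFDerivAt F (fderiv ℝ F (y, t)) (y, t) :=
      ((hF.contDiffAt (ho.mem_nhds ⟨hy, mem_univ _⟩)).differentiableAt (by simp)).hasFDerivAt
    exact HasFDerivAt.comp y h1 (hasFDerivAt_prodMk_left y t)
  have hcs : ∀ {H : Type} [NormedAddCommGroup H] (g : E × ℝ → H),
      ContinuousOn g (s ×ˢ univ) → ∀ y ∈ s, Continuous fun t => g (y, t) := by
    intro H _ g hg y hy
    exact hg.comp_continuous (by fun_prop) (fun t => ⟨hy, mem_univ _⟩)
  -- local uniform bound
  obtain ⟨u, hu, hus, C, hC⟩ : ∃ u ∈ 𝓝 x, u ⊆ s ∧ ∃ C : ℝ, ∀ y ∈ u, ∀ t ∈ uIcc a b,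
      ‖F' (y, t)‖ ≤ C := by
    obtain ⟨C, hC⟩ := (isCompact_uIcc (a := a) (b := b)).exists_bound_of_continuousOn
      (hcs F' hF'c x hx).continuousOn
    have hopen : IsOpen ((s ×ˢ univ) ∩ F' ⁻¹' {A | ‖A‖ < C + 1}) :=
      hF'c.isOpen_inter_preimage ho (isOpen_lt continuous_norm continuous_const)
    obtain ⟨u, v, hu, hv, hxu, hbv, huv⟩ := generalized_tube_lemma
      (isCompact_singleton (x := x)) (isCompact_uIcc (a := a) (b := b)) hopen (by
        rintro ⟨y, t⟩ ⟨hy, ht⟩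
        obtain rfl : y = x := hy
        exact ⟨⟨hx, mem_univ _⟩, lt_of_le_of_lt (hC t ht) (lt_add_one C)⟩)
    refine ⟨u ∩ s, inter_mem (hu.mem_nhds (hxu rfl)) (hs.mem_nhds hx), inter_subset_right, C + 1, ?_⟩
    rintro y ⟨hy, -⟩ t ht
    exact (huv ⟨hy, hbv ht⟩).2.le
  refine intervalIntegral.hasFDerivAt_integral_of_dominated_of_fderiv_le
    (F := fun x t => F (x, t)) (F' := fun x t => F' (x, t)) (bound := fun _ => C) hu ?_ ?_ ?_ ?_ ?_ ?_
  · filter_upwards [hs.mem_nhds hx] with y hy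
    exact (hcs F hF.continuousOn y hy).aestronglyMeasurable
  · exact (hcs F hF.continuousOn x hx).intervalIntegrable _ _
  · exact (hcs F' hF'c x hx).aestronglyMeasurable
  · exact Eventually.of_forall fun t ht y hy => hC y hy t (uIoc_subset_uIcc ht)
  · exact intervalIntegrable_const
  · exact Eventually.of_forall fun t _ y hy => hsl y (hus hy) t

/-- A parametric integral of a jointly smooth integrand is smooth. -/
theorem contDiffOn_intervalIntegral_param {E G : Type} [NormedAddCommGroup E] [NormedSpace ℝ E]
    [NormedAddCommGroup G] [NormedSpace ℝ G] {s : Set E} (hs : IsOpen s) {F : E × ℝ → G}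
    (hF : ContDiffOn ℝ ∞ F (s ×ˢ univ)) (a b : ℝ) :
    ContDiffOn ℝ ∞ (fun x => ∫ t in a..b, F (x, t)) s := by
  refine contDiffOn_infty.2 fun n => ?_
  induction n generalizing G with
  | zero =>
    exact contDiffOn_zero.2 fun x hx =>
      (hasFDerivAt_intervalIntegral_param hs hF a b hx).continuousAt.continuousWithinAt
  | succ n ih =>
    have ho : IsOpen (s ×ˢ (univ : Set ℝ)) := hs.prod isOpen_univ
    push_cast
    rw [contDiffOn_succ_iff_fderiv_of_isOpen hs]
    refine ⟨fun x hx => (hasFDerivAt_intervalIntegral_param hs hF a b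
      hx).differentiableAt.differentiableWithinAt, by simp, ?_⟩
    have h2 := ih (F := fun z => (fderiv ℝ F z).comp (ContinuousLinearMap.inl ℝ E ℝ))
      ((hF.fderiv_of_isOpen ho (by simp)).clm_comp contDiffOn_const)
    exact h2.congr fun x hx => (hasFDerivAt_intervalIntegral_param hs hF a b hx).fderiv

/-- The derivative of a parametric integral in a given direction. -/
theorem fderiv_intervalIntegral_param_apply {E : Type} [NormedAddCommGroup E] [NormedSpace ℝ E]
    {s : Set E} (hs : IsOpen s) {F : E × ℝ → ℝ}
    (hF : ContDiffOn ℝ ∞ F (s ×ˢ univ)) (a b : ℝ) {x : E} (hx : x ∈ s) (v : E) :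
    fderiv ℝ (fun x => ∫ t in a..b, F (x, t)) x v
      = ∫ t in a..b, fderiv ℝ (fun y => F (y, t)) x v := by
  have ho : IsOpen (s ×ˢ (univ : Set ℝ)) := hs.prod isOpen_univ
  rw [(hasFDerivAt_intervalIntegral_param hs hF a b hx).fderiv,
    ContinuousLinearMap.intervalIntegral_apply]
  · refine intervalIntegral.integral_congr fun t _ => ?_
    have h1 : HasFDerivAt F (fderiv ℝ F (x, t)) (x, t) :=
      ((hF.contDiffAt (ho.mem_nhds ⟨hx, mem_univ _⟩)).differentiableAt (by simp)).hasFDerivAt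
    have h2 : HasFDerivAt (fun y => F (y, t)) _ x := HasFDerivAt.comp x h1 (hasFDerivAt_prodMk_left x t)
    rw [h2.fderiv]
  · have h1 : ContinuousOn (fderiv ℝ F) (s ×ˢ univ) :=
      hF.continuousOn_fderiv_of_isOpen ho (by simp)
    have h2 : Continuous fun t : ℝ => fderiv ℝ F (x, t) :=
      h1.comp_continuous (by fun_prop) (fun t => ⟨hx, mem_univ _⟩)
    exact (h2.clm_comp continuous_const).intervalIntegrable _ _

/-- The coefficient in Hadamard's lemma along the range of `π`: an average of the derivative of `u`
over the segment from `x - π x` to `x`. -/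
def hadamardCoeff {E : Type} [NormedAddCommGroup E] [NormedSpace ℝ E] (π : E →L[ℝ] E) (u : E → ℝ)
    (x : E) : E →L[ℝ] ℝ :=
  ∫ t in (0 : ℝ)..1, deriv Real.smoothTransition t •
    fderiv ℝ u (x - π x + Real.smoothTransition t • π x)

theorem contDiffOn_hadamard_integrand {E : Type} [NormedAddCommGroup E] [NormedSpace ℝ E]
    {s : Set E} (hs : IsOpen s) (π : E →L[ℝ] E)
    (hseg : ∀ x ∈ s, ∀ t ∈ Icc (0 : ℝ) 1, x - π x + t • π x ∈ s) {u : E → ℝ}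
    (hu : ContDiffOn ℝ ∞ u s) :
    ContDiffOn ℝ ∞ (fun z : E × ℝ => deriv Real.smoothTransition z.2 •
      fderiv ℝ u (z.1 - π z.1 + Real.smoothTransition z.2 • π z.1)) (s ×ˢ univ) := by
  have hσ : ContDiff ℝ ∞ Real.smoothTransition := Real.smoothTransition.contDiff
  have hσ' : ContDiff ℝ ∞ (deriv Real.smoothTransition) := hσ.iterate_deriv 1
  have h1 : ContDiff ℝ ∞ (fun z : E × ℝ => z.1 - π z.1 + Real.smoothTransition z.2 • π z.1) :=
    (contDiff_fst.sub (π.contDiff.comp contDiff_fst)).add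
      ((hσ.comp contDiff_snd).smul (π.contDiff.comp contDiff_fst))
  refine ((hσ'.comp contDiff_snd).contDiffOn).smul
    ((hu.fderiv_of_isOpen hs (by simp)).comp h1.contDiffOn ?_)
  rintro ⟨x, t⟩ ⟨hx, -⟩
  exact hseg x hx _ ⟨Real.smoothTransition.nonneg t, Real.smoothTransition.le_one t⟩

theorem contDiffOn_hadamardCoeff {E : Type} [NormedAddCommGroup E] [NormedSpace ℝ E]
    {s : Set E} (hs : IsOpen s) (π : E →L[ℝ] E)
    (hseg : ∀ x ∈ s, ∀ t ∈ Icc (0 : ℝ) 1, x - π x + t • π x ∈ s) {u : E → ℝ}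
    (hu : ContDiffOn ℝ ∞ u s) : ContDiffOn ℝ ∞ (hadamardCoeff π u) s :=
  contDiffOn_intervalIntegral_param hs (contDiffOn_hadamard_integrand hs π hseg hu) 0 1

/-- **Hadamard's lemma** along the range of a linear map. -/
theorem eq_add_hadamardCoeff {E : Type} [NormedAddCommGroup E] [NormedSpace ℝ E]
    {s : Set E} (hs : IsOpen s) (π : E →L[ℝ] E)
    (hseg : ∀ x ∈ s, ∀ t ∈ Icc (0 : ℝ) 1, x - π x + t • π x ∈ s) {u : E → ℝ}
    (hu : ContDiffOn ℝ ∞ u s) {x : E} (hx : x ∈ s) :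
    u x = u (x - π x) + hadamardCoeff π u x (π x) := by
  have hσ : ContDiff ℝ ∞ Real.smoothTransition := Real.smoothTransition.contDiff
  have hcont : Continuous fun t : ℝ => deriv Real.smoothTransition t •
      fderiv ℝ u (x - π x + Real.smoothTransition t • π x) :=
    (contDiffOn_hadamard_integrand hs π hseg hu).continuousOn.comp_continuous
      (f := fun t : ℝ => (x, t)) (by fun_prop) (fun t => ⟨hx, mem_univ _⟩)
  rw [hadamardCoeff, ContinuousLinearMap.intervalIntegral_apply (hcont.intervalIntegrable _ _)]
  have hd : ∀ t : ℝ, HasDerivAt (fun t => u (x - π x + Real.smoothTransition t • π x))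
      ((deriv Real.smoothTransition t •
      fderiv ℝ u (x - π x + Real.smoothTransition t • π x)) (π x)) t := by
    intro t
    have h1 : HasFDerivAt u _ (x - π x + Real.smoothTransition t • π x) :=
      ((hu.contDiffAt (hs.mem_nhds (hseg x hx _ ⟨Real.smoothTransition.nonneg t,
        Real.smoothTransition.le_one t⟩))).differentiableAt (by simp)).hasFDerivAt
    have h2 : HasDerivAt Real.smoothTransition (deriv Real.smoothTransition t) t :=
      (hσ.differentiable (by simp) t).hasDerivAt
    have h3 := h1.comp_hasDerivAt t ((h2.smul_const (π x)).const_add (x - π x))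
    simpa [Function.comp_def] using h3
  rw [intervalIntegral.integral_eq_sub_of_hasDerivAt (fun t _ => hd t)
    ((hcont.clm_apply continuous_const).intervalIntegrable _ _)]
  simp

theorem hadamardCoeff_add_eq {E : Type} [NormedAddCommGroup E] [NormedSpace ℝ E]
    {s : Set E} (hs : IsOpen s) (π : E →L[ℝ] E)
    (hseg : ∀ x ∈ s, ∀ t ∈ Icc (0 : ℝ) 1, x - π x + t • π x ∈ s) {u : E → ℝ} {v : E}
    (hπ : π v = 0) (hper : ∀ x ∈ s, u (x + v) = u x) {x : E} (hx : x ∈ s) :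
    hadamardCoeff π u (x + v) = hadamardCoeff π u x := by
  unfold hadamardCoeff
  refine intervalIntegral.integral_congr fun t _ => ?_
  simp only [map_add, hπ, add_zero]
  rw [show x + v - π x + Real.smoothTransition t • π x
    = (x - π x + Real.smoothTransition t • π x) + v by abel]
  congr 1
  rw [← fderiv_comp_add_right]
  refine Filter.EventuallyEq.fderiv_eq ?_
  filter_upwards [hs.mem_nhds (hseg x hx _ ⟨Real.smoothTransition.nonneg t,
        Real.smoothTransition.le_one t⟩)] with y hy using hper y hy

/-- A smooth function with only its `n`-th derivative at `0` nonzero, of prescribed value, and with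
small derivatives of lower order. -/
theorem exists_smooth_single_jet (a : ℝ) (n : ℕ) : ∃ g : ℝ → ℝ, ContDiff ℝ ∞ g ∧
    (∀ k, iteratedDeriv k g 0 = if k = n then a else 0) ∧
    (∀ k, ∃ M, ∀ x, ‖iteratedDeriv k g x‖ ≤ M) ∧
    (∀ k < n, ∀ x, ‖iteratedDeriv k g x‖ ≤ (1 / 2) ^ n) := by
  let χ : ContDiffBump (0 : ℝ) := ⟨1, 2, one_pos, one_lt_two⟩
  set η : ℝ → ℝ := fun x => x ^ n * χ x with hη
  have hηs : ContDiff ℝ ∞ η := (contDiff_id.pow n).mul χ.contDiff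
  have hηc : HasCompactSupport η := χ.hasCompactSupport.mul_left
  have hb : ∀ k, ∃ M, ∀ x, ‖iteratedDeriv k η x‖ ≤ M := by
    intro k
    obtain ⟨M, hM⟩ := ((hηs.continuous_iteratedFDeriv (m := k)
      (by exact_mod_cast le_top))).bounded_above_of_compact_support
      (hηc.iteratedFDeriv k)
    exact ⟨M, fun x => by rw [← norm_iteratedFDeriv_eq_norm_iteratedDeriv]; exact hM x⟩
  choose M hM using hb
  have hM0 : ∀ k, 0 ≤ M k := fun k => (norm_nonneg _).trans (hM k 0)
  set S := ∑ k ∈ Finset.range n, M k with hS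
  have hS0 : 0 ≤ S := Finset.sum_nonneg fun k _ => hM0 k
  set c := a / n.factorial with hc
  set l : ℝ := 1 + |c| * S * 2 ^ n with hl
  have hl1 : 1 ≤ l := by
    have : 0 ≤ |c| * S * 2 ^ n := by positivity
    linarith
  have hl0 : 0 < l := by linarith
  have hg : ∀ k x, iteratedDeriv k (fun x => c * (l ^ n)⁻¹ * η (l * x)) x
      = c * (l ^ n)⁻¹ * (l ^ k * iteratedDeriv k η (l * x)) := by
    intro k x
    rw [iteratedDeriv_const_mul_field,
      iteratedDeriv_comp_const_mul (hηs.of_le (by exact_mod_cast le_top))]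
  refine ⟨fun x => c * (l ^ n)⁻¹ * η (l * x), ?_, ?_, ?_, ?_⟩
  · exact contDiff_const.mul (hηs.comp (contDiff_const.mul contDiff_id))
  · intro k
    rw [hg, mul_zero]
    have h1 : η =ᶠ[𝓝 0] fun x => x ^ n := by
      filter_upwards [χ.eventuallyEq_one] with x hx
      simp [hη, hx]
    rw [h1.iteratedDeriv_eq, iteratedDeriv_fun_pow_zero]
    split_ifs with h
    · subst h
      field_simp [hc]
      rw [hc]; field_simp
    · simp
  · intro k
    refine ⟨|c * (l ^ n)⁻¹| * (l ^ k * M k), fun x => ?_⟩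
    rw [hg, norm_mul, norm_mul (l ^ k), Real.norm_eq_abs, norm_pow, Real.norm_of_nonneg hl0.le]
    gcongr
    exact hM k _
  · intro k hk x
    rw [hg, norm_mul, norm_mul, norm_mul, Real.norm_eq_abs, norm_pow, Real.norm_of_nonneg hl0.le,
      norm_inv, norm_pow, Real.norm_of_nonneg hl0.le]
    have h1 : ‖iteratedDeriv k η (l * x)‖ ≤ S :=
      (hM k _).trans (Finset.single_le_sum (f := M) (fun i _ => hM0 i) (Finset.mem_range.2 hk))
    have h2 : l ^ k * l ≤ l ^ n := by
      rw [← pow_succ]; exact pow_le_pow_right₀ hl1 hk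
    have h3 : (l ^ n)⁻¹ * l ^ k ≤ l⁻¹ := by
      rw [inv_mul_le_iff₀ (by positivity), ← div_eq_mul_inv, le_div_iff₀ hl0]
      exact h2
    calc |c| * (l ^ n)⁻¹ * (l ^ k * ‖iteratedDeriv k η (l * x)‖)
        = |c| * ((l ^ n)⁻¹ * l ^ k) * ‖iteratedDeriv k η (l * x)‖ := by ring
      _ ≤ |c| * l⁻¹ * S := by gcongr
      _ ≤ (1 / 2) ^ n := by
        rw [one_div, inv_pow, mul_right_comm, ← div_eq_mul_inv, div_le_iff₀ hl0,
          inv_mul_eq_div, le_div_iff₀ (by positivity)]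
        linarith

/-- **Borel's lemma**: every sequence is the jet at `0` of a smooth function. -/
theorem exists_contDiff_iteratedDeriv_eq (a : ℕ → ℝ) : ∃ f : ℝ → ℝ, ContDiff ℝ ∞ f ∧
    ∀ k, iteratedDeriv k f 0 = a k := by
  choose g hgs hg0 hgb hg using fun n => exists_smooth_single_jet (a n) n
  choose M hM using hgb
  set v : ℕ → ℕ → ℝ := fun k n => if k < n then (1 / 2) ^ n else M n k with hv
  have hvs : ∀ k : ℕ, ((k : ℕ∞) : ℕ∞) ≤ ⊤ → Summable (v k) := by
    intro k _
    refine (summable_congr_cofinite ?_).2 (summable_geometric_two)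
    rw [Nat.cofinite_eq_atTop]
    filter_upwards [eventually_gt_atTop k] with n hn
    simp [hv, hn]
  have hvb : ∀ (k n : ℕ) (x : ℝ), ((k : ℕ∞) : ℕ∞) ≤ ⊤ → ‖iteratedFDeriv ℝ k (g n) x‖ ≤ v k n := by
    intro k n x _
    rw [norm_iteratedFDeriv_eq_norm_iteratedDeriv]
    simp only [hv]
    split_ifs with h
    · exact hg n k h x
    · exact hM n k x
  refine ⟨fun x => ∑' n, g n x, contDiff_tsum hgs hvs hvb, fun k => ?_⟩
  rw [iteratedDeriv_eq_iteratedFDeriv, iteratedFDeriv_tsum_apply hgs hvs hvb le_top]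
  have hsum : Summable fun n => iteratedFDeriv ℝ k (g n) 0 :=
    Summable.of_norm_bounded (hvs k le_top) fun n => hvb k n 0 le_top
  rw [ContinuousMultilinearMap.tsum_eval hsum]
  simp_rw [← iteratedDeriv_eq_iteratedFDeriv, hg0]
  simp

/-- An even smooth function has derivative `x * h₁ x` with `h₁` even and smooth. -/
theorem exists_even_deriv_eq_mul {r : ℝ} {h : ℝ → ℝ} (hs : ContDiffOn ℝ ∞ h (Ioo (-r) r))
    (he : ∀ x ∈ Ioo (-r) r, h (-x) = h x) :
    ∃ h₁ : ℝ → ℝ, ContDiffOn ℝ ∞ h₁ (Ioo (-r) r) ∧ (∀ x ∈ Ioo (-r) r, h₁ (-x) = h₁ x) ∧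
      ∀ x ∈ Ioo (-r) r, HasDerivAt h (x * h₁ x) x := by
  have hneg : ∀ x ∈ Ioo (-r) r, -x ∈ Ioo (-r) r := fun x hx => ⟨by linarith [hx.2], by linarith [hx.1]⟩
  have hsc : ∀ x ∈ Ioo (-r) r, ∀ t ∈ Icc (0 : ℝ) 1, t * x ∈ Ioo (-r) r := by
    intro x hx t ht
    have := hx.1; have := hx.2; have := ht.1; have := ht.2
    constructor <;> nlinarith
  have hd1 : ContDiffOn ℝ ∞ (deriv h) (Ioo (-r) r) := hs.deriv_of_isOpen isOpen_Ioo (by simp)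
  have hd2 : ContDiffOn ℝ ∞ (deriv (deriv h)) (Ioo (-r) r) := hd1.deriv_of_isOpen isOpen_Ioo (by simp)
  have hD : ∀ x ∈ Ioo (-r) r, HasDerivAt h (deriv h x) x := fun x hx =>
    ((hs.contDiffAt (isOpen_Ioo.mem_nhds hx)).differentiableAt (by simp)).hasDerivAt
  have hD1 : ∀ x ∈ Ioo (-r) r, HasDerivAt (deriv h) (deriv (deriv h) x) x := fun x hx =>
    ((hd1.contDiffAt (isOpen_Ioo.mem_nhds hx)).differentiableAt (by simp)).hasDerivAt
  have hodd : ∀ x ∈ Ioo (-r) r, deriv h (-x) = - deriv h x := by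
    intro x hx
    have h1 : HasDerivAt (fun y => h (-y)) (deriv h (-x) * (-1)) x :=
      (hD (-x) (hneg x hx)).comp x (hasDerivAt_neg x)
    have h2 : HasDerivAt (fun y => h (-y)) (deriv h x) x :=
      (hD x hx).congr_of_eventuallyEq (by
        filter_upwards [isOpen_Ioo.mem_nhds hx] with y hy using he y hy)
    have := h1.unique h2
    linarith
  obtain ⟨h₁, hh1s, hh1⟩ : ∃ h₁ : ℝ → ℝ, ContDiffOn ℝ ∞ h₁ (Ioo (-r) r) ∧
      ∀ x ∈ Ioo (-r) r, deriv h x = x * h₁ x := by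
    have hseg : ∀ x ∈ Ioo (-r) r, ∀ t ∈ Icc (0 : ℝ) 1,
        x - ContinuousLinearMap.id ℝ ℝ x + t • ContinuousLinearMap.id ℝ ℝ x ∈ Ioo (-r) r := by
      intro x hx t ht
      simpa using hsc x hx t ht
    refine ⟨fun x => hadamardCoeff (ContinuousLinearMap.id ℝ ℝ) (deriv h) x 1,
      (contDiffOn_hadamardCoeff isOpen_Ioo _ hseg hd1).clm_apply contDiffOn_const, fun x hx => ?_⟩
    have h0 : deriv h 0 = 0 := by
      have := hodd 0 (by simpa using hsc x hx 0 (by simp))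
      rw [neg_zero] at this
      linarith
    have h1 := eq_add_hadamardCoeff isOpen_Ioo _ hseg hd1 hx
    simp only [ContinuousLinearMap.coe_id', id_eq, sub_self, h0, zero_add] at h1
    rw [h1, ← smul_eq_mul, ← map_smul, smul_eq_mul, mul_one]
  refine ⟨h₁, hh1s, ?_, fun x hx => hh1 x hx ▸ hD x hx⟩
  intro x hx
  by_cases h0 : x = 0
  · simp [h0]
  · have h2 := hh1 _ (hneg x hx)
    rw [hodd x hx, hh1 x hx] at h2
    have : x * (h₁ (-x) - h₁ x) = 0 := by linarith
    have := (mul_eq_zero.1 this).resolve_left h0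
    linarith

/-- A smooth even function of `t` is a smooth function of `t² / 2`, up to and beyond `0`. -/
theorem exists_smooth_comp_sq_of_even {r : ℝ} (hr : 0 < r) {h : ℝ → ℝ}
    (hs : ContDiffOn ℝ ∞ h (Ioo (-r) r)) (he : ∀ x ∈ Ioo (-r) r, h (-x) = h x) :
    ∃ k : ℝ → ℝ, ContDiffOn ℝ ∞ k (Iio (r ^ 2 / 2)) ∧ ∀ t ∈ Ioo (-r) r, h t = k (t ^ 2 / 2) := by
  let X := {h : ℝ → ℝ // ContDiffOn ℝ ∞ h (Ioo (-r) r) ∧ ∀ x ∈ Ioo (-r) r, h (-x) = h x}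
  have hstep : ∀ h : X, ∃ h₁ : X, ∀ x ∈ Ioo (-r) r, HasDerivAt h.1 (x * h₁.1 x) x := by
    rintro ⟨h, hs, he⟩
    obtain ⟨h₁, a, b, c⟩ := exists_even_deriv_eq_mul hs he
    exact ⟨⟨h₁, a, b⟩, c⟩
  choose step hstep using hstep
  let H : ℕ → X := fun n => step^[n] ⟨h, hs, he⟩
  have hH : ∀ n, ∀ x ∈ Ioo (-r) r, HasDerivAt (H n).1 (x * (H (n + 1)).1 x) x := by
    intro n
    have : H (n + 1) = step (H n) := Function.iterate_succ_apply' _ _ _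
    rw [this]; exact hstep _
  obtain ⟨b, hbs, hb⟩ := exists_contDiff_iteratedDeriv_eq fun n => (H n).1 0
  let k : ℕ → ℝ → ℝ := fun n u => if 0 ≤ u then (H n).1 (√(2 * u)) else iteratedDeriv n b u
  have hsq : ∀ u ∈ Iio (r ^ 2 / 2), √(2 * u) ∈ Ioo (-r) r := by
    intro u hu
    have hu' : u < r ^ 2 / 2 := hu
    refine ⟨lt_of_lt_of_le (by linarith) (Real.sqrt_nonneg _), ?_⟩
    rw [Real.sqrt_lt' hr]; linarith
  have hpos : ∀ n, ∀ u ∈ Ioo 0 (r ^ 2 / 2), HasDerivAt (k n) (k (n + 1) u) u := by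
    intro n u hu
    have h1 := hH n _ (hsq u hu.2)
    have h2 : HasDerivAt (fun u : ℝ => √(2 * u)) (2 * 1 / (2 * √(2 * u))) u :=
      ((hasDerivAt_id u).const_mul 2).sqrt (by simpa using hu.1.ne')
    have h3 : HasDerivAt (fun u => (H n).1 (√(2 * u))) _ u := h1.comp u h2
    have h4 : √(2 * u) ≠ 0 := (Real.sqrt_pos.2 (by linarith [hu.1])).ne'
    refine (h3.congr_of_eventuallyEq ?_).congr_deriv ?_
    · filter_upwards [isOpen_Ioi.mem_nhds hu.1] with v hv
      exact if_pos (le_of_lt hv)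
    · simp only [k, if_pos hu.1.le]
      field_simp
  have hneg : ∀ n, ∀ u < 0, HasDerivAt (k n) (k (n + 1) u) u := by
    intro n u hu
    have h1 : HasDerivAt (iteratedDeriv n b) (iteratedDeriv (n + 1) b u) u := by
      rw [iteratedDeriv_succ]
      exact ((hbs.differentiable_iteratedDeriv n (by exact_mod_cast ENat.natCast_lt_top n)) u).hasDerivAt
    refine (h1.congr_of_eventuallyEq ?_).congr_deriv ?_
    · filter_upwards [isOpen_Iio.mem_nhds hu] with v hv
      exact if_neg (not_le.2 hv)
    · simp only [k, if_neg (not_le.2 hu)]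
  have hk0 : ∀ n, k n 0 = (H n).1 0 := by intro n; simp [k]
  have hr2 : 0 < r ^ 2 / 2 := by positivity
  have hcont : ∀ n, ContinuousWithinAt (k n) (Ici 0) 0 := by
    intro n
    have h1 : ContinuousAt (fun u => (H n).1 (√(2 * u))) 0 := by
      refine ContinuousAt.comp (g := (H n).1) ?_ (by fun_prop)
      exact (hH n _ (hsq 0 hr2)).continuousAt
    exact h1.continuousWithinAt.congr (fun v hv => if_pos hv) (if_pos le_rfl)
  have hzero : ∀ n, HasDerivAt (k n) (k (n + 1) 0) 0 := by
    intro n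
    have hR : HasDerivWithinAt (k n) (k (n + 1) 0) (Ici 0) 0 := by
      refine hasDerivWithinAt_Ici_of_tendsto_deriv (s := Ioo 0 (r ^ 2 / 2))
        (fun u hu => (hpos n u hu).differentiableAt.differentiableWithinAt)
        ((hcont n).mono fun u hu => hu.1.le) (Ioo_mem_nhdsGT hr2) ?_
      have h1 : Tendsto (k (n + 1)) (𝓝[>] 0) (𝓝 (k (n + 1) 0)) :=
        (hcont (n + 1)).mono_left (nhdsWithin_mono _ Ioi_subset_Ici_self)
      refine h1.congr' ?_
      filter_upwards [Ioo_mem_nhdsGT hr2] with u hu using (hpos n u hu).deriv.symm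
    have hL : HasDerivWithinAt (k n) (k (n + 1) 0) (Iic 0) 0 := by
      have h1 : HasDerivAt (iteratedDeriv n b) (iteratedDeriv (n + 1) b 0) 0 := by
        rw [iteratedDeriv_succ]
        exact ((hbs.differentiable_iteratedDeriv n (by exact_mod_cast ENat.natCast_lt_top n)) 0).hasDerivAt
      rw [hb, ← hk0] at h1
      refine h1.hasDerivWithinAt.congr_of_mem (fun v hv => ?_) (mem_Iic.2 le_rfl)
      rcases (mem_Iic.1 hv).lt_or_eq with h | h
      · exact if_neg (not_le.2 h)
      · rw [h, hk0, hb]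
    have := hL.union hR
    rwa [Iic_union_Ici, hasDerivWithinAt_univ] at this
  have hall : ∀ n, ∀ u ∈ Iio (r ^ 2 / 2), HasDerivAt (k n) (k (n + 1) u) u := by
    intro n u hu
    rcases lt_trichotomy u 0 with h | rfl | h
    · exact hneg n u h
    · exact hzero n
    · exact hpos n u ⟨h, hu⟩
  have hsm : ∀ m : ℕ, ∀ n, ContDiffOn ℝ m (k n) (Iio (r ^ 2 / 2)) := by
    intro m
    induction m with
    | zero => exact fun n => contDiffOn_zero.2 fun u hu => (hall n u hu).continuousAt.continuousWithinAt
    | succ m ih =>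
      intro n
      push_cast
      rw [contDiffOn_succ_iff_deriv_of_isOpen isOpen_Iio]
      exact ⟨fun u hu => (hall n u hu).differentiableAt.differentiableWithinAt, by simp,
        (ih (n + 1)).congr fun u hu => (hall n u hu).deriv⟩
  refine ⟨k 0, contDiffOn_infty.2 fun m => hsm m 0, fun t ht => ?_⟩
  have h1 : k 0 (t ^ 2 / 2) = h (√(2 * (t ^ 2 / 2))) := if_pos (by positivity)
  rw [h1, show 2 * (t ^ 2 / 2) = t ^ 2 by ring, Real.sqrt_sq_eq_abs]
  rcases abs_choice t with h | h <;> rw [h]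
  exact (he t ht).symm

@[simp] theorem pt_apply_zero (x y z : ℝ) : pt x y z 0 = x := by simp [pt]
@[simp] theorem pt_apply_one (x y z : ℝ) : pt x y z 1 = y := by simp [pt]
@[simp] theorem pt_apply_two (x y z : ℝ) : pt x y z 2 = z := by simp [pt]

theorem R3.ext {u v : R3} (h0 : u 0 = v 0) (h1 : u 1 = v 1) (h2 : u 2 = v 2) : u = v := by
  ext i; fin_cases i <;> assumption

theorem ContDiffOn.pt {E : Type} [NormedAddCommGroup E] [NormedSpace ℝ E] {s : Set E} {n : ℕ∞ω}
    {f g h : E → ℝ} (hf : ContDiffOn ℝ n f s) (hg : ContDiffOn ℝ n g s) (hh : ContDiffOn ℝ n h s) :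
    ContDiffOn ℝ n (fun x => pt (f x) (g x) (h x)) s := by
  rw [contDiffOn_euclidean]
  intro i
  fin_cases i
  · simpa using hf
  · simpa using hg
  · simpa using hh

theorem contDiff_coord {n : ℕ∞ω} (i : Fin 3) : ContDiff ℝ n fun q : R3 => q i :=
  (EuclideanSpace.proj i : R3 →L[ℝ] ℝ).contDiff

theorem continuous_coord (i : Fin 3) : Continuous fun q : R3 => q i :=
  (contDiff_coord (n := 0) i).continuous

/-- The vertical unit vector. -/
def ez : R3 := pt 0 0 1

/-- The generator of rotations about the vertical axis. -/
def vrot (q : R3) : R3 := pt (-(q 1)) (q 0) 0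

/-- Half of the squared distance to the vertical axis. -/
def halfSq (q : R3) : ℝ := (q 0 ^ 2 + q 1 ^ 2) / 2

/-- The projection to the horizontal plane. -/
def hproj : R3 →L[ℝ] R3 :=
  LinearMap.toContinuousLinearMap
    { toFun := fun q => pt (q 0) (q 1) 0
      map_add' := fun u v => R3.ext (by simp) (by simp) (by simp)
      map_smul' := fun c u => R3.ext (by simp) (by simp) (by simp) }

/-- The rotation of angle `t` about the vertical axis. -/
def rotz (t : ℝ) : R3 →L[ℝ] R3 :=
  LinearMap.toContinuousLinearMap
    { toFun := fun q => pt (Real.cos t * q 0 - Real.sin t * q 1) (Real.sin t * q 0 + Real.cos t * q 1) (q 2)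
      map_add' := fun u v => R3.ext (by simp; ring) (by simp; ring) (by simp)
      map_smul' := fun c u => R3.ext (by simp; ring) (by simp; ring) (by simp) }

theorem hproj_apply (q : R3) : hproj q = pt (q 0) (q 1) 0 := rfl

theorem rotz_apply (t : ℝ) (q : R3) : rotz t q =
    pt (Real.cos t * q 0 - Real.sin t * q 1) (Real.sin t * q 0 + Real.cos t * q 1) (q 2) := rfl

@[simp] theorem ez_zero : ez 0 = 0 := by simp [ez]
@[simp] theorem ez_one : ez 1 = 0 := by simp [ez]
@[simp] theorem ez_two : ez 2 = 1 := by simp [ez]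
@[simp] theorem vrot_zero (q : R3) : vrot q 0 = -(q 1) := by simp [vrot]
@[simp] theorem vrot_one (q : R3) : vrot q 1 = q 0 := by simp [vrot]
@[simp] theorem vrot_two (q : R3) : vrot q 2 = 0 := by simp [vrot]
@[simp] theorem hproj_zero (q : R3) : hproj q 0 = q 0 := by simp [hproj_apply]
@[simp] theorem hproj_one (q : R3) : hproj q 1 = q 1 := by simp [hproj_apply]
@[simp] theorem hproj_two (q : R3) : hproj q 2 = 0 := by simp [hproj_apply]
@[simp] theorem rotz_zero' (t : ℝ) (q : R3) : rotz t q 0 = Real.cos t * q 0 - Real.sin t * q 1 := by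
  simp [rotz_apply]
@[simp] theorem rotz_one (t : ℝ) (q : R3) : rotz t q 1 = Real.sin t * q 0 + Real.cos t * q 1 := by
  simp [rotz_apply]
@[simp] theorem rotz_two (t : ℝ) (q : R3) : rotz t q 2 = q 2 := by simp [rotz_apply]

theorem hproj_add_smul_ez (q : R3) : hproj q + q 2 • ez = q := R3.ext (by simp) (by simp) (by simp)

theorem mem_Dset {r : ℝ} {q : R3} : q ∈ Dset r ↔ q 0 ^ 2 + q 1 ^ 2 < r ^ 2 := Iff.rfl

theorem isOpen_Dset (r : ℝ) : IsOpen (Dset r) :=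
  isOpen_lt (((continuous_coord 0).pow 2).add ((continuous_coord 1).pow 2)) continuous_const

theorem Dset_mono {r r' : ℝ} (h0 : 0 ≤ r) (h : r ≤ r') : Dset r ⊆ Dset r' := fun q hq => by
  have : q 0 ^ 2 + q 1 ^ 2 < r ^ 2 := hq
  exact this.trans_le (pow_le_pow_left₀ h0 h 2)

theorem halfSq_mem_Iio {r : ℝ} {q : R3} (hq : q ∈ Dset r) : halfSq q ∈ Iio (r ^ 2 / 2) := by
  have : q 0 ^ 2 + q 1 ^ 2 < r ^ 2 := hq
  simp only [halfSq, mem_Iio]; linarith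

theorem mem_Dset_of_halfSq_eq {r : ℝ} {q q' : R3} (h : halfSq q = halfSq q') (hq : q' ∈ Dset r) :
    q ∈ Dset r := by
  have h1 := halfSq_mem_Iio hq
  rw [← h] at h1
  simp only [halfSq, mem_Iio] at h1
  rw [mem_Dset]; linarith

theorem halfSq_add_smul_ez (q : R3) (t : ℝ) : halfSq (q + t • ez) = halfSq q := by simp [halfSq]

theorem halfSq_hproj_add (q : R3) (t : ℝ) : halfSq (hproj q + t • ez) = halfSq q := by simp [halfSq]

theorem halfSq_hproj (q : R3) : halfSq (hproj q) = halfSq q := by simp [halfSq]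

theorem halfSq_rotz (t : ℝ) (q : R3) : halfSq (rotz t q) = halfSq q := by
  simp only [halfSq, rotz_zero', rotz_one]
  linear_combination (q 0 ^ 2 + q 1 ^ 2) / 2 * Real.sin_sq_add_cos_sq t

theorem add_smul_ez_mem_Dset {r : ℝ} {q : R3} (hq : q ∈ Dset r) (t : ℝ) : q + t • ez ∈ Dset r :=
  mem_Dset_of_halfSq_eq (halfSq_add_smul_ez q t) hq

theorem hproj_add_mem_Dset {r : ℝ} {q : R3} (hq : q ∈ Dset r) (t : ℝ) :
    hproj q + t • ez ∈ Dset r := mem_Dset_of_halfSq_eq (halfSq_hproj_add q t) hq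

theorem hproj_mem_Dset {r : ℝ} {q : R3} (hq : q ∈ Dset r) : hproj q ∈ Dset r :=
  mem_Dset_of_halfSq_eq (halfSq_hproj q) hq

theorem rotz_mem_Dset {r : ℝ} {q : R3} (hq : q ∈ Dset r) (t : ℝ) : rotz t q ∈ Dset r :=
  mem_Dset_of_halfSq_eq (halfSq_rotz t q) hq

theorem axis_mem_Dset {r : ℝ} (hr : 0 < r) (t : ℝ) : t • ez ∈ Dset r := by
  simp [mem_Dset]; positivity

theorem contDiff_halfSq {n : ℕ∞ω} : ContDiff ℝ n halfSq :=
  (((contDiff_coord 0).pow 2).add ((contDiff_coord 1).pow 2)).div_const 2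

theorem rotz_vrot (t : ℝ) (q : R3) : rotz t (vrot q) = vrot (rotz t q) :=
  R3.ext (by simp; ring) (by simp; ring) (by simp)

@[simp] theorem rotz_ez (t : ℝ) : rotz t ez = ez := R3.ext (by simp) (by simp) (by simp)

@[simp] theorem rotz_angle_zero (q : R3) : rotz 0 q = q := R3.ext (by simp) (by simp) (by simp)

@[simp] theorem rotz_two_pi (q : R3) : rotz (2 * Real.pi) q = q :=
  R3.ext (by simp) (by simp) (by simp)

@[simp] theorem hproj_ez : hproj ez = 0 := R3.ext (by simp) (by simp) (by simp)

theorem vrot_add_smul_ez (q : R3) (t : ℝ) : vrot (q + t • ez) = vrot q :=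
  R3.ext (by simp) (by simp) (by simp)

theorem vrot_hproj_add (q : R3) (t : ℝ) : vrot (hproj q + t • ez) = vrot q :=
  R3.ext (by simp) (by simp) (by simp)

theorem hproj_vrot (q : R3) : hproj (vrot q) = vrot q :=
  R3.ext (by simp) (by simp) (by simp)

theorem hasDerivAt_pt {f g h : ℝ → ℝ} {f' g' h' t : ℝ} (hf : HasDerivAt f f' t)
    (hg : HasDerivAt g g' t) (hh : HasDerivAt h h' t) :
    HasDerivAt (fun t => pt (f t) (g t) (h t)) (pt f' g' h') t := by
  have : HasDerivAt (fun t => (![f t, g t, h t] : Fin 3 → ℝ)) ![f', g', h'] t := by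
    rw [hasDerivAt_pi]
    intro i
    fin_cases i
    · simpa using hf
    · simpa using hg
    · simpa using hh
  exact ((EuclideanSpace.equiv (Fin 3) ℝ).symm.hasFDerivAt.comp_hasDerivAt t this :)

theorem hasDerivAt_rotz (t : ℝ) (q : R3) : HasDerivAt (fun t => rotz t q) (vrot (rotz t q)) t := by
  have hc := Real.hasDerivAt_cos t
  have hs := Real.hasDerivAt_sin t
  have := hasDerivAt_pt ((hc.mul_const (q 0)).sub (hs.mul_const (q 1)))
    ((hs.mul_const (q 0)).add (hc.mul_const (q 1))) (hasDerivAt_const t (q 2))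
  refine this.congr_deriv (R3.ext ?_ ?_ ?_) <;> simp <;> ring

theorem hasDerivAt_add_smul_ez (q : R3) (t : ℝ) : HasDerivAt (fun t : ℝ => q + t • ez) ez t := by
  simpa using ((hasDerivAt_id t).smul_const ez).const_add q

theorem contDiff_rotz_uncurry {n : ℕ∞ω} : ContDiff ℝ n fun z : R3 × ℝ => rotz z.2 z.1 := by
  have h0 : ContDiff ℝ n fun z : R3 × ℝ => z.1 0 := (contDiff_coord 0).comp contDiff_fst
  have h1 : ContDiff ℝ n fun z : R3 × ℝ => z.1 1 := (contDiff_coord 1).comp contDiff_fst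
  have h2 : ContDiff ℝ n fun z : R3 × ℝ => z.1 2 := (contDiff_coord 2).comp contDiff_fst
  have hc : ContDiff ℝ n fun z : R3 × ℝ => Real.cos z.2 := Real.contDiff_cos.comp contDiff_snd
  have hs : ContDiff ℝ n fun z : R3 × ℝ => Real.sin z.2 := Real.contDiff_sin.comp contDiff_snd
  rw [← contDiffOn_univ] at *
  exact ContDiffOn.pt ((hc.mul h0).sub (hs.mul h1)) ((hs.mul h0).add (hc.mul h1)) h2

theorem ContDiffOn.hasFDerivAt' {E G : Type} [NormedAddCommGroup E] [NormedSpace ℝ E]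
    [NormedAddCommGroup G] [NormedSpace ℝ G] {s : Set E} {f : E → G}
    (hf : ContDiffOn ℝ ∞ f s) (hs : IsOpen s) {x : E} (hx : x ∈ s) :
    HasFDerivAt f (fderiv ℝ f x) x :=
  ((hf.contDiffAt (hs.mem_nhds hx)).differentiableAt (by simp)).hasFDerivAt

theorem hasDerivAt_comp_rotz {r : ℝ} {f : R3 → ℝ} (hf : ContDiffOn ℝ ∞ f (Dset r)) {q : R3}
    (hq : q ∈ Dset r) (t : ℝ) :
    HasDerivAt (fun t => f (rotz t q)) (fderiv ℝ f (rotz t q) (vrot (rotz t q))) t :=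
  (hf.hasFDerivAt' (isOpen_Dset r) (rotz_mem_Dset hq t)).comp_hasDerivAt t (hasDerivAt_rotz t q)

theorem hasDerivAt_comp_add_ez {r : ℝ} {f : R3 → ℝ} (hf : ContDiffOn ℝ ∞ f (Dset r)) {q : R3}
    (hq : q ∈ Dset r) (t : ℝ) :
    HasDerivAt (fun t : ℝ => f (q + t • ez)) (fderiv ℝ f (q + t • ez) ez) t :=
  (hf.hasFDerivAt' (isOpen_Dset r) (add_smul_ez_mem_Dset hq t)).comp_hasDerivAt t
    (hasDerivAt_add_smul_ez q t)

theorem exists_polar (q : R3) : ∃ t, q = rotz t (pt √(q 0 ^ 2 + q 1 ^ 2) 0 (q 2)) := by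
  let z : ℂ := ⟨q 0, q 1⟩
  have hz : ‖z‖ = √(q 0 ^ 2 + q 1 ^ 2) := by
    rw [Complex.norm_def, Complex.normSq_mk]; ring_nf
  refine ⟨z.arg, R3.ext ?_ ?_ (by simp)⟩
  · have := Complex.norm_mul_cos_arg z
    rw [hz] at this
    simp [mul_comm (Real.cos _), this, z]
  · have := Complex.norm_mul_sin_arg z
    rw [hz] at this
    simp [mul_comm (Real.sin _), this, z]

/-- A smooth function invariant under rotations and vertical translations is a smooth function of
`(x² + y²) / 2`. -/
theorem exists_smooth_comp_halfSq {r : ℝ} (hr : 0 < r) {I : R3 → ℝ} (hI : ContDiffOn ℝ ∞ I (Dset r))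
    (hrot : ∀ q ∈ Dset r, fderiv ℝ I q (vrot q) = 0) (hez : ∀ q ∈ Dset r, fderiv ℝ I q ez = 0) :
    ∃ k : ℝ → ℝ, ContDiffOn ℝ ∞ k (Iio (r ^ 2 / 2)) ∧ ∀ q ∈ Dset r, I q = k (halfSq q) := by
  have hR : ∀ q ∈ Dset r, ∀ t, I (rotz t q) = I q := by
    intro q hq t
    have hd := fun t => hasDerivAt_comp_rotz hI hq t
    have := is_const_of_deriv_eq_zero (fun t => (hd t).differentiableAt)
      (fun t => by rw [(hd t).deriv]; exact hrot _ (rotz_mem_Dset hq t)) t 0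
    simpa using this
  have hZ : ∀ q ∈ Dset r, ∀ t : ℝ, I (q + t • ez) = I q := by
    intro q hq t
    have hd := fun t => hasDerivAt_comp_add_ez hI hq t
    have := is_const_of_deriv_eq_zero (fun t => (hd t).differentiableAt)
      (fun t => by rw [(hd t).deriv]; exact hez _ (add_smul_ez_mem_Dset hq t)) t 0
    simpa using this
  have hmem : ∀ x ∈ Ioo (-r) r, pt x 0 0 ∈ Dset r := by
    intro x hx
    simp only [mem_Dset, pt_apply_zero, pt_apply_one]
    nlinarith [hx.1, hx.2]
  have hsm : ContDiffOn ℝ ∞ (fun x => I (pt x 0 0)) (Ioo (-r) r) :=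
    hI.comp (ContDiffOn.pt contDiffOn_id contDiffOn_const contDiffOn_const) hmem
  obtain ⟨k, hk, hIk⟩ := exists_smooth_comp_sq_of_even hr hsm (by
    intro x hx
    rw [← hR _ (hmem x hx) Real.pi]
    congr 1
    exact R3.ext (by simp) (by simp) (by simp))
  refine ⟨k, hk, fun q hq => ?_⟩
  have hsq : √(q 0 ^ 2 + q 1 ^ 2) ∈ Ioo (-r) r :=
    ⟨by linarith [Real.sqrt_nonneg (q 0 ^ 2 + q 1 ^ 2)], by rw [Real.sqrt_lt' hr]; exact hq⟩
  have h1 := hIk _ hsq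
  rw [Real.sq_sqrt (by positivity)] at h1
  have h2 : halfSq q = (q 0 ^ 2 + q 1 ^ 2) / 2 := rfl
  rw [h2, ← h1, ← hZ _ (hmem _ hsq) (q 2)]
  obtain ⟨t, ht⟩ := exists_polar q
  have h3 : pt √(q 0 ^ 2 + q 1 ^ 2) 0 0 + q 2 • ez = pt √(q 0 ^ 2 + q 1 ^ 2) 0 (q 2) :=
    R3.ext (by simp) (by simp) (by simp)
  have h4 : pt √(q 0 ^ 2 + q 1 ^ 2) 0 (q 2) ∈ Dset r := h3 ▸ add_smul_ez_mem_Dset (hmem _ hsq) _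
  rw [h3, ← hR _ h4 t, ← ht]

theorem continuous_fderiv_comp_rotz {r : ℝ} {f : R3 → ℝ} (hf : ContDiffOn ℝ ∞ f (Dset r)) {q : R3}
    (hq : q ∈ Dset r) (v : R3) : Continuous fun t => fderiv ℝ f (rotz t q) (rotz t v) := by
  have hc : ∀ v : R3, Continuous fun t => rotz t v := fun v =>
    continuous_iff_continuousAt.2 fun t => (hasDerivAt_rotz t v).continuousAt
  exact ((hf.continuousOn_fderiv_of_isOpen (isOpen_Dset r) (by simp)).comp_continuous (hc q)
    (rotz_mem_Dset hq)).clm_apply (hc v)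

theorem continuous_fderiv_comp_add_ez {r : ℝ} {f : R3 → ℝ} (hf : ContDiffOn ℝ ∞ f (Dset r)) {q : R3}
    (hq : q ∈ Dset r) (v : R3) : Continuous fun t : ℝ => fderiv ℝ f (q + t • ez) v :=
  ((hf.continuousOn_fderiv_of_isOpen (isOpen_Dset r) (by simp)).comp_continuous (by fun_prop)
    (add_smul_ez_mem_Dset hq)).clm_apply continuous_const

theorem continuous_comp_rotz {r : ℝ} {f : R3 → ℝ} (hf : ContDiffOn ℝ ∞ f (Dset r)) {q : R3}
    (hq : q ∈ Dset r) : Continuous fun t => f (rotz t q) :=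
  continuous_iff_continuousAt.2 fun t => (hasDerivAt_comp_rotz hf hq t).continuousAt

theorem continuous_comp_add_ez {r : ℝ} {f : R3 → ℝ} (hf : ContDiffOn ℝ ∞ f (Dset r)) {q : R3}
    (hq : q ∈ Dset r) : Continuous fun t : ℝ => f (q + t • ez) :=
  continuous_iff_continuousAt.2 fun t => (hasDerivAt_comp_add_ez hf hq t).continuousAt

theorem integral_fderiv_rotz {r : ℝ} {f : R3 → ℝ} (hf : ContDiffOn ℝ ∞ f (Dset r)) {q : R3}
    (hq : q ∈ Dset r) (a b : ℝ) :
    ∫ t in a..b, fderiv ℝ f (rotz t q) (vrot (rotz t q)) = f (rotz b q) - f (rotz a q) := by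
  refine intervalIntegral.integral_eq_sub_of_hasDerivAt (fun t _ => hasDerivAt_comp_rotz hf hq t) ?_
  simp_rw [← rotz_vrot]
  exact (continuous_fderiv_comp_rotz hf hq _).intervalIntegrable _ _

theorem integral_fderiv_add_ez {r : ℝ} {f : R3 → ℝ} (hf : ContDiffOn ℝ ∞ f (Dset r)) {q : R3}
    (hq : q ∈ Dset r) (a b : ℝ) :
    ∫ t in a..b, fderiv ℝ f (q + t • ez) ez = f (q + b • ez) - f (q + a • ez) :=
  intervalIntegral.integral_eq_sub_of_hasDerivAt (fun t _ => hasDerivAt_comp_add_ez hf hq t)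
    ((continuous_fderiv_comp_add_ez hf hq _).intervalIntegrable _ _)

/-- The period of the angle along the axis. -/
def per : R3 := (2 * Real.pi) • ez

theorem add_per_mem_Dset {r : ℝ} {q : R3} (hq : q ∈ Dset r) : q + per ∈ Dset r :=
  add_smul_ez_mem_Dset hq _

theorem contDiffOn_vertical {r : ℝ} {f : R3 → ℝ} (hf : ContDiffOn ℝ ∞ f (Dset r)) :
    ContDiffOn ℝ ∞ (fun z : R3 × ℝ => f (hproj z.1 + z.2 • ez)) (Dset r ×ˢ univ) :=
  hf.comp ((hproj.contDiff.comp contDiff_fst).add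
    (contDiff_snd.smul contDiff_const)).contDiffOn fun _ hz => hproj_add_mem_Dset hz.1 _

theorem contDiffOn_circle {r : ℝ} {f : R3 → ℝ} (hf : ContDiffOn ℝ ∞ f (Dset r)) :
    ContDiffOn ℝ ∞ (fun z : R3 × ℝ => f (rotz z.2 z.1)) (Dset r ×ˢ univ) :=
  hf.comp contDiff_rotz_uncurry.contDiffOn fun _ hz => rotz_mem_Dset hz.1 _

theorem contDiffOn_vertical_mean {r : ℝ} {f : R3 → ℝ} (hf : ContDiffOn ℝ ∞ f (Dset r)) :
    ContDiffOn ℝ ∞ (fun q => (2 * Real.pi)⁻¹ * ∫ t in (0 : ℝ)..2 * Real.pi, f (hproj q + t • ez))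
      (Dset r) :=
  contDiffOn_const.mul
    (contDiffOn_intervalIntegral_param (isOpen_Dset r) (contDiffOn_vertical hf) _ _)

theorem contDiffOn_circle_mean {r : ℝ} {f : R3 → ℝ} (hf : ContDiffOn ℝ ∞ f (Dset r)) :
    ContDiffOn ℝ ∞ (fun q => (2 * Real.pi)⁻¹ * ∫ t in (0 : ℝ)..2 * Real.pi, f (rotz t q))
      (Dset r) :=
  contDiffOn_const.mul
    (contDiffOn_intervalIntegral_param (isOpen_Dset r) (contDiffOn_circle hf) _ _)

theorem exists_vertical_mean {r : ℝ} (hr : 0 < r) {A C : R3 → ℝ} (hA : ContDiffOn ℝ ∞ A (Dset r))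
    (hC : ContDiffOn ℝ ∞ C (Dset r)) (hCp : ∀ q ∈ Dset r, C (q + per) = C q)
    (hdiv : ∀ q ∈ Dset r, fderiv ℝ A q (vrot q) + fderiv ℝ C q ez = 0) :
    ∃ k : ℝ → ℝ, ContDiffOn ℝ ∞ k (Iio (r ^ 2 / 2)) ∧ ∀ q ∈ Dset r,
      (2 * Real.pi)⁻¹ * ∫ t in (0 : ℝ)..2 * Real.pi, A (hproj q + t • ez) = k (halfSq q) := by
  have key : ∀ q ∈ Dset r, ∀ v, fderiv ℝ
      (fun q => (2 * Real.pi)⁻¹ * ∫ t in (0 : ℝ)..2 * Real.pi, A (hproj q + t • ez)) q v =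
      (2 * Real.pi)⁻¹ * ∫ t in (0 : ℝ)..2 * Real.pi, fderiv ℝ A (hproj q + t • ez) (hproj v) := by
    intro q hq v
    have h1 := contDiffOn_intervalIntegral_param (isOpen_Dset r) (contDiffOn_vertical hA)
      0 (2 * Real.pi)
    rw [((h1.hasFDerivAt' (isOpen_Dset r) hq).const_mul _).fderiv]
    refine congrArg ((2 * Real.pi)⁻¹ * ·) ((fderiv_intervalIntegral_param_apply (isOpen_Dset r)
      (contDiffOn_vertical hA) _ _ hq v).trans ?_)
    refine intervalIntegral.integral_congr fun t _ => ?_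
    have h2 := (hA.hasFDerivAt' (isOpen_Dset r) (hproj_add_mem_Dset hq t)).comp q
      (hproj.hasFDerivAt.add_const (t • ez))
    exact congrArg (· v) h2.fderiv
  refine exists_smooth_comp_halfSq hr (contDiffOn_vertical_mean hA) ?_ ?_
  · intro q hq
    rw [key q hq, hproj_vrot]
    have : ∫ t in (0 : ℝ)..2 * Real.pi, fderiv ℝ A (hproj q + t • ez) (vrot q) =
        ∫ t in (0 : ℝ)..2 * Real.pi, -(fderiv ℝ C (hproj q + t • ez) ez) := by
      refine intervalIntegral.integral_congr fun t _ => ?_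
      have := hdiv _ (hproj_add_mem_Dset hq t)
      rw [vrot_hproj_add] at this
      linarith
    rw [this, intervalIntegral.integral_neg, integral_fderiv_add_ez hC (hproj_mem_Dset hq)]
    have := hCp _ (hproj_mem_Dset hq)
    rw [per] at this
    simp [this]
  · intro q hq
    rw [key q hq]; simp

theorem exists_circle_mean {r : ℝ} (hr : 0 < r) {A C : R3 → ℝ} (hA : ContDiffOn ℝ ∞ A (Dset r))
    (hC : ContDiffOn ℝ ∞ C (Dset r))
    (hdiv : ∀ q ∈ Dset r, fderiv ℝ A q (vrot q) + fderiv ℝ C q ez = 0) :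
    ∃ k : ℝ → ℝ, ContDiffOn ℝ ∞ k (Iio (r ^ 2 / 2)) ∧ ∀ q ∈ Dset r,
      (2 * Real.pi)⁻¹ * ∫ t in (0 : ℝ)..2 * Real.pi, C (rotz t q) = k (halfSq q) := by
  have key : ∀ q ∈ Dset r, ∀ v, fderiv ℝ
      (fun q => (2 * Real.pi)⁻¹ * ∫ t in (0 : ℝ)..2 * Real.pi, C (rotz t q)) q v =
      (2 * Real.pi)⁻¹ * ∫ t in (0 : ℝ)..2 * Real.pi, fderiv ℝ C (rotz t q) (rotz t v) := by
    intro q hq v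
    have h1 := contDiffOn_intervalIntegral_param (isOpen_Dset r) (contDiffOn_circle hC)
      0 (2 * Real.pi)
    rw [((h1.hasFDerivAt' (isOpen_Dset r) hq).const_mul _).fderiv]
    refine congrArg ((2 * Real.pi)⁻¹ * ·) ((fderiv_intervalIntegral_param_apply (isOpen_Dset r)
      (contDiffOn_circle hC) _ _ hq v).trans ?_)
    refine intervalIntegral.integral_congr fun t _ => ?_
    have h2 := (hC.hasFDerivAt' (isOpen_Dset r) (rotz_mem_Dset hq t)).comp q
      (rotz t).hasFDerivAt
    exact congrArg (· v) h2.fderiv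
  refine exists_smooth_comp_halfSq hr (contDiffOn_circle_mean hC) ?_ ?_
  · intro q hq
    rw [key q hq]
    simp_rw [rotz_vrot]
    rw [integral_fderiv_rotz hC hq]
    simp
  · intro q hq
    rw [key q hq]
    have : ∫ t in (0 : ℝ)..2 * Real.pi, fderiv ℝ C (rotz t q) (rotz t ez) =
        ∫ t in (0 : ℝ)..2 * Real.pi, -(fderiv ℝ A (rotz t q) (vrot (rotz t q))) := by
      refine intervalIntegral.integral_congr fun t _ => ?_
      have := hdiv _ (rotz_mem_Dset hq t)
      simp only [rotz_ez]; linarith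
    rw [this, intervalIntegral.integral_neg, integral_fderiv_rotz hA hq]
    simp

/-- A closed form with vanishing periods on a solid torus has a periodic potential. -/
theorem exists_periodic_potential {r : ℝ} {a c : R3 → ℝ}
    (ha : ContDiffOn ℝ ∞ a (Dset r)) (hc : ContDiffOn ℝ ∞ c (Dset r))
    (hcp : ∀ q ∈ Dset r, c (q + per) = c q)
    (hclosed : ∀ q ∈ Dset r, fderiv ℝ a q ez = fderiv ℝ c q (vrot q))
    (ha0 : ∀ q ∈ Dset r, ∫ t in (0 : ℝ)..2 * Real.pi, a (rotz t q) = 0)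
    (hc0 : ∀ q ∈ Dset r, ∫ t in (0 : ℝ)..2 * Real.pi, c (hproj q + t • ez) = 0) :
    ∃ f : R3 → ℝ, ContDiffOn ℝ ∞ f (Dset r) ∧ (∀ q ∈ Dset r, f (q + per) = f q) ∧
      (∀ q ∈ Dset r, fderiv ℝ f q (vrot q) = a q) ∧ (∀ q ∈ Dset r, fderiv ℝ f q ez = c q) := by
  have ho := isOpen_Dset r
  set I : R3 → ℝ := fun q => ∫ t in (0 : ℝ)..1, c (hproj q + (t * q 2) • ez) with hI
  set M : R3 → ℝ := fun q => ∫ t in (0 : ℝ)..2 * Real.pi, t * a (rotz t (hproj q)) with hM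
  have hFI : ContDiffOn ℝ ∞ (fun z : R3 × ℝ => c (hproj z.1 + (z.2 * z.1 2) • ez))
      (Dset r ×ˢ univ) :=
    hc.comp ((hproj.contDiff.comp contDiff_fst).add ((contDiff_snd.mul
      ((contDiff_coord 2).comp contDiff_fst)).smul contDiff_const)).contDiffOn
      fun _ hz => hproj_add_mem_Dset hz.1 _
  have hFM : ContDiffOn ℝ ∞ (fun z : R3 × ℝ => z.2 * a (rotz z.2 (hproj z.1)))
      (Dset r ×ˢ univ) :=
    contDiff_snd.contDiffOn.mul (ha.comp (contDiff_rotz_uncurry.comp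
      ((hproj.contDiff.comp contDiff_fst).prodMk contDiff_snd)).contDiffOn
      fun _ hz => rotz_mem_Dset (hproj_mem_Dset hz.1) _)
  have hIs : ContDiffOn ℝ ∞ I (Dset r) := contDiffOn_intervalIntegral_param ho hFI 0 1
  have hMs : ContDiffOn ℝ ∞ M (Dset r) := contDiffOn_intervalIntegral_param ho hFM 0 _
  set f : R3 → ℝ := fun q => q 2 * I q + (2 * Real.pi)⁻¹ * M q with hf
  have hfs : ContDiffOn ℝ ∞ f (Dset r) :=
    ((contDiff_coord 2).contDiffOn.mul hIs).add (contDiffOn_const.mul hMs)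
  have hfi : ∀ q, f q = (∫ t in (0 : ℝ)..q 2, c (hproj q + t • ez)) + (2 * Real.pi)⁻¹ * M q := by
    intro q
    have := intervalIntegral.mul_integral_comp_mul_right (a := 0) (b := 1)
      (f := fun t : ℝ => c (hproj q + t • ez)) (q 2)
    simp only [zero_mul, one_mul] at this
    simp only [hf, hI, this]
  refine ⟨f, hfs, ?_, ?_, ?_⟩
  · intro q hq
    have e1 : hproj (q + per) = hproj q := by simp [per]
    have e2 : (q + per) 2 = q 2 + 2 * Real.pi := by simp [per]
    have hcont := continuous_comp_add_ez hc (hproj_mem_Dset hq)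
    have hper : Function.Periodic (fun t : ℝ => c (hproj q + t • ez)) (2 * Real.pi) := fun t => by
      have := hcp _ (hproj_add_mem_Dset hq t)
      rw [per, add_assoc, ← add_smul] at this
      exact this
    rw [hfi, hfi, hM]
    simp only [e1, e2]
    rw [← intervalIntegral.integral_add_adjacent_intervals (hcont.intervalIntegrable 0 (q 2))
      (hcont.intervalIntegrable _ _), hper.intervalIntegral_add_eq (q 2) 0, zero_add, hc0 q hq,
      add_zero]
  · intro q hq
    have hd := (((EuclideanSpace.proj 2 : R3 →L[ℝ] ℝ).hasFDerivAt (x := q)).mul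
      (hIs.hasFDerivAt' ho hq)).add ((hMs.hasFDerivAt' ho hq).const_mul (2 * Real.pi)⁻¹)
    have hd' : fderiv ℝ f q (vrot q) = q 2 * fderiv ℝ I q (vrot q) + I q * vrot q 2
        + (2 * Real.pi)⁻¹ * fderiv ℝ M q (vrot q) := congrArg (· (vrot q)) hd.fderiv
    have h1 : q 2 * fderiv ℝ I q (vrot q) = a q - a (hproj q) := by
      rw [hI, fderiv_intervalIntegral_param_apply ho hFI _ _ hq]
      have : ∀ t : ℝ, fderiv ℝ (fun y => c (hproj y + (t * y 2) • ez)) q (vrot q) =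
          fderiv ℝ a (hproj q + (t * q 2) • ez) ez := by
        intro t
        have h2 := (hc.hasFDerivAt' ho (hproj_add_mem_Dset hq (t * q 2))).comp q
          (hproj.hasFDerivAt.add ((((EuclideanSpace.proj 2 : R3 →L[ℝ] ℝ).hasFDerivAt
            (x := q)).const_mul t).smul_const ez))
        rw [hclosed _ (hproj_add_mem_Dset hq _), vrot_hproj_add]
        refine (congrArg (· (vrot q)) h2.fderiv).trans ?_
        simp [hproj_vrot]
      simp_rw [this]
      have := intervalIntegral.mul_integral_comp_mul_right (a := 0) (b := 1)
        (f := fun t : ℝ => fderiv ℝ a (hproj q + t • ez) ez) (q 2)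
      simp only [zero_mul, one_mul] at this
      rw [this, integral_fderiv_add_ez ha (hproj_mem_Dset hq), hproj_add_smul_ez]
      simp
    have h3 : fderiv ℝ M q (vrot q) = 2 * Real.pi * a (hproj q) := by
      rw [hM, fderiv_intervalIntegral_param_apply ho hFM _ _ hq]
      have hq' := hproj_mem_Dset hq
      have : ∀ t : ℝ, fderiv ℝ (fun y => t * a (rotz t (hproj y))) q (vrot q) =
          t * fderiv ℝ a (rotz t (hproj q)) (rotz t (vrot (hproj q))) := by
        intro t
        have h2 := ((ha.hasFDerivAt' ho (rotz_mem_Dset hq' t)).comp q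
          ((rotz t).hasFDerivAt.comp q hproj.hasFDerivAt)).const_mul t
        refine (congrArg (· (vrot q)) h2.fderiv).trans ?_
        have : vrot (hproj q) = vrot q := R3.ext (by simp) (by simp) (by simp)
        simp [hproj_vrot, this]
      simp_rw [this]
      have hd : ∀ t : ℝ, HasDerivAt (fun t => t * a (rotz t (hproj q)))
          (a (rotz t (hproj q)) + t * fderiv ℝ a (rotz t (hproj q)) (rotz t (vrot (hproj q)))) t := by
        intro t
        have := (hasDerivAt_id t).mul (hasDerivAt_comp_rotz ha hq' t)
        rw [rotz_vrot]
        simpa [Pi.mul_def] using this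
      have hc1 := continuous_comp_rotz ha hq'
      have hc2 := continuous_id.mul (continuous_fderiv_comp_rotz ha hq' (vrot (hproj q)))
      have h4 := intervalIntegral.integral_eq_sub_of_hasDerivAt (fun t _ => hd t)
        ((hc1.add hc2).intervalIntegrable 0 (2 * Real.pi))
      have h5 := intervalIntegral.integral_add (hc1.intervalIntegrable 0 (2 * Real.pi))
        (hc2.intervalIntegrable (μ := MeasureTheory.volume) 0 (2 * Real.pi))
      rw [show (∫ t in (0 : ℝ)..2 * Real.pi, (a (rotz t (hproj q)) +
        t * fderiv ℝ a (rotz t (hproj q)) (rotz t (vrot (hproj q))))) = _ from h5, ha0 _ hq'] at h4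
      simpa using h4
    rw [hd', h1, h3]
    have : (2 * Real.pi)⁻¹ * (2 * Real.pi * a (hproj q)) = a (hproj q) := by
      field_simp
    rw [this]; simp
  · intro q hq
    have h1 : HasDerivAt (fun t : ℝ => f (q + t • ez)) (fderiv ℝ f q ez) 0 := by
      simpa using hasDerivAt_comp_add_ez hfs hq 0
    have hcont := continuous_comp_add_ez hc (hproj_mem_Dset hq)
    have h2 : HasDerivAt (fun t : ℝ => f (q + t • ez)) (c q) 0 := by
      have e : (fun t : ℝ => f (q + t • ez)) = fun t : ℝ =>
          (∫ s in (0 : ℝ)..q 2 + t, c (hproj q + s • ez)) + (2 * Real.pi)⁻¹ * M q := by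
        funext t
        rw [hfi, hM]
        simp
      rw [e]
      have h3 := (hcont.integral_hasStrictDerivAt 0 (q 2 + 0)).hasDerivAt
      have h4 := (h3.comp_const_add (q 2) 0).add_const ((2 * Real.pi)⁻¹ * M q)
      simpa [hproj_add_smul_ez] using h4
    exact h1.unique h2

theorem add_smul_per_mem_Dset {r : ℝ} {q : R3} (hq : q ∈ Dset r) (t : ℝ) : q + t • per ∈ Dset r := by
  rw [per, smul_smul]; exact add_smul_ez_mem_Dset hq _

@[simp] theorem per_zero : per 0 = 0 := by simp [per]
@[simp] theorem per_one : per 1 = 0 := by simp [per]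
@[simp] theorem per_two : per 2 = 2 * Real.pi := by simp [per]

theorem apply_add_int_smul_per {X : Type*} {r : ℝ} {f : R3 → X}
    (hf : ∀ q ∈ Dset r, f (q + per) = f q) (n : ℤ) :
    ∀ q ∈ Dset r, f (q + (n : ℝ) • per) = f q := by
  induction n using Int.induction_on with
  | zero => simp
  | succ n ih =>
    intro q hq
    rw [← ih q hq, ← hf (q + ((n : ℤ) : ℝ) • per) (add_smul_per_mem_Dset hq _)]
    push_cast
    rw [add_smul, one_smul, add_assoc]
  | pred n ih =>
    intro q hq
    rw [← ih q hq, ← hf _ (add_smul_per_mem_Dset hq _)]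
    push_cast
    rw [sub_smul, one_smul, add_assoc, sub_add_cancel]

theorem fderiv_add_per {G : Type*} [NormedAddCommGroup G] [NormedSpace ℝ G] {r : ℝ} {f : R3 → G}
    (hf : ∀ q ∈ Dset r, f (q + per) = f q) {q : R3} (hq : q ∈ Dset r) :
    fderiv ℝ f (q + per) = fderiv ℝ f q := by
  rw [← fderiv_comp_add_right]
  refine Filter.EventuallyEq.fderiv_eq ?_
  filter_upwards [(isOpen_Dset r).mem_nhds hq] with y hy using hf y hy

/-- Every point can be translated vertically into a fundamental domain. -/
theorem exists_int_add_mem (q : R3) : ∃ n : ℤ, (q + (n : ℝ) • per) 2 ∈ Icc 0 (2 * Real.pi) := by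
  refine ⟨-⌊q 2 / (2 * Real.pi)⌋, ?_⟩
  have h1 := Int.floor_le (q 2 / (2 * Real.pi))
  have h2 := Int.lt_floor_add_one (q 2 / (2 * Real.pi))
  have h0 := Real.two_pi_pos
  rw [le_div_iff₀ h0] at h1
  rw [div_lt_iff₀ h0] at h2
  simp
  constructor <;> linarith

/-- An open set containing a segment of the axis contains a cylinder around it. -/
theorem exists_segment_tube {S : Set R3} (hS : IsOpen S) {a b : ℝ}
    (h : ∀ t ∈ Icc a b, t • ez ∈ S) :
    ∃ r > 0, ∀ q ∈ Dset r, q 2 ∈ Icc a b → q ∈ S := by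
  have hK : IsCompact ((fun t : ℝ => t • ez) '' Icc a b) :=
    isCompact_Icc.image (continuous_id.smul continuous_const)
  obtain ⟨δ, hδ, hsub⟩ := hK.exists_thickening_subset_open hS (by
    rintro _ ⟨t, ht, rfl⟩; exact h t ht)
  refine ⟨δ, hδ, fun q hq hq2 => hsub ?_⟩
  rw [Metric.mem_thickening_iff]
  refine ⟨q 2 • ez, ⟨_, hq2, rfl⟩, ?_⟩
  rw [EuclideanSpace.dist_eq, Real.sqrt_lt' hδ]
  have : q 0 ^ 2 + q 1 ^ 2 < δ ^ 2 := hq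
  simpa [Fin.sum_univ_three, Real.dist_eq] using this

/-- A periodic open set containing the axis contains a solid cylinder. -/
theorem exists_Dset_subset {S : Set R3} (hS : IsOpen S) (hax : ∀ t : ℝ, t • ez ∈ S)
    (hper : ∀ q, ∀ n : ℤ, q + (n : ℝ) • per ∈ S → q ∈ S) : ∃ r > 0, Dset r ⊆ S := by
  obtain ⟨r, hr, h⟩ := exists_segment_tube hS (a := 0) (b := 2 * Real.pi) (fun t _ => hax t)
  refine ⟨r, hr, fun q hq => ?_⟩
  obtain ⟨n, hn⟩ := exists_int_add_mem q
  exact hper q n (h _ (add_smul_per_mem_Dset hq _) hn)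

/-- A periodic open condition satisfied on the axis is satisfied on a solid cylinder. -/
theorem exists_Dset_subset_preimage {X : Type*} [TopologicalSpace X] {r : ℝ} (hr : 0 < r) {f : R3 → X}
    (hf : ContinuousOn f (Dset r)) (hper : ∀ q ∈ Dset r, f (q + per) = f q) {O : Set X} (hO : IsOpen O)
    (hax : ∀ t : ℝ, f (t • ez) ∈ O) : ∃ r' > 0, r' ≤ r ∧ ∀ q ∈ Dset r', f q ∈ O := by
  obtain ⟨r', hr', h⟩ := exists_Dset_subset (hf.isOpen_inter_preimage (isOpen_Dset r) hO)
    (fun t => ⟨axis_mem_Dset hr t, hax t⟩) (by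
      rintro q n ⟨h1, h2⟩
      have hq : q ∈ Dset r := by
        rw [mem_Dset] at h1 ⊢; simpa using h1
      refine ⟨hq, ?_⟩
      rw [mem_preimage, ← apply_add_int_smul_per hper n q hq]
      exact h2)
  exact ⟨min r' r, lt_min hr' hr, min_le_right _ _, fun q hq =>
    (h (Dset_mono (lt_min hr' hr).le (min_le_left _ _) hq)).2⟩

theorem exists_equiv_hasStrictFDerivAt {s : Set R3} (hs : IsOpen s) {f : R3 → R3}
    (hf : ContDiffOn ℝ ∞ f s) {q : R3} (hq : q ∈ s) (hdet : (fderiv ℝ f q).det ≠ 0) :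
    ∃ f' : R3 ≃L[ℝ] R3, HasStrictFDerivAt f (f' : R3 →L[ℝ] R3) q := by
  refine ⟨(fderiv ℝ f q).toContinuousLinearEquivOfDetNeZero hdet, ?_⟩
  rw [ContinuousLinearMap.coe_toContinuousLinearEquivOfDetNeZero]
  exact (hf.contDiffAt (hs.mem_nhds hq)).hasStrictFDerivAt (by simp)

/-- A smooth map with invertible differential is open. -/
theorem isOpen_image_of_det_ne_zero {s : Set R3} (hs : IsOpen s) {f : R3 → R3}
    (hf : ContDiffOn ℝ ∞ f s) (hdet : ∀ q ∈ s, (fderiv ℝ f q).det ≠ 0) : IsOpen (f '' s) := by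
  rw [isOpen_iff_mem_nhds]
  rintro _ ⟨q, hq, rfl⟩
  obtain ⟨f', hf'⟩ := exists_equiv_hasStrictFDerivAt hs hf hq (hdet q hq)
  rw [← hf'.map_nhds_eq_of_equiv]
  exact image_mem_map (hs.mem_nhds hq)

/-- A local diffeomorphism injective on a segment of the axis is injective nearby. -/
theorem exists_injOn_tube {r : ℝ} (hr : 0 < r) {f : R3 → R3} (hf : ContDiffOn ℝ ∞ f (Dset r))
    (hdet : ∀ t : ℝ, (fderiv ℝ f (t • ez)).det ≠ 0) {a b : ℝ}
    (hinj : ∀ s ∈ Icc a b, ∀ t ∈ Icc a b, f (s • ez) = f (t • ez) → s = t) :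
    ∃ r' > 0, InjOn f {q | q ∈ Dset r' ∧ q 2 ∈ Icc a b} := by
  have hK : IsCompact ((fun t : ℝ => t • ez) '' Icc a b) :=
    isCompact_Icc.image (continuous_id.smul continuous_const)
  obtain ⟨t, ht, hti⟩ := Set.InjOn.exists_mem_nhdsSet (f := f) (s := (fun t : ℝ => t • ez) '' Icc a b)
    (by rintro _ ⟨s, hs, rfl⟩ _ ⟨t, ht, rfl⟩ hst
        rw [hinj s hs t ht hst]) hK
    (by rintro _ ⟨s, hs, rfl⟩
        exact hf.continuousOn.continuousAt ((isOpen_Dset r).mem_nhds (axis_mem_Dset hr s)))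
    (by rintro _ ⟨s, hs, rfl⟩
        obtain ⟨f', hf'⟩ := exists_equiv_hasStrictFDerivAt (isOpen_Dset r) hf (axis_mem_Dset hr s)
          (hdet s)
        exact ⟨_, (hf'.toOpenPartialHomeomorph f).open_source.mem_nhds
          hf'.mem_toOpenPartialHomeomorph_source, (hf'.toOpenPartialHomeomorph f).injOn⟩)
  obtain ⟨S, hS, hKS, hSt⟩ := mem_nhdsSet_iff_exists.1 ht
  obtain ⟨r', hr', h⟩ := exists_segment_tube hS (a := a) (b := b) (fun t ht => hKS ⟨t, ht, rfl⟩)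
  exact ⟨r', hr', hti.mono fun q hq => hSt (h q hq.1 hq.2)⟩

theorem smul_ez_add_int_smul_per (t : ℝ) (n : ℤ) :
    t • ez + (n : ℝ) • per = (t + n * (2 * Real.pi)) • ez := by
  rw [per, smul_smul, add_smul]

/-- A periodic local diffeomorphism, injective modulo the period on the axis, is injective modulo the
period near the axis. -/
theorem exists_injective_mod_per {r : ℝ} (hr : 0 < r) {f : R3 → R3} (hf : ContDiffOn ℝ ∞ f (Dset r))
    (hper : ∀ q ∈ Dset r, f (q + per) = f q) (hdet : ∀ t : ℝ, (fderiv ℝ f (t • ez)).det ≠ 0)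
    (hinj : ∀ s t : ℝ, f (s • ez) = f (t • ez) → ∃ n : ℤ, s = t + n * (2 * Real.pi)) :
    ∃ r' > 0, r' ≤ r ∧ ∀ q ∈ Dset r', ∀ q' ∈ Dset r', f q = f q' →
      ∃ n : ℤ, q = q' + (n : ℝ) • per := by
  have hπ := Real.pi_pos
  have hseg : ∀ a : ℝ, ∃ r' > 0,
      InjOn f {q | q ∈ Dset r' ∧ q 2 ∈ Icc a (a + 3 / 2 * Real.pi)} := by
    intro a
    refine exists_injOn_tube hr hf hdet fun s hs t ht hst => ?_
    obtain ⟨n, hn⟩ := hinj s t hst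
    have h1 : n < 1 := by
      by_contra! h
      have : (1 : ℝ) ≤ n := by exact_mod_cast h
      nlinarith [hs.1, hs.2, ht.1, ht.2]
    have h2 : -1 < n := by
      by_contra! h
      have : (n : ℝ) ≤ -1 := by exact_mod_cast h
      nlinarith [hs.1, hs.2, ht.1, ht.2]
    have h3 : n = 0 := by omega
    simpa [h3] using hn
  obtain ⟨r1, hr1, h1⟩ := hseg 0
  obtain ⟨r2, hr2, h2⟩ := hseg (Real.pi / 2)
  obtain ⟨r3, hr3, h3⟩ := hseg (3 / 2 * Real.pi)
  set r' := min (min r1 r2) (min r3 r) with hr'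
  have hr'0 : 0 < r' := lt_min (lt_min hr1 hr2) (lt_min hr3 hr)
  have m1 : Dset r' ⊆ Dset r1 := Dset_mono hr'0.le ((min_le_left _ _).trans (min_le_left _ _))
  have m2 : Dset r' ⊆ Dset r2 := Dset_mono hr'0.le ((min_le_left _ _).trans (min_le_right _ _))
  have m3 : Dset r' ⊆ Dset r3 := Dset_mono hr'0.le ((min_le_right _ _).trans (min_le_left _ _))
  have m4 : Dset r' ⊆ Dset r := Dset_mono hr'0.le ((min_le_right _ _).trans (min_le_right _ _))
  -- both points in the fundamental domain
  have key : ∀ q ∈ Dset r', ∀ q' ∈ Dset r', q 2 ∈ Icc 0 (2 * Real.pi) → q' 2 ∈ Icc 0 (2 * Real.pi) →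
      q 2 ≤ q' 2 → f q = f q' → ∃ n : ℤ, q = q' + (n : ℝ) • per := by
    intro q hq q' hq' hI hI' hle he
    by_cases c1 : q' 2 ≤ 3 / 2 * Real.pi
    · refine ⟨0, ?_⟩
      have := h1 (x₁ := q) (x₂ := q') ⟨m1 hq, by constructor <;> linarith [hI.1]⟩
        ⟨m1 hq', by constructor <;> linarith [hI'.1]⟩ he
      simpa using this
    by_cases c2 : Real.pi / 2 ≤ q 2
    · refine ⟨0, ?_⟩
      have := h2 (x₁ := q) (x₂ := q') ⟨m2 hq, by constructor <;> linarith [hI.2]⟩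
        ⟨m2 hq', by constructor <;> linarith [hI'.2]⟩ he
      simpa using this
    · refine ⟨-1, ?_⟩
      have := h3 (x₁ := q + per) (x₂ := q')
        ⟨add_per_mem_Dset (m3 hq), by
          simp only [PiLp.add_apply, per_two]
          constructor <;> linarith [hI.1]⟩
        ⟨m3 hq', by constructor <;> linarith [hI'.2]⟩ ((hper q (m4 hq)).trans he)
      rw [← this]; simp
  refine ⟨r', hr'0, (min_le_right _ _).trans (min_le_right _ _), fun q hq q' hq' he => ?_⟩
  obtain ⟨n, hn⟩ := exists_int_add_mem q
  obtain ⟨n', hn'⟩ := exists_int_add_mem q'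
  have e1 := apply_add_int_smul_per hper n q (m4 hq)
  have e2 := apply_add_int_smul_per hper n' q' (m4 hq')
  have he' : f (q + (n : ℝ) • per) = f (q' + (n' : ℝ) • per) := by rw [e1, e2, he]
  have hm := add_smul_per_mem_Dset hq (n : ℝ)
  have hm' := add_smul_per_mem_Dset hq' (n' : ℝ)
  rcases le_total ((q + (n : ℝ) • per) 2) ((q' + (n' : ℝ) • per) 2) with h | h
  · obtain ⟨k, hk⟩ := key _ hm _ hm' hn hn' h he'
    refine ⟨n' + k - n, ?_⟩
    rw [eq_sub_of_add_eq hk]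
    push_cast
    module
  · obtain ⟨k, hk⟩ := key _ hm' _ hm hn' hn h he'.symm
    refine ⟨n' - k - n, ?_⟩
    have := eq_sub_of_add_eq hk.symm
    rw [eq_sub_of_add_eq this]
    push_cast
    module

/-- A local diffeomorphism commuting with the period and mapping the axis injectively to itself is
invertible near the axis. -/
theorem exists_inverse_near_axis {r : ℝ} (hr : 0 < r) {N : R3 → R3} (hN : ContDiffOn ℝ ∞ N (Dset r))
    (hper : ∀ q ∈ Dset r, N (q + per) = N q + per) (hdet : ∀ t : ℝ, (fderiv ℝ N (t • ez)).det ≠ 0)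
    (hax : ∀ t : ℝ, ∃ s : ℝ, N (t • ez) = s • ez)
    (hinj : ∀ s t : ℝ, N (s • ez) = N (t • ez) → s = t) :
    ∃ r' > 0, ∃ Ξ : R3 → R3, ContDiffOn ℝ ∞ Ξ (Dset r') ∧ (∀ q ∈ Dset r', Ξ q ∈ Dset r) ∧
      (∀ q ∈ Dset r', N (Ξ q) = q) ∧ (∀ q ∈ Dset r', Ξ (q + per) = Ξ q + per) ∧
      (∀ q ∈ Dset r', (fderiv ℝ N (Ξ q)).comp (fderiv ℝ Ξ q) = ContinuousLinearMap.id ℝ R3) ∧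
      (∀ t : ℝ, ∃ s : ℝ, Ξ (t • ez) = s • ez) ∧ (∀ s : ℝ, ∃ t : ℝ, Ξ (t • ez) = s • ez) := by
  have ho := isOpen_Dset r
  have hperI : ∀ n : ℤ, ∀ q ∈ Dset r, N (q + (n : ℝ) • per) = N q + (n : ℝ) • per := by
    intro n q hq
    have := apply_add_int_smul_per (f := fun q => N q - q)
      (fun q hq => by simp only [hper q hq]; abel) n q hq
    rw [sub_eq_sub_iff_add_eq_add] at this
    have h2 : N (q + (n : ℝ) • per) = N q + (q + (n : ℝ) • per) - q := eq_sub_of_add_eq this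
    rw [h2]; abel
  have hcN := hN.continuousOn
  -- nonvanishing Jacobian determinant
  obtain ⟨r1, hr1, hr1r, hdet1⟩ : ∃ r1 > 0, r1 ≤ r ∧ ∀ q ∈ Dset r1, (fderiv ℝ N q).det ≠ 0 := by
    refine exists_Dset_subset_preimage (f := fun q => (fderiv ℝ N q).det) (O := {x : ℝ | x ≠ 0}) hr
      (ContinuousLinearMap.continuous_det.comp_continuousOn
        (hN.continuousOn_fderiv_of_isOpen ho (by simp))) ?_ isOpen_ne hdet
    intro q hq
    have h1 : fderiv ℝ (fun q => N q - q) (q + per) = fderiv ℝ (fun q => N q - q) q :=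
      fderiv_add_per (fun q hq => by simp only [hper q hq]; abel) hq
    have h2 : ∀ q ∈ Dset r, fderiv ℝ (fun q => N q - q) q
        = fderiv ℝ N q - ContinuousLinearMap.id ℝ R3 := fun q hq =>
      ((hN.hasFDerivAt' ho hq).sub (hasFDerivAt_id q)).fderiv
    rw [h2 q hq, h2 _ (add_per_mem_Dset hq), sub_left_inj] at h1
    simp only [h1]
  -- bounded vertical displacement
  obtain ⟨M, hM⟩ : ∃ M : ℝ, ∀ t : ℝ, |N (t • ez) 2 - t| ≤ M := by
    have hc : Continuous fun t : ℝ => |N (t • ez) 2 - t| := by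
      have : Continuous fun t : ℝ => N (t • ez) :=
        hcN.comp_continuous (by fun_prop) (axis_mem_Dset hr)
      exact (((continuous_coord 2).comp this).sub continuous_id).abs
    obtain ⟨M, hM⟩ := (isCompact_Icc (a := (0 : ℝ)) (b := 2 * Real.pi)).bddAbove_image hc.continuousOn
    refine ⟨M, fun t => ?_⟩
    obtain ⟨n, hn⟩ := exists_int_add_mem (t • ez)
    have h1 := hperI n _ (axis_mem_Dset hr t)
    rw [smul_ez_add_int_smul_per] at h1 hn
    have h2 := hM ⟨_, (by simpa using hn : t + n * (2 * Real.pi) ∈ _), rfl⟩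
    simp only [h1] at h2
    simpa [add_sub_add_right_eq_sub] using h2
  obtain ⟨r2, hr2, hr2r, hM2⟩ : ∃ r2 > 0, r2 ≤ r ∧ ∀ q ∈ Dset r2, N q 2 - q 2 ∈ Ioo (-(M+1)) (M+1) := by
    refine exists_Dset_subset_preimage (f := fun q => N q 2 - q 2) hr
      (((continuous_coord 2).comp_continuousOn hcN).sub (continuous_coord 2).continuousOn) ?_
      isOpen_Ioo ?_
    · intro q hq
      simp only [hper q hq]; simp
    · intro t
      have := abs_le.1 (hM t)
      simp
      constructor <;> linarith
  obtain ⟨r3, hr3, hinj3⟩ := exists_injOn_tube hr hN hdet (a := -(2 * (M + 1)))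
    (b := 2 * Real.pi + 2 * (M + 1)) (fun s _ t _ => hinj s t)
  set ρ := min r1 (min r2 r3) with hρ
  have hρ0 : 0 < ρ := lt_min hr1 (lt_min hr2 hr3)
  have m1 : Dset ρ ⊆ Dset r1 := Dset_mono hρ0.le (min_le_left _ _)
  have m2 : Dset ρ ⊆ Dset r2 := Dset_mono hρ0.le ((min_le_right _ _).trans (min_le_left _ _))
  have m3 : Dset ρ ⊆ Dset r3 := Dset_mono hρ0.le ((min_le_right _ _).trans (min_le_right _ _))
  have m4 : Dset ρ ⊆ Dset r := m1.trans (Dset_mono hr1.le hr1r)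
  have hinjρ : InjOn N (Dset ρ) := by
    intro q hq q' hq' he
    obtain ⟨n, hn⟩ := exists_int_add_mem q
    have he' : N (q + (n : ℝ) • per) = N (q' + (n : ℝ) • per) := by
      rw [hperI n q (m4 hq), hperI n q' (m4 hq'), he]
    have hm := add_smul_per_mem_Dset hq (n : ℝ)
    have hm' := add_smul_per_mem_Dset hq' (n : ℝ)
    have b1 := hM2 _ (m2 hm)
    have b2 := hM2 _ (m2 hm')
    rw [← he'] at b2
    have := hinj3 (x₁ := q + (n : ℝ) • per) (x₂ := q' + (n : ℝ) • per)
      ⟨m3 hm, by constructor <;> linarith [b1.1, b1.2, b2.1, b2.2, hn.1, hn.2]⟩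
      ⟨m3 hm', by constructor <;> linarith [b1.1, b1.2, b2.1, b2.2, hn.1, hn.2]⟩ he'
    exact add_right_cancel this
  have hVo : IsOpen (N '' Dset ρ) :=
    isOpen_image_of_det_ne_zero (isOpen_Dset ρ) (hN.mono m4) fun q hq => hdet1 q (m1 hq)
  have haxV : ∀ s : ℝ, ∃ t : ℝ, N (t • ez) = s • ez := by
    intro s
    have hc : Continuous fun t : ℝ => N (t • ez) 2 :=
      (continuous_coord 2).comp (hcN.comp_continuous (by fun_prop) (axis_mem_Dset hr))
    obtain ⟨t, ht⟩ := mem_range_of_exists_le_of_exists_ge (c := s) hc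
      ⟨s - M, by linarith [(abs_le.1 (hM (s - M))).2]⟩ ⟨s + M, by linarith [(abs_le.1 (hM (s + M))).1]⟩
    obtain ⟨s', hs'⟩ := hax t
    simp only [hs'] at ht
    refine ⟨t, ?_⟩
    rw [hs', ← ht]; simp
  obtain ⟨r', hr', hsub⟩ := exists_Dset_subset hVo
    (fun s => by obtain ⟨t, ht⟩ := haxV s; exact ⟨_, axis_mem_Dset hρ0 t, ht⟩) (by
      rintro q n ⟨q', hq', he⟩
      refine ⟨q' + ((-n : ℤ) : ℝ) • per, add_smul_per_mem_Dset hq' _, ?_⟩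
      rw [hperI _ _ (m4 hq'), he]
      push_cast
      module)
  set Ξ := Function.invFunOn N (Dset ρ) with hΞ
  have hΞm : ∀ q ∈ Dset r', Ξ q ∈ Dset ρ := fun q hq => Function.invFunOn_mem (hsub hq)
  have hΞN : ∀ q ∈ Dset r', N (Ξ q) = q := fun q hq => Function.invFunOn_eq (hsub hq)
  have hΞs : ContDiffOn ℝ ∞ Ξ (Dset r') := by
    intro q hq
    refine ContDiffAt.contDiffWithinAt ?_
    have hq' := hΞm q hq
    have hd := hdet1 _ (m1 hq')
    have hca := hN.contDiffAt (ho.mem_nhds (m4 hq'))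
    have hfd : HasFDerivAt N (((fderiv ℝ N (Ξ q)).toContinuousLinearEquivOfDetNeZero hd :
        R3 ≃L[ℝ] R3) : R3 →L[ℝ] R3) (Ξ q) := by
      rw [ContinuousLinearMap.coe_toContinuousLinearEquivOfDetNeZero]
      exact hN.hasFDerivAt' ho (m4 hq')
    have hl := hca.to_localInverse hfd (by simp)
    have hst := hca.hasStrictFDerivAt' hfd (by simp)
    rw [hΞN q hq] at hl
    refine hl.congr_of_eventuallyEq ?_
    have e1 := hst.eventually_right_inverse
    have e2 : ∀ᶠ y in 𝓝 (N (Ξ q)), hst.localInverse N _ (Ξ q) y ∈ Dset ρ :=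
      hst.localInverse_tendsto ((isOpen_Dset ρ).mem_nhds hq')
    rw [hΞN q hq] at e1 e2
    filter_upwards [e1, e2, (isOpen_Dset r').mem_nhds hq] with y h1 h2 h3
    exact hinjρ (hΞm y h3) h2 ((hΞN y h3).trans h1.symm)
  have hΞax : ∀ t : ℝ, Ξ (N (t • ez)) = t • ez := by
    intro t
    obtain ⟨s, hs⟩ := hax t
    have h1 := axis_mem_Dset hr' s
    rw [hs]
    exact hinjρ (hΞm _ h1) (axis_mem_Dset hρ0 t) (by rw [hΞN _ h1, hs])
  refine ⟨r', hr', Ξ, hΞs, fun q hq => m4 (hΞm q hq), hΞN, ?_, ?_, ?_, ?_⟩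
  · intro q hq
    refine hinjρ (hΞm _ (add_per_mem_Dset hq)) (add_per_mem_Dset (hΞm q hq)) ?_
    rw [hΞN _ (add_per_mem_Dset hq), hper _ (m4 (hΞm q hq)), hΞN q hq]
  · intro q hq
    have h1 := (hN.hasFDerivAt' ho (m4 (hΞm q hq))).comp q (hΞs.hasFDerivAt' (isOpen_Dset r') hq)
    have h2 : HasFDerivAt (N ∘ Ξ) (ContinuousLinearMap.id ℝ R3) q := by
      refine (hasFDerivAt_id q).congr_of_eventuallyEq ?_
      filter_upwards [(isOpen_Dset r').mem_nhds hq] with y hy using hΞN y hy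
    exact h1.unique h2
  · intro t
    obtain ⟨s, hs⟩ := haxV t
    exact ⟨s, by rw [← hs, hΞax]⟩
  · intro s
    obtain ⟨t, ht⟩ := hax s
    exact ⟨t, by rw [← ht, hΞax]⟩

/-- The determinant of three vectors of `ℝ³`. -/
def det3 (u v w : R3) : ℝ :=
  u 0 * (v 1 * w 2 - v 2 * w 1) - u 1 * (v 0 * w 2 - v 2 * w 0) + u 2 * (v 0 * w 1 - v 1 * w 0)

theorem clm_det_eq_det3 (L : R3 →L[ℝ] R3) :
    L.det = det3 (L (pt 1 0 0)) (L (pt 0 1 0)) (L (pt 0 0 1)) := by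
  have hb : ∀ i, (EuclideanSpace.basisFun (Fin 3) ℝ).toBasis i = EuclideanSpace.single i (1 : ℝ) := by
    intro i; simp
  have h0 : EuclideanSpace.single (0 : Fin 3) (1 : ℝ) = pt 1 0 0 :=
    R3.ext (by simp) (by simp) (by simp)
  have h1 : EuclideanSpace.single (1 : Fin 3) (1 : ℝ) = pt 0 1 0 :=
    R3.ext (by simp) (by simp) (by simp)
  have h2 : EuclideanSpace.single (2 : Fin 3) (1 : ℝ) = pt 0 0 1 :=
    R3.ext (by simp) (by simp) (by simp)
  rw [ContinuousLinearMap.det, ← LinearMap.det_toMatrix (EuclideanSpace.basisFun (Fin 3) ℝ).toBasis,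
    Matrix.det_fin_three]
  simp only [LinearMap.toMatrix_apply, hb, h0, h1, h2, det3]
  simp
  ring

theorem clm_det_comp (L M : R3 →L[ℝ] R3) : (L.comp M).det = L.det * M.det :=
  LinearMap.det_comp (L : R3 →ₗ[ℝ] R3) (M : R3 →ₗ[ℝ] R3)

theorem clm_det_id : (ContinuousLinearMap.id ℝ R3).det = 1 := LinearMap.det_id

theorem det_rotz (t : ℝ) : (rotz t).det = 1 := by
  rw [clm_det_eq_det3]
  simp [det3]
  linear_combination Real.sin_sq_add_cos_sq t

theorem clm_apply_eq_sum (a : R3 →L[ℝ] ℝ) (v : R3) :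
    a v = v 0 * a (pt 1 0 0) + v 1 * a (pt 0 1 0) + v 2 * a ez := by
  conv_lhs => rw [show v = v 0 • pt 1 0 0 + v 1 • pt 0 1 0 + v 2 • ez from
    R3.ext (by simp) (by simp) (by simp)]
  simp only [map_add, map_smul, smul_eq_mul]

theorem clm_left_inverse_of_right {L M : R3 →L[ℝ] R3} (h : L.comp M = ContinuousLinearMap.id ℝ R3) :
    M.comp L = ContinuousLinearMap.id ℝ R3 := by
  have h1 : (L : R3 →ₗ[ℝ] R3) * (M : R3 →ₗ[ℝ] R3) = 1 := by
    ext1 v; exact congrArg (· v) h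
  have h2 := mul_eq_one_comm.1 h1
  ext1 v
  exact congrArg (· v) h2

/-- The coefficients of a periodic divergence-free field `A • vrot + C • ez` tangent to the
cylinders. -/
structure FluxPair (r : ℝ) (A C : R3 → ℝ) : Prop where
  smooth_fst : ContDiffOn ℝ ∞ A (Dset r)
  smooth_snd : ContDiffOn ℝ ∞ C (Dset r)
  per_fst : ∀ q ∈ Dset r, A (q + per) = A q
  per_snd : ∀ q ∈ Dset r, C (q + per) = C q
  div_eq_zero : ∀ q ∈ Dset r, fderiv ℝ A q (vrot q) + fderiv ℝ C q ez = 0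

theorem FluxPair.mono {r r' : ℝ} {A C : R3 → ℝ} (h : FluxPair r A C) (h0 : 0 ≤ r') (hr : r' ≤ r) :
    FluxPair r' A C :=
  ⟨h.1.mono (Dset_mono h0 hr), h.2.mono (Dset_mono h0 hr), fun q hq => h.3 q (Dset_mono h0 hr hq),
    fun q hq => h.4 q (Dset_mono h0 hr hq), fun q hq => h.5 q (Dset_mono h0 hr hq)⟩

theorem ContDiffOn.comp_halfSq {r : ℝ} {k : ℝ → ℝ} (hk : ContDiffOn ℝ ∞ k (Iio (r ^ 2 / 2))) :
    ContDiffOn ℝ ∞ (fun q => k (halfSq q)) (Dset r) :=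
  hk.comp contDiff_halfSq.contDiffOn fun _ hq => halfSq_mem_Iio hq

theorem fderiv_comp_halfSq {r : ℝ} {k : ℝ → ℝ} (hk : ContDiffOn ℝ ∞ (fun q => k (halfSq q)) (Dset r)) {q : R3}
    (hq : q ∈ Dset r) :
    fderiv ℝ (fun q => k (halfSq q)) q (vrot q) = 0 ∧ fderiv ℝ (fun q => k (halfSq q)) q ez = 0 := by
  constructor
  · have h1 := hasDerivAt_comp_rotz hk hq 0
    simp only [halfSq_rotz, rotz_angle_zero] at h1
    exact h1.unique (hasDerivAt_const _ _)
  · have h1 := hasDerivAt_comp_add_ez hk hq 0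
    simp only [halfSq_add_smul_ez, zero_smul, add_zero] at h1
    exact h1.unique (hasDerivAt_const _ _)

theorem fderiv_comp_halfSq_mul {r : ℝ} {k : ℝ → ℝ} (hk : ContDiffOn ℝ ∞ (fun q => k (halfSq q)) (Dset r))
    {f : R3 → ℝ} (hf : ContDiffOn ℝ ∞ f (Dset r)) {q : R3} (hq : q ∈ Dset r) :
    fderiv ℝ (fun q => k (halfSq q) * f q) q (vrot q) = k (halfSq q) * fderiv ℝ f q (vrot q) ∧
    fderiv ℝ (fun q => k (halfSq q) * f q) q ez = k (halfSq q) * fderiv ℝ f q ez := by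
  have h1 := ((hk.hasFDerivAt' (isOpen_Dset r) hq).mul
    (hf.hasFDerivAt' (isOpen_Dset r) hq)).fderiv
  obtain ⟨h2, h3⟩ := fderiv_comp_halfSq hk hq
  exact ⟨(congrArg (· (vrot q)) h1).trans (by simp [h2]), (congrArg (· ez) h1).trans (by simp [h3])⟩

/-- The angle corrections: periodic potentials of combinations of two flux pairs whose mean values
cancel. -/
theorem exists_potential_of_fluxPair {r : ℝ} {A₁ C₁ A₂ C₂ : R3 → ℝ}
    (h₁ : FluxPair r A₁ C₁) (h₂ : FluxPair r A₂ C₂) {a₁ c₁ a₂ c₂ k₁ k₂ : ℝ → ℝ}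
    (ha₁ : ∀ q ∈ Dset r,
      (2 * Real.pi)⁻¹ * ∫ t in (0 : ℝ)..2 * Real.pi, A₁ (hproj q + t • ez) = a₁ (halfSq q))
    (ha₂ : ∀ q ∈ Dset r,
      (2 * Real.pi)⁻¹ * ∫ t in (0 : ℝ)..2 * Real.pi, A₂ (hproj q + t • ez) = a₂ (halfSq q))
    (hc₁ : ∀ q ∈ Dset r,
      (2 * Real.pi)⁻¹ * ∫ t in (0 : ℝ)..2 * Real.pi, C₁ (rotz t q) = c₁ (halfSq q))
    (hc₂ : ∀ q ∈ Dset r,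
      (2 * Real.pi)⁻¹ * ∫ t in (0 : ℝ)..2 * Real.pi, C₂ (rotz t q) = c₂ (halfSq q))
    (hk₁ : ContDiffOn ℝ ∞ (fun q => k₁ (halfSq q)) (Dset r))
    (hk₂ : ContDiffOn ℝ ∞ (fun q => k₂ (halfSq q)) (Dset r)) {κ κ' : ℝ}
    (hκ : ∀ q ∈ Dset r, k₁ (halfSq q) * c₁ (halfSq q) + k₂ (halfSq q) * c₂ (halfSq q) + κ = 0)
    (hκ' : ∀ q ∈ Dset r, k₁ (halfSq q) * a₁ (halfSq q) + k₂ (halfSq q) * a₂ (halfSq q) + κ' = 0) :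
    ∃ f : R3 → ℝ, ContDiffOn ℝ ∞ f (Dset r) ∧ (∀ q ∈ Dset r, f (q + per) = f q) ∧
      (∀ q ∈ Dset r, fderiv ℝ f q (vrot q) = k₁ (halfSq q) * C₁ q + k₂ (halfSq q) * C₂ q + κ) ∧
      (∀ q ∈ Dset r, fderiv ℝ f q ez = -(k₁ (halfSq q) * A₁ q + k₂ (halfSq q) * A₂ q + κ')) := by
  have ho := isOpen_Dset r
  have h_int : ∀ (f₁ f₂ : ℝ → ℝ) (x y z : ℝ), Continuous f₁ → Continuous f₂ →
      x * ((2 * Real.pi)⁻¹ * ∫ t in (0 : ℝ)..2 * Real.pi, f₁ t) +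
        y * ((2 * Real.pi)⁻¹ * ∫ t in (0 : ℝ)..2 * Real.pi, f₂ t) + z = 0 →
      ∫ t in (0 : ℝ)..2 * Real.pi, (x * f₁ t + y * f₂ t + z) = 0 := by
    intro f₁ f₂ x y z h1 h2 h
    rw [intervalIntegral.integral_add, intervalIntegral.integral_add,
      intervalIntegral.integral_const_mul, intervalIntegral.integral_const_mul,
      intervalIntegral.integral_const]
    · have hp := Real.pi_pos
      have : (2 * Real.pi)⁻¹ * (2 * Real.pi) = 1 := by field_simp
      simp only [sub_zero, smul_eq_mul]
      linear_combination (2 * Real.pi) * h - (x * (∫ t in (0 : ℝ)..2 * Real.pi, f₁ t)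
        + y * (∫ t in (0 : ℝ)..2 * Real.pi, f₂ t)) * this
    all_goals exact Continuous.intervalIntegrable (by fun_prop) _ _
  refine exists_periodic_potential
    (a := fun q => k₁ (halfSq q) * C₁ q + k₂ (halfSq q) * C₂ q + κ)
    (c := fun q => -(k₁ (halfSq q) * A₁ q + k₂ (halfSq q) * A₂ q + κ')) ?_ ?_ ?_ ?_ ?_ ?_
  · exact ((hk₁.mul h₁.2).add (hk₂.mul h₂.2)).add contDiffOn_const
  · exact (((hk₁.mul h₁.1).add (hk₂.mul h₂.1)).add contDiffOn_const).neg
  · intro q hq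
    simp only [per, halfSq_add_smul_ez]
    rw [← per, h₁.3 q hq, h₂.3 q hq]
  · intro q hq
    have e1 := (((hk₁.mul h₁.2).hasFDerivAt' ho hq).add
      ((hk₂.mul h₂.2).hasFDerivAt' ho hq)).add_const κ
    have e2 := ((((hk₁.mul h₁.1).hasFDerivAt' ho hq).add
      ((hk₂.mul h₂.1).hasFDerivAt' ho hq)).add_const κ').neg
    refine (congrArg (· ez) e1.fderiv).trans (Eq.trans ?_ (congrArg (· (vrot q)) e2.fderiv).symm)
    have l1 := (fderiv_comp_halfSq_mul hk₁ h₁.2 hq).2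
    have l2 := (fderiv_comp_halfSq_mul hk₂ h₂.2 hq).2
    have l3 := (fderiv_comp_halfSq_mul hk₁ h₁.1 hq).1
    have l4 := (fderiv_comp_halfSq_mul hk₂ h₂.1 hq).1
    simp only [add_apply, neg_apply, l1, l2, l3, l4]
    linear_combination k₁ (halfSq q) * h₁.5 q hq + k₂ (halfSq q) * h₂.5 q hq
  · intro q hq
    simp only [halfSq_rotz]
    refine h_int _ _ _ _ _ (continuous_comp_rotz h₁.2 hq) (continuous_comp_rotz h₂.2 hq) ?_
    rw [hc₁ q hq, hc₂ q hq, hκ q hq]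
  · intro q hq
    simp only [halfSq_hproj_add]
    rw [intervalIntegral.integral_neg, h_int _ _ _ _ _
      (continuous_comp_add_ez h₁.1 (hproj_mem_Dset hq))
      (continuous_comp_add_ez h₂.1 (hproj_mem_Dset hq)), neg_zero]
    rw [ha₁ q hq, ha₂ q hq, hκ' q hq]

/-- The change of angles `(θ, φ) ↦ (θ + f, φ + g)`. -/
def angleShift (f g : R3 → ℝ) (q : R3) : R3 := rotz (f q) q + g q • ez

theorem halfSq_angleShift (f g : R3 → ℝ) (q : R3) : halfSq (angleShift f g q) = halfSq q := by
  rw [angleShift, halfSq_add_smul_ez, halfSq_rotz]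

theorem contDiffOn_angleShift {s : Set R3} {f g : R3 → ℝ} (hf : ContDiffOn ℝ ∞ f s)
    (hg : ContDiffOn ℝ ∞ g s) : ContDiffOn ℝ ∞ (angleShift f g) s :=
  (contDiff_rotz_uncurry.comp_contDiffOn (contDiffOn_id.prodMk hf)).add (hg.smul contDiffOn_const)

/-- The derivative of a change of angles, up to a rotation. -/
def angleShiftDeriv (a b : R3 →L[ℝ] ℝ) (q : R3) : R3 →L[ℝ] R3 :=
  ContinuousLinearMap.id ℝ R3 + a.smulRight (vrot q) + b.smulRight ez

theorem det_angleShiftDeriv (a b : R3 →L[ℝ] ℝ) (q : R3) :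
    (angleShiftDeriv a b q).det = (1 + a (vrot q)) * (1 + b ez) - a ez * b (vrot q) := by
  rw [clm_det_eq_det3, clm_apply_eq_sum a (vrot q), clm_apply_eq_sum b (vrot q)]
  simp [det3, angleShiftDeriv, ez]
  ring

theorem hasFDerivAt_angleShift {f g : R3 → ℝ} {a b : R3 →L[ℝ] ℝ} {q : R3} (hf : HasFDerivAt f a q)
    (hg : HasFDerivAt g b q) :
    HasFDerivAt (angleShift f g) ((rotz (f q)).comp (angleShiftDeriv a b q)) q := by
  have h1 : HasFDerivAt (fun z : R3 × ℝ => rotz z.2 z.1) (fderiv ℝ (fun z : R3 × ℝ => rotz z.2 z.1)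
      (q, f q)) (q, f q) :=
    ((contDiff_rotz_uncurry (n := 1)).differentiable (by simp) _).hasFDerivAt
  have h2 : HasFDerivAt (fun q => rotz (f q) q) _ q := HasFDerivAt.comp q
    (f := fun q => (q, f q)) h1 ((hasFDerivAt_id q).prodMk hf)
  have h3 := h2.add (hg.smul_const ez)
  refine h3.congr_fderiv ?_
  have p1 : ∀ v : R3, fderiv ℝ (fun z : R3 × ℝ => rotz z.2 z.1) (q, f q) (v, 0) = rotz (f q) v := by
    intro v
    have k1 : HasFDerivAt (fun y => rotz (f q) y) _ q :=
      HasFDerivAt.comp (𝕜 := ℝ) q (f := fun y => (y, f q)) h1 (hasFDerivAt_prodMk_left q (f q))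
    exact congrArg (· v) (k1.unique (rotz (f q)).hasFDerivAt)
  have p2 : fderiv ℝ (fun z : R3 × ℝ => rotz z.2 z.1) (q, f q) (0, 1) = vrot (rotz (f q) q) := by
    have k1 : HasFDerivAt (fun t => rotz t q) _ (f q) :=
      HasFDerivAt.comp (𝕜 := ℝ) (f q) (f := fun t => (q, t)) h1 (hasFDerivAt_prodMk_right q (f q))
    have := k1.hasDerivAt.unique (hasDerivAt_rotz (f q) q)
    simpa using this
  ext1 v
  have p3 : fderiv ℝ (fun z : R3 × ℝ => rotz z.2 z.1) (q, f q) (v, a v)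
      = rotz (f q) v + a v • vrot (rotz (f q) q) := by
    rw [← p1, ← p2, ← map_smul, ← map_add]
    simp
  change fderiv ℝ (fun z : R3 × ℝ => rotz z.2 z.1) (q, f q) (v, a v) + b v • ez
    = rotz (f q) (v + a v • vrot q + b v • ez)
  rw [p3, map_add, map_add, map_smul, map_smul, rotz_ez, rotz_vrot]

theorem halfSq_smul_ez (t : ℝ) : halfSq (t • ez) = 0 := by simp [halfSq]

theorem vrot_smul_ez (t : ℝ) : vrot (t • ez) = 0 := R3.ext (by simp) (by simp) (by simp)

theorem rotz_smul_ez (s t : ℝ) : rotz s (t • ez) = t • ez := by simp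

/-- The determinant of the mean values of two flux pairs does not vanish on the axis. -/
theorem mean_det_ne_zero {r : ℝ} (hr : 0 < r) {A₁ C₁ A₂ C₂ : R3 → ℝ}
    (h₁ : FluxPair r A₁ C₁) (h₂ : FluxPair r A₂ C₂) {a₁ c₁ a₂ c₂ : ℝ}
    (hD : ∀ q ∈ Dset r, A₂ q * C₁ q - A₁ q * C₂ q ≠ 0)
    (ha₁ : (2 * Real.pi)⁻¹ * ∫ t in (0 : ℝ)..2 * Real.pi, A₁ (t • ez) = a₁)
    (ha₂ : (2 * Real.pi)⁻¹ * ∫ t in (0 : ℝ)..2 * Real.pi, A₂ (t • ez) = a₂)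
    (hc₁ : ∀ t : ℝ, C₁ (t • ez) = c₁) (hc₂ : ∀ t : ℝ, C₂ (t • ez) = c₂) :
    a₂ * c₁ - a₁ * c₂ ≠ 0 := by
  intro h0
  have hcont : ∀ {f : R3 → ℝ}, ContDiffOn ℝ ∞ f (Dset r) → Continuous fun t : ℝ => f (t • ez) := by
    intro f hf
    exact hf.continuousOn.comp_continuous (by fun_prop) (axis_mem_Dset hr)
  have k1 := hcont h₁.1
  have k2 := hcont h₂.1
  have hDc : Continuous fun t : ℝ => A₂ (t • ez) * c₁ - A₁ (t • ez) * c₂ :=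
    (k2.mul continuous_const).sub (k1.mul continuous_const)
  have h_int : ∫ t in (0 : ℝ)..2 * Real.pi, (A₂ (t • ez) * c₁ - A₁ (t • ez) * c₂) = 0 := by
    rw [intervalIntegral.integral_sub, intervalIntegral.integral_mul_const,
      intervalIntegral.integral_mul_const]
    · have hp := Real.pi_pos
      have h3 : (2 * Real.pi) * (2 * Real.pi)⁻¹ = 1 := by field_simp
      rw [← ha₁, ← ha₂] at h0
      linear_combination (2 * Real.pi) * h0 - ((∫ t in (0 : ℝ)..2 * Real.pi, A₂ (t • ez)) * c₁
        - (∫ t in (0 : ℝ)..2 * Real.pi, A₁ (t • ez)) * c₂) * h3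
    · exact (k2.mul continuous_const).intervalIntegrable _ _
    · exact (k1.mul continuous_const).intervalIntegrable _ _
  obtain ⟨t, -, ht⟩ := exists_hasDerivAt_eq_zero Real.two_pi_pos
    (f := fun u => ∫ t in (0 : ℝ)..u, (A₂ (t • ez) * c₁ - A₁ (t • ez) * c₂))
    (f' := fun t => A₂ (t • ez) * c₁ - A₁ (t • ez) * c₂)
    (continuous_iff_continuousAt.2 fun t =>
      (hDc.integral_hasStrictDerivAt 0 t).hasDerivAt.continuousAt).continuousOn
    (by simp only [intervalIntegral.integral_same, h_int])
    (fun t _ => (hDc.integral_hasStrictDerivAt 0 t).hasDerivAt)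
  refine hD _ (axis_mem_Dset hr t) ?_
  rw [hc₁, hc₂]
  exact ht

theorem flux_of_right_inverse {L M : R3 →L[ℝ] R3} (h : L.comp M = ContinuousLinearMap.id ℝ R3)
    {V H : R3} (hV : L V = L.det • H) : M H = M.det • V := by
  have h1 : M (L V) = V := congrArg (· V) (clm_left_inverse_of_right h)
  have h2 : M.det * L.det = 1 := by rw [mul_comm, ← clm_det_comp, h, clm_det_id]
  rw [← h1, hV, map_smul, smul_smul, h2, one_smul]

theorem angleShiftDeriv_apply_flux {f g : R3 → ℝ} (a b : R3 →L[ℝ] ℝ) (q : R3) {α β d : ℝ} (A C : ℝ)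
    (hα : A + (A * a (vrot q) + C * a ez) = d * α) (hβ : C + (A * b (vrot q) + C * b ez) = d * β) :
    (rotz (f q)).comp (angleShiftDeriv a b q) (A • vrot q + C • ez) =
      d • (α • vrot (angleShift f g q) + β • ez) := by
  have h1 : angleShiftDeriv a b q (A • vrot q + C • ez) = (d * α) • vrot q + (d * β) • ez := by
    rw [← hα, ← hβ]
    simp only [angleShiftDeriv, add_apply, ContinuousLinearMap.id_apply,
      ContinuousLinearMap.smulRight_apply, map_add, map_smul]
    module
  rw [ContinuousLinearMap.comp_apply, h1, angleShift, vrot_add_smul_ez, ← rotz_vrot, map_add,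
    map_smul, map_smul, rotz_ez, smul_add, smul_smul, smul_smul]

theorem injective_axis_of_deriv_ne_zero {r : ℝ} (hr : 0 < r) {g : R3 → ℝ} {Ψ : R3 → R3}
    (hg : ContDiffOn ℝ ∞ g (Dset r)) (h : ∀ t : ℝ, 1 + fderiv ℝ g (t • ez) ez ≠ 0)
    (hΨ : ∀ t : ℝ, Ψ (t • ez) = (t + g (t • ez)) • ez) {s t : ℝ} (hst : Ψ (s • ez) = Ψ (t • ez)) :
    s = t := by
  have hd : ∀ t : ℝ, HasDerivAt (fun t : ℝ => t + g (t • ez)) (1 + fderiv ℝ g (t • ez) ez) t := by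
    intro t
    have := hasDerivAt_comp_add_ez hg (q := 0) (by simpa using axis_mem_Dset hr 0) t
    simp only [zero_add] at this
    exact (hasDerivAt_id t).add this
  have key : ∀ s t : ℝ, s < t → Ψ (s • ez) ≠ Ψ (t • ez) := by
    intro s t hlt he
    rw [hΨ, hΨ] at he
    have he' := congrArg (· 2) he
    simp only [PiLp.smul_apply, smul_eq_mul, ez, pt_apply_two, mul_one] at he'
    obtain ⟨u, -, hu⟩ := exists_hasDerivAt_eq_zero hlt
      (continuous_iff_continuousAt.2 fun t => (hd t).continuousAt).continuousOn he'
      (fun t _ => hd t)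
    exact h u hu
  rcases lt_trichotomy s t with hlt | rfl | hlt
  · exact (key s t hlt hst).elim
  · rfl
  · exact (key t s hlt hst.symm).elim

/-- **Hamada's change of angles**: two independent flux pairs are simultaneously straightened by a
change of angles preserving the cylinders. -/
theorem exists_hamada_angles {r : ℝ} (hr : 0 < r) {A₁ C₁ A₂ C₂ : R3 → ℝ}
    (h₁ : FluxPair r A₁ C₁) (h₂ : FluxPair r A₂ C₂)
    (hD : ∀ q ∈ Dset r, A₂ q * C₁ q - A₁ q * C₂ q ≠ 0) :
    ∃ r' > 0, ∃ Ξ : R3 → R3, ∃ a₁ c₁ a₂ c₂ : ℝ → ℝ,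
      ContDiffOn ℝ ∞ a₁ (Iio (r' ^ 2 / 2)) ∧ ContDiffOn ℝ ∞ c₁ (Iio (r' ^ 2 / 2)) ∧
      ContDiffOn ℝ ∞ a₂ (Iio (r' ^ 2 / 2)) ∧ ContDiffOn ℝ ∞ c₂ (Iio (r' ^ 2 / 2)) ∧
      ContDiffOn ℝ ∞ Ξ (Dset r') ∧ (∀ q ∈ Dset r', Ξ q ∈ Dset r) ∧
      (∀ q ∈ Dset r', halfSq (Ξ q) = halfSq q) ∧ InjOn Ξ (Dset r') ∧
      (∀ q ∈ Dset r', Ξ (q + per) = Ξ q + per) ∧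
      (∀ t : ℝ, ∃ s : ℝ, Ξ (t • ez) = s • ez) ∧ (∀ s : ℝ, ∃ t : ℝ, Ξ (t • ez) = s • ez) ∧
      (∀ q ∈ Dset r', (fderiv ℝ Ξ q).det ≠ 0) ∧
      (∀ q ∈ Dset r', fderiv ℝ Ξ q (a₁ (halfSq q) • vrot q + c₁ (halfSq q) • ez) =
        (fderiv ℝ Ξ q).det • (A₁ (Ξ q) • vrot (Ξ q) + C₁ (Ξ q) • ez)) ∧
      (∀ q ∈ Dset r', fderiv ℝ Ξ q (a₂ (halfSq q) • vrot q + c₂ (halfSq q) • ez) =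
        (fderiv ℝ Ξ q).det • (A₂ (Ξ q) • vrot (Ξ q) + C₂ (Ξ q) • ez)) := by
  obtain ⟨a₁, ha₁s, ha₁⟩ := exists_vertical_mean hr h₁.1 h₁.2 h₁.4 h₁.5
  obtain ⟨a₂, ha₂s, ha₂⟩ := exists_vertical_mean hr h₂.1 h₂.2 h₂.4 h₂.5
  obtain ⟨c₁, hc₁s, hc₁⟩ := exists_circle_mean hr h₁.1 h₁.2 h₁.5
  obtain ⟨c₂, hc₂s, hc₂⟩ := exists_circle_mean hr h₂.1 h₂.2 h₂.5
  have hcax : ∀ {C : R3 → ℝ} {c : ℝ → ℝ}, (∀ q ∈ Dset r,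
      (2 * Real.pi)⁻¹ * ∫ t in (0 : ℝ)..2 * Real.pi, C (rotz t q) = c (halfSq q)) →
      ∀ t : ℝ, C (t • ez) = c 0 := by
    intro C c hc t
    have := hc _ (axis_mem_Dset hr t)
    simp only [rotz_smul_ez, halfSq_smul_ez, intervalIntegral.integral_const, sub_zero,
      smul_eq_mul] at this
    rw [← this, inv_mul_cancel_left₀ Real.two_pi_pos.ne']
  have haax : ∀ {A : R3 → ℝ} {a : ℝ → ℝ}, (∀ q ∈ Dset r,
      (2 * Real.pi)⁻¹ * ∫ t in (0 : ℝ)..2 * Real.pi, A (hproj q + t • ez) = a (halfSq q)) →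
      (2 * Real.pi)⁻¹ * ∫ t in (0 : ℝ)..2 * Real.pi, A (t • ez) = a 0 := by
    intro A a ha
    simpa [halfSq] using ha 0 (by simpa using axis_mem_Dset hr 0)
  have hΔ0 := mean_det_ne_zero hr h₁ h₂ hD (haax ha₁) (haax ha₂) (hcax hc₁) (hcax hc₂)
  have hΔs : ContDiffOn ℝ ∞ (fun u => a₂ u * c₁ u - a₁ u * c₂ u) (Iio (r ^ 2 / 2)) :=
    (ha₂s.mul hc₁s).sub (ha₁s.mul hc₂s)
  obtain ⟨ρ, hρ, hρr, hΔ⟩ := exists_Dset_subset_preimage (O := {x : ℝ | x ≠ 0}) hr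
    hΔs.comp_halfSq.continuousOn (fun q _ => by simp only [per, halfSq_add_smul_ez]) isOpen_ne
    (fun t => by
      show a₂ (halfSq (t • ez)) * c₁ (halfSq (t • ez)) - a₁ (halfSq (t • ez)) * c₂ (halfSq (t • ez)) ≠ 0
      rw [halfSq_smul_ez]
      exact hΔ0)
  replace hΔ : ∀ q ∈ Dset ρ, a₂ (halfSq q) * c₁ (halfSq q) - a₁ (halfSq q) * c₂ (halfSq q) ≠ 0 := hΔ
  have hinv : ∀ q ∈ Dset ρ, ∃ d : ℝ,
      a₂ (halfSq q) * c₁ (halfSq q) - a₁ (halfSq q) * c₂ (halfSq q) = d ∧ d⁻¹ * d = 1 :=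
    fun q hq => ⟨_, rfl, inv_mul_cancel₀ (hΔ q hq)⟩
  have hsub : Dset ρ ⊆ Dset r := Dset_mono hρ.le hρr
  have ho := isOpen_Dset ρ
  have g₁ := h₁.mono hρ.le hρr
  have g₂ := h₂.mono hρ.le hρr
  have hΔc := hΔs.comp_halfSq.mono hsub
  obtain ⟨f, hf, hfp, hfθ, hfφ⟩ := exists_potential_of_fluxPair g₁ g₂
    (k₁ := fun u => a₂ u / (a₂ u * c₁ u - a₁ u * c₂ u))
    (k₂ := fun u => -(a₁ u / (a₂ u * c₁ u - a₁ u * c₂ u))) (κ := -1) (κ' := 0)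
    (fun q hq => ha₁ q (hsub hq)) (fun q hq => ha₂ q (hsub hq))
    (fun q hq => hc₁ q (hsub hq)) (fun q hq => hc₂ q (hsub hq))
    ((ha₂s.comp_halfSq.mono hsub).div hΔc hΔ) ((ha₁s.comp_halfSq.mono hsub).div hΔc hΔ).neg
    (fun q hq => by
      obtain ⟨d, hd, hi⟩ := hinv q hq
      simp only [hd]
      linear_combination d⁻¹ * hd + hi)
    (fun q hq => by
      obtain ⟨d, hd, hi⟩ := hinv q hq
      simp only [hd]
      ring)
  obtain ⟨g, hg, hgp, hgθ, hgφ⟩ := exists_potential_of_fluxPair g₁ g₂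
    (k₁ := fun u => c₂ u / (a₂ u * c₁ u - a₁ u * c₂ u))
    (k₂ := fun u => -(c₁ u / (a₂ u * c₁ u - a₁ u * c₂ u))) (κ := 0) (κ' := 1)
    (fun q hq => ha₁ q (hsub hq)) (fun q hq => ha₂ q (hsub hq))
    (fun q hq => hc₁ q (hsub hq)) (fun q hq => hc₂ q (hsub hq))
    ((hc₂s.comp_halfSq.mono hsub).div hΔc hΔ) ((hc₁s.comp_halfSq.mono hsub).div hΔc hΔ).neg
    (fun q hq => by
      obtain ⟨d, hd, hi⟩ := hinv q hq
      simp only [hd]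
      ring)
    (fun q hq => by
      obtain ⟨d, hd, hi⟩ := hinv q hq
      simp only [hd]
      linear_combination -d⁻¹ * hd - hi)
  have hder : ∀ q ∈ Dset ρ, fderiv ℝ (angleShift f g) q =
      (rotz (f q)).comp (angleShiftDeriv (fderiv ℝ f q) (fderiv ℝ g q) q) := fun q hq =>
    (hasFDerivAt_angleShift (hf.hasFDerivAt' ho hq) (hg.hasFDerivAt' ho hq)).fderiv
  have hdet : ∀ q ∈ Dset ρ, (fderiv ℝ (angleShift f g) q).det = (A₂ q * C₁ q - A₁ q * C₂ q) /
      (a₂ (halfSq q) * c₁ (halfSq q) - a₁ (halfSq q) * c₂ (halfSq q)) := by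
    intro q hq
    obtain ⟨d, hd, hi⟩ := hinv q hq
    rw [hder q hq, clm_det_comp, det_rotz, det_angleShiftDeriv, hfθ q hq, hfφ q hq, hgθ q hq,
      hgφ q hq]
    simp only [hd]
    linear_combination (A₂ q * C₁ q - A₁ q * C₂ q) * (d⁻¹ ^ 2 * hd + d⁻¹ * hi)
  have hdet0 : ∀ q ∈ Dset ρ, (fderiv ℝ (angleShift f g) q).det ≠ 0 := fun q hq => by
    rw [hdet q hq]
    exact div_ne_zero (hD q (hsub hq)) (hΔ q hq)
  have hflux₁ : ∀ q ∈ Dset ρ, fderiv ℝ (angleShift f g) q (A₁ q • vrot q + C₁ q • ez) =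
      (fderiv ℝ (angleShift f g) q).det •
        (a₁ (halfSq q) • vrot (angleShift f g q) + c₁ (halfSq q) • ez) := by
    intro q hq
    rw [hdet q hq, hder q hq]
    exact angleShiftDeriv_apply_flux _ _ _ _ _
      (by rw [hfθ q hq, hfφ q hq]; ring) (by rw [hgθ q hq, hgφ q hq]; ring)
  have hflux₂ : ∀ q ∈ Dset ρ, fderiv ℝ (angleShift f g) q (A₂ q • vrot q + C₂ q • ez) =
      (fderiv ℝ (angleShift f g) q).det •
        (a₂ (halfSq q) • vrot (angleShift f g q) + c₂ (halfSq q) • ez) := by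
    intro q hq
    rw [hdet q hq, hder q hq]
    exact angleShiftDeriv_apply_flux _ _ _ _ _
      (by rw [hfθ q hq, hfφ q hq]; ring) (by rw [hgθ q hq, hgφ q hq]; ring)
  have haxis : ∀ t : ℝ, angleShift f g (t • ez) = (t + g (t • ez)) • ez := fun t => by
    rw [angleShift, rotz_smul_ez, add_smul]
  have hinj : ∀ s t : ℝ, angleShift f g (s • ez) = angleShift f g (t • ez) → s = t := by
    refine fun s t => injective_axis_of_deriv_ne_zero hρ hg ?_ haxis
    intro t
    have h1 := hdet0 _ (axis_mem_Dset hρ t)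
    rwa [hder _ (axis_mem_Dset hρ t), clm_det_comp, det_rotz, det_angleShiftDeriv, vrot_smul_ez,
      map_zero, map_zero, add_zero, one_mul, one_mul, mul_zero, sub_zero] at h1
  obtain ⟨σ, hσ, Ξ, hΞ, hΞm, hΞi, hΞp, hΞd, hax₁, hax₂⟩ := exists_inverse_near_axis hρ
    (contDiffOn_angleShift hf hg) (fun q hq => by
      rw [angleShift, angleShift, hfp q hq, hgp q hq, map_add, per, map_smul, rotz_ez]; abel)
    (fun t => hdet0 _ (axis_mem_Dset hρ t)) (fun t => ⟨_, haxis t⟩) hinj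
  have hm : 0 < min σ ρ := lt_min hσ hρ
  have hs₁ : Dset (min σ ρ) ⊆ Dset σ := Dset_mono hm.le (min_le_left _ _)
  have hs₂ : Iio (min σ ρ ^ 2 / 2) ⊆ Iio (r ^ 2 / 2) := Iio_subset_Iio (by
    have := pow_le_pow_left₀ hm.le ((min_le_right σ ρ).trans hρr) 2
    linarith)
  have hhalf : ∀ q ∈ Dset σ, halfSq (Ξ q) = halfSq q := fun q hq => by
    rw [← halfSq_angleShift f g (Ξ q), hΞi q hq]
  have hdets : ∀ q ∈ Dset σ, (fderiv ℝ (angleShift f g) (Ξ q)).det * (fderiv ℝ Ξ q).det = 1 :=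
    fun q hq => by rw [← clm_det_comp, hΞd q hq, clm_det_id]
  refine ⟨min σ ρ, hm, Ξ, a₁, c₁, a₂, c₂, ha₁s.mono hs₂, hc₁s.mono hs₂, ha₂s.mono hs₂, hc₂s.mono hs₂,
    hΞ.mono hs₁, fun q hq => hsub (hΞm q (hs₁ hq)), fun q hq => hhalf q (hs₁ hq), ?_,
    fun q hq => hΞp q (hs₁ hq), hax₁, hax₂, ?_, ?_, ?_⟩
  · intro q hq q' hq' h
    rw [← hΞi q (hs₁ hq), h, hΞi q' (hs₁ hq')]
  · intro q hq
    exact right_ne_zero_of_mul_eq_one (hdets q (hs₁ hq))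
  · intro q hq
    have h1 := hflux₁ _ (hΞm q (hs₁ hq))
    rw [hΞi q (hs₁ hq), hhalf q (hs₁ hq)] at h1
    exact flux_of_right_inverse (hΞd q (hs₁ hq)) h1
  · intro q hq
    have h1 := hflux₂ _ (hΞm q (hs₁ hq))
    rw [hΞi q (hs₁ hq), hhalf q (hs₁ hq)] at h1
    exact flux_of_right_inverse (hΞd q (hs₁ hq)) h1

theorem clm_apply_eq_sum_smul (L : R3 →L[ℝ] R3) (v : R3) :
    L v = v 0 • L (pt 1 0 0) + v 1 • L (pt 0 1 0) + v 2 • L (pt 0 0 1) := by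
  conv_lhs => rw [show v = v 0 • pt 1 0 0 + v 1 • pt 0 1 0 + v 2 • pt 0 0 1 from
    R3.ext (by simp) (by simp) (by simp)]
  simp only [map_add, map_smul]

theorem clm_cramer (L : R3 →L[ℝ] R3) (b : R3) :
    L (pt (det3 b (L (pt 0 1 0)) (L (pt 0 0 1))) (det3 (L (pt 1 0 0)) b (L (pt 0 0 1)))
      (det3 (L (pt 1 0 0)) (L (pt 0 1 0)) b)) = L.det • b := by
  rw [clm_apply_eq_sum_smul, clm_det_eq_det3]
  refine R3.ext ?_ ?_ ?_ <;> simp [det3] <;> ring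

theorem det3_map (L : R3 →L[ℝ] R3) (u v w : R3) :
    det3 (L u) (L v) (L w) = L.det * det3 u v w := by
  rw [clm_apply_eq_sum_smul L u, clm_apply_eq_sum_smul L v, clm_apply_eq_sum_smul L w,
    clm_det_eq_det3]
  simp [det3]
  ring

theorem trace_eq_sum_coord (L : R3 →L[ℝ] R3) : LinearMap.trace ℝ R3 L.toLinearMap =
    L (pt 1 0 0) 0 + L (pt 0 1 0) 1 + L (pt 0 0 1) 2 := by
  have hb : ∀ i, (EuclideanSpace.basisFun (Fin 3) ℝ).toBasis i = EuclideanSpace.single i (1 : ℝ) := by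
    intro i; simp
  have h0 : EuclideanSpace.single (0 : Fin 3) (1 : ℝ) = pt 1 0 0 :=
    R3.ext (by simp) (by simp) (by simp)
  have h1 : EuclideanSpace.single (1 : Fin 3) (1 : ℝ) = pt 0 1 0 :=
    R3.ext (by simp) (by simp) (by simp)
  have h2 : EuclideanSpace.single (2 : Fin 3) (1 : ℝ) = pt 0 0 1 :=
    R3.ext (by simp) (by simp) (by simp)
  rw [LinearMap.trace_eq_matrix_trace ℝ (EuclideanSpace.basisFun (Fin 3) ℝ).toBasis,
    Matrix.trace_fin_three]
  simp only [LinearMap.toMatrix_apply, hb, h0, h1, h2]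
  simp

theorem det3_trace (L : R3 →L[ℝ] R3) (u v w : R3) :
    det3 (L u) v w + det3 u (L v) w + det3 u v (L w) =
      LinearMap.trace ℝ R3 L.toLinearMap * det3 u v w := by
  rw [clm_apply_eq_sum_smul L u, clm_apply_eq_sum_smul L v, clm_apply_eq_sum_smul L w,
    trace_eq_sum_coord]
  simp [det3]
  ring

theorem det3_sum_div (u v w x xu xv xw p q r : R3) :
    det3 xu v w + det3 x p w + det3 x v q + (det3 p x w + det3 u xv w + det3 u x r) +
      (det3 q v x + det3 u r x + det3 u v xw) = det3 xu v w + det3 u xv w + det3 u v xw := by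
  simp only [det3]
  ring

theorem HasDerivAt.coord {f : ℝ → R3} {f' : R3} {t : ℝ} (hf : HasDerivAt f f' t) (i : Fin 3) :
    HasDerivAt (fun t => f t i) (f' i) t :=
  (EuclideanSpace.proj i : R3 →L[ℝ] ℝ).hasFDerivAt.comp_hasDerivAt t hf

theorem HasDerivAt.det3 {u v w : ℝ → R3} {u' v' w' : R3} {t : ℝ} (hu : HasDerivAt u u' t)
    (hv : HasDerivAt v v' t) (hw : HasDerivAt w w' t) :
    HasDerivAt (fun t => det3 (u t) (v t) (w t))
      (_root_.det3 u' (v t) (w t) + _root_.det3 (u t) v' (w t) + _root_.det3 (u t) (v t) w') t := by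
  have h := (((hu.coord 0).mul (((hv.coord 1).mul (hw.coord 2)).sub ((hv.coord 2).mul (hw.coord 1)))).sub
    ((hu.coord 1).mul (((hv.coord 0).mul (hw.coord 2)).sub ((hv.coord 2).mul (hw.coord 0))))).add
    ((hu.coord 2).mul (((hv.coord 0).mul (hw.coord 1)).sub ((hv.coord 1).mul (hw.coord 0))))
  refine h.congr_deriv ?_
  simp [_root_.det3]
  ring

theorem ContDiffOn.det3 {E : Type} [NormedAddCommGroup E] [NormedSpace ℝ E] {s : Set E} {n : ℕ∞ω}
    {u v w : E → R3} (hu : ContDiffOn ℝ n u s) (hv : ContDiffOn ℝ n v s) (hw : ContDiffOn ℝ n w s) :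
    ContDiffOn ℝ n (fun x => det3 (u x) (v x) (w x)) s := by
  have c : ∀ {f : E → R3}, ContDiffOn ℝ n f s → ∀ i : Fin 3, ContDiffOn ℝ n (fun x => f x i) s :=
    fun hf i => (contDiff_coord i).comp_contDiffOn hf
  exact (((c hu 0).mul (((c hv 1).mul (c hw 2)).sub ((c hv 2).mul (c hw 1)))).sub
    ((c hu 1).mul (((c hv 0).mul (c hw 2)).sub ((c hv 2).mul (c hw 0))))).add
    ((c hu 2).mul (((c hv 0).mul (c hw 1)).sub ((c hv 1).mul (c hw 0))))

/-- The pulled-back flux field of `X` under `Φ`, by Cramer's rule. -/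
def fluxPull (Φ X : R3 → R3) (q : R3) : R3 :=
  pt (det3 (X (Φ q)) (fderiv ℝ Φ q (pt 0 1 0)) (fderiv ℝ Φ q (pt 0 0 1)))
    (det3 (fderiv ℝ Φ q (pt 1 0 0)) (X (Φ q)) (fderiv ℝ Φ q (pt 0 0 1)))
    (det3 (fderiv ℝ Φ q (pt 1 0 0)) (fderiv ℝ Φ q (pt 0 1 0)) (X (Φ q)))

theorem fluxPull_zero (Φ X : R3 → R3) (q : R3) : fluxPull Φ X q 0 =
    det3 (X (Φ q)) (fderiv ℝ Φ q (pt 0 1 0)) (fderiv ℝ Φ q (pt 0 0 1)) := rfl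

theorem fluxPull_one (Φ X : R3 → R3) (q : R3) : fluxPull Φ X q 1 =
    det3 (fderiv ℝ Φ q (pt 1 0 0)) (X (Φ q)) (fderiv ℝ Φ q (pt 0 0 1)) := rfl

theorem fluxPull_two (Φ X : R3 → R3) (q : R3) : fluxPull Φ X q 2 =
    det3 (fderiv ℝ Φ q (pt 1 0 0)) (fderiv ℝ Φ q (pt 0 1 0)) (X (Φ q)) := rfl

theorem fderiv_fluxPull (Φ X : R3 → R3) (q : R3) :
    fderiv ℝ Φ q (fluxPull Φ X q) = (fderiv ℝ Φ q).det • X (Φ q) :=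
  clm_cramer _ _

theorem ContDiffOn.fderiv_apply_const {s : Set R3} (hs : IsOpen s) {Φ : R3 → R3}
    (hΦ : ContDiffOn ℝ ∞ Φ s) (v : R3) : ContDiffOn ℝ ∞ (fun q => fderiv ℝ Φ q v) s :=
  (hΦ.fderiv_of_isOpen hs (by simp)).clm_apply contDiffOn_const

theorem contDiffOn_fluxPull {s U : Set R3} (hs : IsOpen s) {Φ X : R3 → R3}
    (hΦ : ContDiffOn ℝ ∞ Φ s) (hX : ContDiffOn ℝ ∞ X U) (hm : MapsTo Φ s U) :
    ContDiffOn ℝ ∞ (fluxPull Φ X) s := by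
  have h := hΦ.fderiv_apply_const hs
  have hXΦ := hX.comp hΦ hm
  exact ContDiffOn.pt (hXΦ.det3 (h _) (h _)) ((h _).det3 hXΦ (h _)) ((h _).det3 (h _) hXΦ)

theorem hasDerivAt_comp_line {G : Type} [NormedAddCommGroup G] [NormedSpace ℝ G] {f : R3 → G}
    {L : R3 →L[ℝ] G} {q : R3} (hf : HasFDerivAt f L q) (v : R3) :
    HasDerivAt (fun t : ℝ => f (q + t • v)) (L v) 0 := by
  have h1 : HasDerivAt (fun t : ℝ => q + t • v) v 0 := by
    simpa using ((hasDerivAt_id (0 : ℝ)).smul_const v).const_add q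
  have h2 : HasFDerivAt f L (q + (0 : ℝ) • v) := by simpa using hf
  exact h2.comp_hasDerivAt 0 h1

/-- The pulled-back flux field of a divergence-free field is divergence-free. -/
theorem div_fluxPull {s U : Set R3} (hs : IsOpen s) (hU : IsOpen U) {Φ X : R3 → R3}
    (hΦ : ContDiffOn ℝ ∞ Φ s) (hX : ContDiffOn ℝ ∞ X U) (hm : MapsTo Φ s U)
    (hdiv : ∀ z ∈ U, divg X z = 0) {q : R3} (hq : q ∈ s) :
    fderiv ℝ (fun q => fluxPull Φ X q 0) q (pt 1 0 0) + fderiv ℝ (fun q => fluxPull Φ X q 1) q (pt 0 1 0)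
      + fderiv ℝ (fun q => fluxPull Φ X q 2) q (pt 0 0 1) = 0 := by
  have hXd := (hX.hasFDerivAt' hU (hm hq)).comp q (hΦ.hasFDerivAt' hs hq)
  have hd2 : HasFDerivAt (fderiv ℝ Φ) (fderiv ℝ (fderiv ℝ Φ) q) q :=
    (hΦ.fderiv_of_isOpen hs (m := ∞) (by simp)).hasFDerivAt' hs hq
  have hsymm : ∀ v w, fderiv ℝ (fderiv ℝ Φ) q v w = fderiv ℝ (fderiv ℝ Φ) q w v :=
    (hΦ.contDiffAt (hs.mem_nhds hq)).isSymmSndFDerivAt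
      (by rw [minSmoothness_of_isRCLikeNormedField]; exact WithTop.coe_le_coe.2 (OrderTop.le_top (2 : ℕ∞)))
  have hdv : ∀ v w : R3, HasDerivAt (fun t : ℝ => fderiv ℝ Φ (q + t • v) w)
      (fderiv ℝ (fderiv ℝ Φ) q v w) 0 := by
    intro v w
    have := (hasDerivAt_comp_line hd2 v).clm_apply (hasDerivAt_const 0 w)
    simpa using this
  have hXv : ∀ v : R3, HasDerivAt (fun t : ℝ => X (Φ (q + t • v)))
      (fderiv ℝ X (Φ q) (fderiv ℝ Φ q v)) 0 := fun v => hasDerivAt_comp_line hXd v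
  have hV := contDiffOn_fluxPull hs hΦ hX hm
  have hc : ∀ (i : Fin 3) (v : R3), HasDerivAt (fun t : ℝ => fluxPull Φ X (q + t • v) i)
      (fderiv ℝ (fun q => fluxPull Φ X q i) q v) 0 := fun i v =>
    hasDerivAt_comp_line (((contDiff_coord i).comp_contDiffOn hV).hasFDerivAt' hs hq) v
  have e0 := (hc 0 (pt 1 0 0)).unique
    (((hXv (pt 1 0 0)).det3 (hdv (pt 1 0 0) (pt 0 1 0)) (hdv (pt 1 0 0) (pt 0 0 1))).congr_of_eventuallyEq
      (Eventually.of_forall fun t => fluxPull_zero Φ X _))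
  have e1 := (hc 1 (pt 0 1 0)).unique
    (((hdv (pt 0 1 0) (pt 1 0 0)).det3 (hXv (pt 0 1 0)) (hdv (pt 0 1 0) (pt 0 0 1))).congr_of_eventuallyEq
      (Eventually.of_forall fun t => fluxPull_one Φ X _))
  have e2 := (hc 2 (pt 0 0 1)).unique
    (((hdv (pt 0 0 1) (pt 1 0 0)).det3 (hdv (pt 0 0 1) (pt 0 1 0)) (hXv (pt 0 0 1))).congr_of_eventuallyEq
      (Eventually.of_forall fun t => fluxPull_two Φ X _))
  have ht := det3_trace (fderiv ℝ X (Φ q)) (fderiv ℝ Φ q (pt 1 0 0)) (fderiv ℝ Φ q (pt 0 1 0))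
    (fderiv ℝ Φ q (pt 0 0 1))
  have hdq : LinearMap.trace ℝ R3 (fderiv ℝ X (Φ q)).toLinearMap = 0 := hdiv _ (hm hq)
  rw [hdq, zero_mul] at ht
  rw [e0, e1, e2]
  simp only [zero_smul, add_zero]
  rw [hsymm (pt 0 1 0) (pt 1 0 0), hsymm (pt 0 0 1) (pt 1 0 0), hsymm (pt 0 0 1) (pt 0 1 0)]
  rw [det3_sum_div]
  exact ht

/-- A continuous function vanishing off a coordinate plane vanishes. -/
theorem eq_zero_of_coord_ne_zero {s : Set R3} (hs : IsOpen s) {f : R3 → ℝ} (hf : ContinuousOn f s)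
    (i : Fin 3) (h : ∀ q ∈ s, q i ≠ 0 → f q = 0) {q : R3} (hq : q ∈ s) : f q = 0 := by
  by_cases hi : q i = 0
  · have hl : Continuous fun t : ℝ => q + t • EuclideanSpace.single i (1 : ℝ) := by fun_prop
    have hl0 : Tendsto (fun t : ℝ => q + t • EuclideanSpace.single i (1 : ℝ)) (𝓝[≠] 0) (𝓝 q) := by
      have := hl.tendsto 0
      rw [zero_smul, add_zero] at this
      exact this.mono_left nhdsWithin_le_nhds
    have h1 := (hf.continuousAt (hs.mem_nhds hq)).tendsto.comp hl0
    refine tendsto_nhds_unique h1 (tendsto_const_nhds.congr' ?_)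
    filter_upwards [hl0 (hs.mem_nhds hq), self_mem_nhdsWithin] with t ht ht0
    refine (h _ ht ?_).symm
    simpa [hi] using ht0
  · exact h q hq hi

/-- The projection to the first axis. -/
def xproj : R3 →L[ℝ] R3 :=
  LinearMap.toContinuousLinearMap
    { toFun := fun q => pt (q 0) 0 0
      map_add' := fun u v => R3.ext (by simp) (by simp) (by simp)
      map_smul' := fun c u => R3.ext (by simp) (by simp) (by simp) }

theorem xproj_apply (q : R3) : xproj q = pt (q 0) 0 0 := rfl

theorem sub_xproj_add_mem_Dset {r : ℝ} {q : R3} (hq : q ∈ Dset r) {t : ℝ} (ht : t ∈ Icc (0 : ℝ) 1) :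
    q - xproj q + t • xproj q ∈ Dset r := by
  rw [mem_Dset] at *
  simp only [xproj_apply, PiLp.add_apply, PiLp.sub_apply, PiLp.smul_apply, pt_apply_zero,
    pt_apply_one, smul_eq_mul, sub_self, zero_add, sub_zero, mul_zero, add_zero]
  have h1 : t ^ 2 ≤ 1 := pow_le_one₀ ht.1 ht.2
  nlinarith [sq_nonneg (q 0)]

theorem hadamardCoeff_xproj {u : R3 → ℝ} {q : R3} :
    hadamardCoeff xproj u q (xproj q) = q 0 * hadamardCoeff xproj u q (pt 1 0 0) := by
  rw [← smul_eq_mul, ← map_smul]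
  congr 1
  exact R3.ext (by simp [xproj_apply]) (by simp [xproj_apply]) (by simp [xproj_apply])

/-- A smooth periodic divergence-free field tangent to the cylinders is a flux pair. -/
theorem exists_fluxPair {r : ℝ} {V : R3 → R3} (hV : ContDiffOn ℝ ∞ V (Dset r))
    (hper : ∀ q ∈ Dset r, V (q + per) = V q)
    (hdiv : ∀ q ∈ Dset r, fderiv ℝ (fun q => V q 0) q (pt 1 0 0) +
      fderiv ℝ (fun q => V q 1) q (pt 0 1 0) + fderiv ℝ (fun q => V q 2) q (pt 0 0 1) = 0)
    (htan : ∀ q ∈ Dset r, q 0 * V q 0 + q 1 * V q 1 = 0) :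
    ∃ A C : R3 → ℝ, FluxPair r A C ∧ ∀ q ∈ Dset r, V q = A q • vrot q + C q • ez := by
  have ho := isOpen_Dset r
  have hc : ∀ i : Fin 3, ContDiffOn ℝ ∞ (fun q => V q i) (Dset r) := fun i =>
    (contDiff_coord i).comp_contDiffOn hV
  have hseg : ∀ x ∈ Dset r, ∀ t ∈ Icc (0 : ℝ) 1, x - xproj x + t • xproj x ∈ Dset r :=
    fun x hx t ht => sub_xproj_add_mem_Dset hx ht
  have hmem : ∀ x ∈ Dset r, x - xproj x ∈ Dset r := fun x hx => by
    simpa using hseg x hx 0 ⟨le_rfl, zero_le_one⟩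
  have h1 : ∀ q ∈ Dset r, V (q - xproj q) 1 = 0 := fun q hq => by
    refine eq_zero_of_coord_ne_zero ho (f := fun q => V (q - xproj q) 1)
      ((hc 1).continuousOn.comp (by fun_prop) hmem) 1 (fun q hq hq1 => ?_) hq
    have := htan _ (hmem q hq)
    simpa [xproj_apply, hq1] using this
  set A : R3 → ℝ := fun q => hadamardCoeff xproj (fun q => V q 1) q (pt 1 0 0) with hA
  have hAs : ContDiffOn ℝ ∞ A (Dset r) :=
    (contDiffOn_hadamardCoeff ho xproj hseg (hc 1)).clm_apply contDiffOn_const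
  have hV1 : ∀ q ∈ Dset r, V q 1 = A q * q 0 := fun q hq => by
    have := eq_add_hadamardCoeff ho xproj hseg (hc 1) hq
    rw [h1 q hq, zero_add, hadamardCoeff_xproj, mul_comm] at this
    exact this
  have hV0 : ∀ q ∈ Dset r, V q 0 = -(A q * q 1) := fun q hq => by
    have := eq_zero_of_coord_ne_zero ho (f := fun q => V q 0 + A q * q 1)
      ((hc 0).continuousOn.add (hAs.continuousOn.mul (continuous_coord 1).continuousOn)) 0
      (fun q hq hq0 => by
        have h2 := htan q hq
        rw [hV1 q hq] at h2
        refine (mul_eq_zero.1 (?_ : q 0 * (V q 0 + A q * q 1) = 0)).resolve_left hq0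
        linear_combination h2) hq
    linear_combination this
  refine ⟨A, fun q => V q 2, ⟨hAs, hc 2, ?_, ?_, ?_⟩, ?_⟩
  · intro q hq
    exact congrArg (· (pt 1 0 0)) (hadamardCoeff_add_eq ho xproj hseg
      (u := fun q => V q 1) (v := per) (R3.ext (by simp [xproj_apply]) (by simp [xproj_apply]) (by simp [xproj_apply]))
      (fun x hx => congrArg (· 1) (hper x hx)) hq)
  · exact fun q hq => congrArg (· 2) (hper q hq)
  · intro q hq
    have hAd := hAs.hasFDerivAt' ho hq
    have d0 := (hasDerivAt_comp_line ((hc 0).hasFDerivAt' ho hq) (pt 1 0 0)).unique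
      (((((hasDerivAt_comp_line hAd (pt 1 0 0)).mul_const (q 1))).neg).congr_of_eventuallyEq (by
        have hl : Tendsto (fun t : ℝ => q + t • pt 1 0 0) (𝓝 0) (𝓝 q) := by
          have : Continuous fun t : ℝ => q + t • pt 1 0 0 := by fun_prop
          simpa using this.tendsto 0
        filter_upwards [hl (ho.mem_nhds hq)] with t ht
        rw [hV0 _ ht]
        simp))
    have d1 := (hasDerivAt_comp_line ((hc 1).hasFDerivAt' ho hq) (pt 0 1 0)).unique
      ((((hasDerivAt_comp_line hAd (pt 0 1 0)).mul_const (q 0))).congr_of_eventuallyEq (by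
        have hl : Tendsto (fun t : ℝ => q + t • pt 0 1 0) (𝓝 0) (𝓝 q) := by
          have : Continuous fun t : ℝ => q + t • pt 0 1 0 := by fun_prop
          simpa using this.tendsto 0
        filter_upwards [hl (ho.mem_nhds hq)] with t ht
        rw [hV1 _ ht]
        simp))
    have d := hdiv q hq
    rw [d0, d1] at d
    rw [clm_apply_eq_sum _ (vrot q)]
    simp only [vrot, pt_apply_zero, pt_apply_one, pt_apply_two]
    rw [ez]
    linear_combination d
  · intro q hq
    exact R3.ext (by simp [hV0 q hq]) (by simp [hV1 q hq]) (by simp)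

theorem fderiv_halfSq_apply (q v : R3) : fderiv ℝ halfSq q v = q 0 * v 0 + q 1 * v 1 := by
  have h : HasDerivAt (fun t : ℝ => halfSq (q + t • v)) _ 0 := hasDerivAt_comp_line
    ((contDiff_halfSq (n := 1)).differentiable (by simp) q).hasFDerivAt v
  have hd : ∀ i : Fin 3, HasDerivAt (fun t : ℝ => (q + t • v) i) (v i) 0 := fun i => by
    simpa using ((hasDerivAt_id (0 : ℝ)).mul_const (v i)).const_add (q i)
  have h2 := (((hd 0).pow 2).add ((hd 1).pow 2)).div_const 2
  refine (h.unique h2).trans ?_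
  simp
  ring

theorem fderiv_eq_det3 {p : R3 → ℝ} {J B : R3} {z : R3} (h : cross3 J B = gradient p z) (w : R3) :
    fderiv ℝ p z w = det3 J B w := by
  have : fderiv ℝ p z w = inner ℝ (gradient p z) w := by
    simp [gradient]
  rw [this, ← h, PiLp.inner_apply, Fin.sum_univ_three]
  simp [cross3, det3]
  ring

/-- The pulled-back flux fields of an integrable magnetic field in coordinates adapted to the
pressure. -/
theorem IntegrableMagneticField.exists_fluxPair_pair {U : Set R3} {B J : R3 → R3} {p : R3 → ℝ}
    (h : IntegrableMagneticField U B J p) {r : ℝ} {Φ : R3 → R3} (hΦ : ContDiffOn ℝ ∞ Φ (Dset r))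
    (hm : MapsTo Φ (Dset r) U) (hper : ∀ q ∈ Dset r, Φ (q + per) = Φ q)
    (hdet : ∀ q ∈ Dset r, (fderiv ℝ Φ q).det ≠ 0) {p₀ ε : ℝ} (hε : ε ≠ 0)
    (hp : ∀ q ∈ Dset r, p (Φ q) = p₀ + ε * halfSq q) :
    ∃ A₁ C₁ A₂ C₂ : R3 → ℝ, FluxPair r A₁ C₁ ∧ FluxPair r A₂ C₂ ∧
      (∀ q ∈ Dset r, fderiv ℝ Φ q (A₁ q • vrot q + C₁ q • ez) = (fderiv ℝ Φ q).det • B (Φ q)) ∧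
      (∀ q ∈ Dset r, fderiv ℝ Φ q (A₂ q • vrot q + C₂ q • ez) = (fderiv ℝ Φ q).det • J (Φ q)) ∧
      ∀ q ∈ Dset r, A₂ q * C₁ q - A₁ q * C₂ q ≠ 0 := by
  have ho := isOpen_Dset r
  have hpd : ∀ q ∈ Dset r, ∀ v, det3 (J (Φ q)) (B (Φ q)) (fderiv ℝ Φ q v) =
      ε * (q 0 * v 0 + q 1 * v 1) := by
    intro q hq v
    rw [← fderiv_eq_det3 (h.hamiltonian _ (hm hq)), ← fderiv_halfSq_apply]
    have h1 := (h.smooth_p.hasFDerivAt' h.isOpen_U (hm hq)).comp q (hΦ.hasFDerivAt' ho hq)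
    have h2 : HasFDerivAt (fun q => p₀ + ε * halfSq q) (ε • fderiv ℝ halfSq q) q :=
      ((((contDiff_halfSq (n := 1)).differentiable (by simp) q).hasFDerivAt).const_mul ε).const_add p₀
    have h3 := h1.unique (h2.congr_of_eventuallyEq (by
      filter_upwards [ho.mem_nhds hq] with y hy using hp y hy))
    exact congrArg (· v) h3
  have key : ∀ X : R3 → R3, ContDiffOn ℝ ∞ X U → (∀ z ∈ U, divg X z = 0) →
      (∀ q ∈ Dset r, det3 (J (Φ q)) (B (Φ q)) (X (Φ q)) = 0) →
      ∃ A C : R3 → ℝ, FluxPair r A C ∧ ∀ q ∈ Dset r,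
        fderiv ℝ Φ q (A q • vrot q + C q • ez) = (fderiv ℝ Φ q).det • X (Φ q) := by
    intro X hX hXd hX0
    obtain ⟨A, C, hAC, hV⟩ := exists_fluxPair (contDiffOn_fluxPull ho hΦ hX hm)
      (fun q hq => by simp only [fluxPull, fderiv_add_per hper hq, hper q hq])
      (fun q hq => div_fluxPull ho h.isOpen_U hΦ hX hm hXd hq)
      (fun q hq => by
        have h1 := hpd q hq (fluxPull Φ X q)
        rw [fderiv_fluxPull] at h1
        have h2 : det3 (J (Φ q)) (B (Φ q)) ((fderiv ℝ Φ q).det • X (Φ q)) =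
            (fderiv ℝ Φ q).det * det3 (J (Φ q)) (B (Φ q)) (X (Φ q)) := by
          simp [det3]; ring
        rw [h2, hX0 q hq, mul_zero] at h1
        exact (mul_eq_zero.1 h1.symm).resolve_left hε)
    exact ⟨A, C, hAC, fun q hq => by rw [← hV q hq, fderiv_fluxPull]⟩
  obtain ⟨A₁, C₁, h₁, hV₁⟩ := key B h.smooth_B h.div_B (fun q _ => by simp [det3]; ring)
  obtain ⟨A₂, C₂, h₂, hV₂⟩ := key J h.smooth_J h.div_J (fun q _ => by simp [det3]; ring)
  refine ⟨A₁, C₁, A₂, C₂, h₁, h₂, hV₁, hV₂, fun q hq => ?_⟩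
  have hdc : ContinuousOn (fun q => (fderiv ℝ Φ q).det) (Dset r) :=
    ContinuousLinearMap.continuous_det.comp_continuousOn
      (hΦ.continuousOn_fderiv_of_isOpen ho (by simp))
  have hD := eq_zero_of_coord_ne_zero ho
    (f := fun q => A₂ q * C₁ q - A₁ q * C₂ q - ε * (fderiv ℝ Φ q).det)
    (((h₂.1.continuousOn.mul h₁.2.continuousOn).sub (h₁.1.continuousOn.mul h₂.2.continuousOn)).sub
      (continuousOn_const.mul hdc)) 0 (fun q hq hq0 => by
      have e1 := det3_map (fderiv ℝ Φ q) (A₂ q • vrot q + C₂ q • ez) (A₁ q • vrot q + C₁ q • ez)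
        (hproj q)
      rw [hV₁ q hq, hV₂ q hq] at e1
      have e2 := hpd q hq (hproj q)
      have e3 : det3 ((fderiv ℝ Φ q).det • J (Φ q)) ((fderiv ℝ Φ q).det • B (Φ q))
          (fderiv ℝ Φ q (hproj q)) = (fderiv ℝ Φ q).det ^ 2 *
            det3 (J (Φ q)) (B (Φ q)) (fderiv ℝ Φ q (hproj q)) := by
        simp [det3]; ring
      have e4 : det3 (A₂ q • vrot q + C₂ q • ez) (A₁ q • vrot q + C₁ q • ez) (hproj q) =
          (A₂ q * C₁ q - A₁ q * C₂ q) * (q 0 ^ 2 + q 1 ^ 2) := by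
        simp [det3, hproj_apply, vrot, ez]; ring
      have e5 : hproj q 0 = q 0 := rfl
      have e6 : hproj q 1 = q 1 := rfl
      rw [e3, e2, e4, e5, e6] at e1
      have e7 : 0 < q 0 ^ 2 + q 1 ^ 2 := by positivity
      have e8 : (fderiv ℝ Φ q).det * (q 0 ^ 2 + q 1 ^ 2) ≠ 0 := mul_ne_zero (hdet q hq) e7.ne'
      refine (mul_eq_zero.1 (?_ : (fderiv ℝ Φ q).det * (q 0 ^ 2 + q 1 ^ 2) *
        (A₂ q * C₁ q - A₁ q * C₂ q - ε * (fderiv ℝ Φ q).det) = 0)).resolve_left e8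
      linear_combination -e1) hq
  rw [sub_eq_zero.1 hD]
  exact mul_ne_zero hε (hdet q hq)

theorem sub_hproj_add_mem_Dset {r : ℝ} {q : R3} (hq : q ∈ Dset r) {t : ℝ} (ht : t ∈ Icc (0 : ℝ) 1) :
    q - hproj q + t • hproj q ∈ Dset r := by
  rw [mem_Dset] at *
  simp only [hproj_apply, PiLp.add_apply, PiLp.sub_apply, PiLp.smul_apply, pt_apply_zero,
    pt_apply_one, smul_eq_mul, sub_self, zero_add]
  have h1 : t ^ 2 ≤ 1 := pow_le_one₀ ht.1 ht.2
  nlinarith [sq_nonneg (q 0), sq_nonneg (q 1)]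

theorem sub_hproj (q : R3) : q - hproj q = q 2 • ez :=
  R3.ext (by simp) (by simp) (by simp)

/-- A smooth periodic function vanishing on the axis is a combination of the two transverse
coordinates. -/
theorem exists_coeff_of_eq_zero_axis {r : ℝ} {u : R3 → ℝ} (hu : ContDiffOn ℝ ∞ u (Dset r))
    (hper : ∀ q ∈ Dset r, u (q + per) = u q) (h0 : ∀ t : ℝ, u (t • ez) = 0) :
    ∃ a b : R3 → ℝ, ContDiffOn ℝ ∞ a (Dset r) ∧ ContDiffOn ℝ ∞ b (Dset r) ∧
      (∀ q ∈ Dset r, a (q + per) = a q) ∧ (∀ q ∈ Dset r, b (q + per) = b q) ∧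
      ∀ q ∈ Dset r, u q = q 0 * a q + q 1 * b q := by
  have ho := isOpen_Dset r
  have hseg : ∀ x ∈ Dset r, ∀ t ∈ Icc (0 : ℝ) 1, x - hproj x + t • hproj x ∈ Dset r :=
    fun x hx t ht => sub_hproj_add_mem_Dset hx ht
  have hs := contDiffOn_hadamardCoeff ho hproj hseg hu
  have hp : ∀ q ∈ Dset r, hadamardCoeff hproj u (q + per) = hadamardCoeff hproj u q := fun q hq =>
    hadamardCoeff_add_eq ho hproj hseg (by simp [per]) hper hq
  refine ⟨fun q => hadamardCoeff hproj u q (pt 1 0 0), fun q => hadamardCoeff hproj u q (pt 0 1 0),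
    hs.clm_apply contDiffOn_const, hs.clm_apply contDiffOn_const,
    fun q hq => congrArg (· (pt 1 0 0)) (hp q hq), fun q hq => congrArg (· (pt 0 1 0)) (hp q hq),
    fun q hq => ?_⟩
  have h1 := eq_add_hadamardCoeff ho hproj hseg hu hq
  rw [sub_hproj, h0, zero_add, clm_apply_eq_sum] at h1
  simpa [hproj_apply] using h1

theorem hasDerivAt_mul_self_zero {k : ℝ → ℝ} (hk : ContinuousAt k 0) :
    HasDerivAt (fun s => s * k s) (k 0) 0 := by
  rw [hasDerivAt_iff_tendsto_slope]
  refine (hk.tendsto.mono_left nhdsWithin_le_nhds).congr' ?_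
  filter_upwards [self_mem_nhdsWithin] with s hs
  have : s ≠ 0 := hs
  simp [slope_def_field, this]

theorem continuous_line (q v : R3) : Continuous fun s : ℝ => q + s • v := by fun_prop

theorem tendsto_line (q v : R3) : Tendsto (fun s : ℝ => q + s • v) (𝓝 0) (𝓝 q) := by
  simpa using (continuous_line q v).tendsto 0

theorem hasDerivAt_comp_line_at {G : Type} [NormedAddCommGroup G] [NormedSpace ℝ G] {f : R3 → G}
    {q v : R3} {t : ℝ} {L : R3 →L[ℝ] G} (hf : HasFDerivAt f L (q + t • v)) :
    HasDerivAt (fun t : ℝ => f (q + t • v)) (L v) t := by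
  have h1 : HasDerivAt (fun t : ℝ => q + t • v) v t := by
    simpa using ((hasDerivAt_id t).smul_const v).const_add q
  exact hf.comp_hasDerivAt t h1

/-- Along a line, `h = p₀ + s² Q` has second derivative `2 Q`. -/
theorem fderiv_fderiv_eq_of_line {S : Set R3} (hS : IsOpen S) {h Q : R3 → ℝ} {q v : R3} {p₀ : ℝ}
    (hh : ContDiffOn ℝ ∞ h S) (hQ : ContDiffOn ℝ ∞ Q S) (hq : q ∈ S)
    (heq : ∀ s : ℝ, q + s • v ∈ S → h (q + s • v) = p₀ + s ^ 2 * Q (q + s • v)) :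
    fderiv ℝ (fderiv ℝ h) q v v = 2 * Q q := by
  have hd2 : HasFDerivAt (fderiv ℝ h) (fderiv ℝ (fderiv ℝ h) q) q :=
    (hh.fderiv_of_isOpen hS (m := ∞) (by simp)).hasFDerivAt' hS hq
  have e1 : HasDerivAt (fun s : ℝ => fderiv ℝ h (q + s • v) v) (fderiv ℝ (fderiv ℝ h) q v v) 0 := by
    simpa using (hasDerivAt_comp_line hd2 v).clm_apply (hasDerivAt_const 0 v)
  have hmem : ∀ᶠ s : ℝ in 𝓝 0, q + s • v ∈ S := tendsto_line q v (hS.mem_nhds hq)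
  have hmem' : ∀ᶠ s : ℝ in 𝓝 0, ∀ᶠ s' : ℝ in 𝓝 s, q + s' • v ∈ S := hmem.eventually_nhds
  have e2 : (fun s : ℝ => fderiv ℝ h (q + s • v) v) =ᶠ[𝓝 0]
      fun s => s * (2 * Q (q + s • v) + s * fderiv ℝ Q (q + s • v) v) := by
    filter_upwards [hmem'] with s hs
    have hs0 := hs.self_of_nhds
    have d1 := hasDerivAt_comp_line_at (hh.hasFDerivAt' hS hs0)
    have d2 := (((hasDerivAt_id s).pow 2).mul
      (hasDerivAt_comp_line_at (hQ.hasFDerivAt' hS hs0))).const_add p₀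
    have d3 := d1.unique (d2.congr_of_eventuallyEq (by
      filter_upwards [hs] with s' hs' using heq s' hs'))
    rw [d3]
    simp
    ring
  have hk : ContinuousAt (fun s : ℝ => 2 * Q (q + s • v) + s * fderiv ℝ Q (q + s • v) v) 0 := by
    have c1 : ContinuousAt (fun s : ℝ => Q (q + s • v)) 0 := by
      refine ContinuousAt.comp (g := Q) ?_ (continuous_line q v).continuousAt
      simpa using hQ.continuousOn.continuousAt (hS.mem_nhds hq)
    have c2 : ContinuousAt (fun s : ℝ => fderiv ℝ Q (q + s • v) v) 0 := by
      refine ContinuousAt.comp (g := fun q => fderiv ℝ Q q v) ?_ (continuous_line q v).continuousAt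
      have : ContinuousOn (fun q => fderiv ℝ Q q v) S :=
        (hQ.continuousOn_fderiv_of_isOpen hS (by simp)).clm_apply continuousOn_const
      simpa using this.continuousAt (hS.mem_nhds hq)
    exact (continuousAt_const.mul c1).add (continuousAt_id.mul c2)
  have := e1.unique ((hasDerivAt_mul_self_zero hk).congr_of_eventuallyEq e2)
  simpa using this

theorem hasDerivAt_mul_line {q v : R3} {a : R3 → ℝ} {L : R3 →L[ℝ] ℝ} (ha : HasFDerivAt a L q)
    {i : Fin 3} (hi : q i = 0) :
    HasDerivAt (fun s : ℝ => (q + s • v) i * a (q + s • v)) (v i * a q) 0 := by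
  have h1 : HasDerivAt (fun s : ℝ => (q + s • v) i) (v i) 0 := by
    simpa using ((hasDerivAt_id (0 : ℝ)).mul_const (v i)).const_add (q i)
  refine (h1.mul (hasDerivAt_comp_line ha v)).congr_deriv ?_
  simp [hi]

/-- **Morse–Bott lemma** near a nondegenerate axis of minima. -/
theorem exists_morse_coordinates {r : ℝ} (hr : 0 < r) {h : R3 → ℝ} {p₀ : ℝ}
    (hh : ContDiffOn ℝ ∞ h (Dset r)) (hper : ∀ q ∈ Dset r, h (q + per) = h q)
    (hax : ∀ t : ℝ, h (t • ez) = p₀) (hcrit : ∀ t : ℝ, fderiv ℝ h (t • ez) = 0)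
    (hpos : ∀ (t : ℝ) (v : R3), v 2 = 0 → v ≠ 0 → 0 < fderiv ℝ (fderiv ℝ h) (t • ez) v v) :
    ∃ r' > 0, ∃ Ξ : R3 → R3, ContDiffOn ℝ ∞ Ξ (Dset r') ∧ (∀ q ∈ Dset r', Ξ q ∈ Dset r) ∧
      (∀ q ∈ Dset r', Ξ (q + per) = Ξ q + per) ∧ InjOn Ξ (Dset r') ∧
      (∀ q ∈ Dset r', (fderiv ℝ Ξ q).det ≠ 0) ∧
      (∀ t : ℝ, ∃ s : ℝ, Ξ (t • ez) = s • ez) ∧ (∀ s : ℝ, ∃ t : ℝ, Ξ (t • ez) = s • ez) ∧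
      ∀ q ∈ Dset r', h (Ξ q) = p₀ + halfSq q := by
  have ho := isOpen_Dset r
  obtain ⟨a₁, a₂, ha₁, ha₂, hp₁, hp₂, hha⟩ := exists_coeff_of_eq_zero_axis
    (u := fun q => h q - p₀) (hh.sub contDiffOn_const) (fun q hq => by rw [hper q hq])
    (fun t => by rw [hax, sub_self])
  have hlin : ∀ (t : ℝ) (v : R3), v 0 * a₁ (t • ez) + v 1 * a₂ (t • ez) = 0 := by
    intro t v
    have hq := axis_mem_Dset hr t
    have d1 := hasDerivAt_comp_line (hh.hasFDerivAt' ho hq) v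
    have d2 := ((hasDerivAt_mul_line (v := v) (i := 0) (ha₁.hasFDerivAt' ho hq) (by simp)).add
      (hasDerivAt_mul_line (v := v) (i := 1) (ha₂.hasFDerivAt' ho hq) (by simp))).const_add p₀
    have d3 := d1.unique (d2.congr_of_eventuallyEq (by
      filter_upwards [tendsto_line (t • ez) v (ho.mem_nhds hq)] with s hs
      have := hha _ hs
      simp only [Pi.add_apply]
      linear_combination this))
    rw [← d3, hcrit]
    rfl
  obtain ⟨b₁, b₂, hb₁, hb₂, hq₁, hq₂, hhb⟩ := exists_coeff_of_eq_zero_axis ha₁ hp₁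
    (fun t => by simpa using hlin t (pt 1 0 0))
  obtain ⟨d₁, d₂, hd₁, hd₂, hs₁, hs₂, hhd⟩ := exists_coeff_of_eq_zero_axis ha₂ hp₂
    (fun t => by simpa using hlin t (pt 0 1 0))
  obtain ⟨a, ha⟩ : ∃ a : R3 → ℝ, a = fun q => 2 * b₁ q := ⟨_, rfl⟩
  obtain ⟨b, hb⟩ : ∃ b : R3 → ℝ, b = fun q => b₂ q + d₁ q := ⟨_, rfl⟩
  obtain ⟨d, hd⟩ : ∃ d : R3 → ℝ, d = fun q => 2 * d₂ q := ⟨_, rfl⟩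
  have has : ContDiffOn ℝ ∞ a (Dset r) := ha ▸ contDiffOn_const.mul hb₁
  have hbs : ContDiffOn ℝ ∞ b (Dset r) := hb ▸ hb₂.add hd₁
  have hds : ContDiffOn ℝ ∞ d (Dset r) := hd ▸ contDiffOn_const.mul hd₂
  have hap : ∀ q ∈ Dset r, a (q + per) = a q := fun q hq => by simp only [ha, hq₁ q hq]
  have hbp : ∀ q ∈ Dset r, b (q + per) = b q := fun q hq => by simp only [hb, hq₂ q hq, hs₁ q hq]
  have hdp : ∀ q ∈ Dset r, d (q + per) = d q := fun q hq => by simp only [hd, hs₂ q hq]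
  have hform : ∀ q ∈ Dset r,
      h q = p₀ + (a q * q 0 ^ 2 + 2 * b q * (q 0 * q 1) + d q * q 1 ^ 2) / 2 := fun q hq => by
    have h1 := hha q hq
    rw [hhb q hq, hhd q hq] at h1
    simp only [ha, hb, hd]
    linear_combination h1
  have hQ : ∀ (t : ℝ) (v : R3), v 2 = 0 → v ≠ 0 →
      0 < a (t • ez) * v 0 ^ 2 + 2 * b (t • ez) * (v 0 * v 1) + d (t • ez) * v 1 ^ 2 := by
    intro t v hv hv0
    have h1 := fderiv_fderiv_eq_of_line (v := v) (p₀ := p₀) ho hh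
      (Q := fun q => (a q * v 0 ^ 2 + b q * (2 * (v 0 * v 1)) + d q * v 1 ^ 2) / 2)
      ((((has.mul contDiffOn_const).add (hbs.mul contDiffOn_const)).add
        (hds.mul contDiffOn_const)).div_const 2) (axis_mem_Dset hr t) (fun s hs => by
        rw [hform _ hs]
        simp
        ring)
    have h2 := hpos t v hv hv0
    rw [h1] at h2
    linarith
  have ha0 : ∀ t : ℝ, 0 < a (t • ez) := fun t => by
    simpa using hQ t (pt 1 0 0) (by simp) (fun h => by simpa using congrArg (· 0) h)
  have hdisc : ∀ t : ℝ, 0 < a (t • ez) * d (t • ez) - b (t • ez) ^ 2 := fun t => by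
    have h1 := hQ t (pt (-b (t • ez)) (a (t • ez)) 0) (by simp) (fun h => by
      have := congrArg (· 1) h
      simp only [pt_apply_one] at this
      exact (ha0 t).ne' this)
    simp only [pt_apply_zero, pt_apply_one] at h1
    refine pos_of_mul_pos_right (a := a (t • ez)) ?_ (ha0 t).le
    linarith
  obtain ⟨ρ, hρ, hρr, hpre⟩ := exists_Dset_subset_preimage
    (f := fun q => (a q, a q * d q - b q ^ 2)) (O := Ioi (0 : ℝ) ×ˢ Ioi (0 : ℝ)) hr
    (has.continuousOn.prodMk ((has.mul hds).sub (hbs.pow 2)).continuousOn)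
    (fun q hq => by rw [hap q hq, hbp q hq, hdp q hq]) (isOpen_Ioi.prod isOpen_Ioi)
    (fun t => ⟨ha0 t, hdisc t⟩)
  have hsub := Dset_mono hρ.le hρr
  replace has := has.mono hsub
  replace hbs := hbs.mono hsub
  replace hds := hds.mono hsub
  have hapos : ∀ q ∈ Dset ρ, 0 < a q := fun q hq => (hpre q hq).1
  have hdpos : ∀ q ∈ Dset ρ, 0 < (a q * d q - b q ^ 2) / a q := fun q hq =>
    div_pos (hpre q hq).2 (hpre q hq).1
  have hα : ContDiffOn ℝ ∞ (fun q => √(a q)) (Dset ρ) := has.sqrt fun q hq => (hapos q hq).ne'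
  have hβ : ContDiffOn ℝ ∞ (fun q => b q / √(a q)) (Dset ρ) :=
    hbs.div hα fun q hq => (Real.sqrt_pos.2 (hapos q hq)).ne'
  have hγ : ContDiffOn ℝ ∞ (fun q => √((a q * d q - b q ^ 2) / a q)) (Dset ρ) :=
    (((has.mul hds).sub (hbs.pow 2)).div has fun q hq => (hapos q hq).ne').sqrt
      fun q hq => (hdpos q hq).ne'
  have hx : ∀ i, ContDiffOn ℝ ∞ (fun q : R3 => q i) (Dset ρ) := fun i => (contDiff_coord i).contDiffOn
  obtain ⟨N, hN⟩ : ∃ N : R3 → R3, N = fun q => pt (q 0 * √(a q) + q 1 * (b q / √(a q)))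
    (q 1 * √((a q * d q - b q ^ 2) / a q)) (q 2) := ⟨_, rfl⟩
  have hNs : ContDiffOn ℝ ∞ N (Dset ρ) := hN ▸ ContDiffOn.pt (((hx 0).mul hα).add ((hx 1).mul hβ))
    ((hx 1).mul hγ) (hx 2)
  have hNax : ∀ t : ℝ, N (t • ez) = t • ez := fun t => by
    rw [hN]; exact R3.ext (by simp) (by simp) (by simp)
  have hNhalf : ∀ q ∈ Dset ρ, h q = p₀ + halfSq (N q) := fun q hq => by
    have h1 := hapos q hq
    have h2 := Real.sq_sqrt h1.le
    have h3 := Real.sq_sqrt (hdpos q hq).le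
    rw [hform q (hsub hq), hN]
    simp only [halfSq, pt_apply_zero, pt_apply_one]
    have h5 : (q 0 * √(a q) + q 1 * (b q / √(a q))) ^ 2 =
        q 0 ^ 2 * a q + 2 * (q 0 * q 1) * b q + q 1 ^ 2 * (b q ^ 2 / a q) := by
      have h4 : √(a q) ≠ 0 := (Real.sqrt_pos.2 h1).ne'
      rw [← h2]
      simp only [Real.sqrt_sq (Real.sqrt_nonneg _)]
      field_simp
      ring
    rw [h5, mul_pow, h3]
    field_simp
    ring
  have hNdet : ∀ t : ℝ, (fderiv ℝ N (t • ez)).det ≠ 0 := by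
    intro t
    have hq := axis_mem_Dset hρ t
    have ho' := isOpen_Dset ρ
    have key : ∀ v : R3, fderiv ℝ N (t • ez) v = pt
        (v 0 * √(a (t • ez)) + v 1 * (b (t • ez) / √(a (t • ez))))
        (v 1 * √((a (t • ez) * d (t • ez) - b (t • ez) ^ 2) / a (t • ez))) (v 2) := by
      intro v
      have d1 := hasDerivAt_comp_line (hNs.hasFDerivAt' ho' hq) v
      have d2 : HasDerivAt (fun s : ℝ => (t • ez + s • v) 2) (v 2) 0 := by
        simpa using ((hasDerivAt_id (0 : ℝ)).mul_const (v 2)).const_add ((t • ez) 2)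
      have d3 := hasDerivAt_pt
        ((hasDerivAt_mul_line (v := v) (i := 0) (hα.hasFDerivAt' ho' hq) (by simp)).add
          (hasDerivAt_mul_line (v := v) (i := 1) (hβ.hasFDerivAt' ho' hq) (by simp)))
        (hasDerivAt_mul_line (v := v) (i := 1) (hγ.hasFDerivAt' ho' hq) (by simp)) d2
      refine d1.unique (d3.congr_of_eventuallyEq (Eventually.of_forall fun s => ?_))
      rw [hN]
      rfl
    rw [clm_det_eq_det3, key, key, key]
    have h1 := (Real.sqrt_pos.2 (hapos _ hq)).ne'
    have h2 := (Real.sqrt_pos.2 (hdpos _ hq)).ne'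
    simpa [det3] using mul_ne_zero h1 h2
  obtain ⟨r', hr', Ξ, hΞ, hΞm, hΞi, hΞp, hΞd, hax₁, hax₂⟩ := exists_inverse_near_axis hρ hNs
    (fun q hq => by
      simp only [hN, hap q (hsub hq), hbp q (hsub hq), hdp q (hsub hq)]
      exact R3.ext (by simp) (by simp) (by simp)) hNdet (fun t => ⟨t, hNax t⟩)
    (fun s t hst => by
      rw [hNax, hNax] at hst
      simpa [ez] using congrArg (· 2) hst)
  refine ⟨r', hr', Ξ, hΞ, fun q hq => hsub (hΞm q hq), hΞp, ?_, ?_, hax₁, hax₂, ?_⟩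
  · intro q hq q' hq' hqq
    rw [← hΞi q hq, hqq, hΞi q' hq']
  · intro q hq h0
    have h1 := congrArg ContinuousLinearMap.det (hΞd q hq)
    rw [clm_det_comp, h0, clm_det_id, mul_zero] at h1
    exact zero_ne_one h1
  · intro q hq
    rw [hNhalf _ (hΞm q hq), hΞi q hq]

theorem contDiff_of_hasDerivAt_comp {U : Set R3} {B : R3 → R3}
    (hB : ContDiffOn ℝ ∞ B U) {c : ℝ → R3} (hc : ∀ t, c t ∈ U)
    (hd : ∀ t, HasDerivAt c (B (c t)) t) : ContDiff ℝ ∞ c := by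
  rw [contDiff_infty]
  intro n
  induction n with
  | zero => exact contDiff_zero.2 (continuous_iff_continuousAt.2 fun t => (hd t).continuousAt)
  | succ n ih =>
    have hderiv : deriv c = B ∘ c := funext fun t => (hd t).deriv
    refine (contDiff_succ_iff_deriv (n := (n : ℕ∞ω))).2
      ⟨fun t => (hd t).differentiableAt, fun h => by simp at h, ?_⟩
    rw [hderiv]
    exact (hB.of_le (by exact_mod_cast le_top)).comp_contDiff ih hc

theorem integralCurve_unique {U : Set R3} (hU : IsOpen U) {B : R3 → R3}
    (hB : ContDiffOn ℝ ∞ B U) {f g : ℝ → R3} (hfU : ∀ t, f t ∈ U)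
    (hf : ∀ t, HasDerivAt f (B (f t)) t) (hg : ∀ t, HasDerivAt g (B (g t)) t)
    (h0 : f 0 = g 0) : f = g := by
  have hfc : Continuous f := continuous_iff_continuousAt.2 fun t => (hf t).continuousAt
  have hgc : Continuous g := continuous_iff_continuousAt.2 fun t => (hg t).continuousAt
  have hopen : IsOpen {t | f t = g t} := by
    rw [isOpen_iff_mem_nhds]
    intro t ht
    have hBt : ContDiffAt ℝ 1 B (f t) :=
      ((hB (f t) (hfU t)).contDiffAt (hU.mem_nhds (hfU t))).of_le (by exact_mod_cast le_top)
    obtain ⟨K, S, hS, hK⟩ := hBt.exists_lipschitzOnWith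
    have hS' : S ∈ 𝓝 (g t) := by
      have h : f t = g t := ht
      rwa [← h]
    exact ODE_solution_unique_of_eventually (v := fun _ => B) (s := fun _ => S) (K := K)
      (Eventually.of_forall fun _ => hK)
      ((hfc.continuousAt.eventually_mem hS).mono fun s hs => ⟨hf s, hs⟩)
      ((hgc.continuousAt.eventually_mem hS').mono fun s hs => ⟨hg s, hs⟩) ht
  have huniv := IsClopen.eq_univ ⟨isClosed_eq hfc hgc, hopen⟩ ⟨(0 : ℝ), h0⟩
  exact funext fun t => (huniv ▸ mem_univ t : t ∈ {t | f t = g t})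

theorem exists_minimal_period {U : Set R3} (hU : IsOpen U) {B : R3 → R3}
    (hB : ContDiffOn ℝ ∞ B U) (hB0 : ∀ z ∈ U, B z ≠ 0) {γ : Set R3} (h : IsPeriodicOrbit U B γ) :
    ∃ (c : ℝ → R3) (T : ℝ), 0 < T ∧ ContDiff ℝ ∞ c ∧ (∀ t, c t ∈ U) ∧
      (∀ t, HasDerivAt c (B (c t)) t) ∧ range c = γ ∧ (∀ t, c (t + T) = c t) ∧
      ∀ s t, c s = c t → ∃ n : ℤ, s = t + n * T := by
  obtain ⟨c, T₁, hT₁, hcU, hcT, hd, hγ⟩ := h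
  have hcs := contDiff_of_hasDerivAt_comp hB hcU hd
  have hshift : ∀ s t, HasDerivAt (fun u => c (s + u)) (B (c (s + t))) t := fun s t => by
    simpa using (hd (s + t)).comp_const_add s t
  let H : AddSubgroup ℝ :=
    { carrier := {s | ∀ t, c (s + t) = c t}
      zero_mem' := fun t => by simp
      add_mem' := fun {a b} ha hb t => by rw [add_assoc, ha, hb]
      neg_mem' := fun {a} ha t => by rw [← ha (-a + t)]; congr 1; ring }
  have hH : ∀ s, s ∈ H ↔ ∀ t, c (s + t) = c t := fun s => Iff.rfl
  have hmem : ∀ s t, c s = c t → s - t ∈ H := by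
    intro s t hst u
    have := integralCurve_unique hU hB (f := fun u => c (s + u)) (g := fun u => c (t + u))
      (fun u => hcU _) (hshift s) (hshift t) (by simpa using hst)
    have h2 := congrFun this (u - t)
    have e1 : s - t + u = s + (u - t) := by ring
    have e2 : t + (u - t) = u := by ring
    rw [e1]
    simpa [e2] using h2
  have hTH : T₁ ∈ H := fun t => by rw [add_comm]; exact hcT t
  rcases H.dense_or_cyclic with hdense | ⟨a, ha⟩
  · exfalso
    have hconst : ∀ s, c s = c 0 := by
      have hcl : IsClosed {s | c s = c 0} := isClosed_eq hcs.continuous continuous_const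
      have hsub : (H : Set ℝ) ⊆ {s | c s = c 0} := fun s hs => by simpa using (hH s).1 hs 0
      intro s
      have : s ∈ closure (H : Set ℝ) := hdense s
      exact closure_minimal hsub hcl this
    have h1 : HasDerivAt c 0 0 := by
      rw [funext hconst]; exact hasDerivAt_const _ _
    exact hB0 _ (hcU 0) ((hd 0).unique h1)
  · have ha0 : a ≠ 0 := by
      rintro rfl
      rw [ha, AddSubgroup.mem_closure_singleton] at hTH
      obtain ⟨n, hn⟩ := hTH
      simp at hn
      exact hT₁.ne hn
    have hmult : ∀ s ∈ H, ∃ n : ℤ, s = n * |a| := by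
      intro s hs
      rw [ha, AddSubgroup.mem_closure_singleton] at hs
      obtain ⟨n, hn⟩ := hs
      rcases abs_choice a with h | h <;> rw [h]
      · exact ⟨n, by rw [← hn]; simp⟩
      · exact ⟨-n, by rw [← hn]; simp⟩
    have habs : |a| ∈ H := by
      have haH : a ∈ H := ha ▸ AddSubgroup.subset_closure rfl
      rcases abs_choice a with h | h <;> rw [h]
      · exact haH
      · exact H.neg_mem haH
    refine ⟨c, |a|, abs_pos.2 ha0, hcs, hcU, hd, hγ, fun t => by rw [add_comm]; exact habs t,
      fun s t hst => ?_⟩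
    obtain ⟨n, hn⟩ := hmult _ (hmem s t hst)
    exact ⟨n, by linarith⟩

theorem cross3_inner_left (u v : R3) : ⟪cross3 u v, v⟫ = 0 := by
  simp [cross3, PiLp.inner_apply, Fin.sum_univ_three, pt]; ring

theorem cross3_inner_right (u v : R3) : ⟪cross3 u v, u⟫ = 0 := by
  simp [cross3, PiLp.inner_apply, Fin.sum_univ_three, pt]; ring

theorem sum_sq_pos {w : R3} (hw : w ≠ 0) : 0 < w 0 ^ 2 + w 1 ^ 2 + w 2 ^ 2 := by
  rcases (by positivity : 0 ≤ w 0 ^ 2 + w 1 ^ 2 + w 2 ^ 2).eq_or_lt with hz | hz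
  · exact absurd (R3.ext (by simp; nlinarith [sq_nonneg (w 0), sq_nonneg (w 1), sq_nonneg (w 2)])
      (by simp; nlinarith [sq_nonneg (w 0), sq_nonneg (w 1), sq_nonneg (w 2)])
      (by simp; nlinarith [sq_nonneg (w 0), sq_nonneg (w 1), sq_nonneg (w 2)])) hw
  · exact hz

theorem det3_cross3_frame (w b : R3) (h : ⟪w, b⟫ = 0) (a : ℝ) :
    det3 w (cross3 b w) (a • b) =
      a * (w 0 ^ 2 + w 1 ^ 2 + w 2 ^ 2) * (b 0 ^ 2 + b 1 ^ 2 + b 2 ^ 2) := by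
  have h' : w 0 * b 0 + w 1 * b 1 + w 2 * b 2 = 0 := by
    rw [← h]; simp [PiLp.inner_apply, Fin.sum_univ_three]; ring
  simp only [det3, cross3, pt_apply_zero, pt_apply_one, pt_apply_two, PiLp.smul_apply, smul_eq_mul]
  linear_combination (-a * (w 0 * b 0 + w 1 * b 1 + w 2 * b 2)) * h'

theorem exists_not_parallel {b : ℝ → R3} (hb : ContDiff ℝ 1 b) (hb0 : ∀ t, b t ≠ 0) :
    ∃ v : R3, ∀ t, cross3 v (b t) ≠ 0 := by
  have hdense := ContDiff.dense_compl_range_of_finrank_lt_finrank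
    (f := fun z : ℝ × ℝ => z.2 • b z.1) (contDiff_snd.smul (hb.comp contDiff_fst)) (by simp)
  obtain ⟨v, hv⟩ := hdense.nonempty
  refine ⟨v, fun t h => hv ?_⟩
  have h0 := congrArg (fun q : R3 => q 0) h
  have h1 := congrArg (fun q : R3 => q 1) h
  have h2 := congrArg (fun q : R3 => q 2) h
  simp [cross3] at h0 h1 h2
  set w := b t with hw
  have hn := (sum_sq_pos (hb0 t)).ne'
  rw [← hw] at hn
  refine ⟨(t, (v 0 * w 0 + v 1 * w 1 + v 2 * w 2) / (w 0 ^ 2 + w 1 ^ 2 + w 2 ^ 2)), ?_⟩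
  have hw' : b t = w := rfl
  refine R3.ext ?_ ?_ ?_ <;> simp [hw'] <;> field_simp
  · linear_combination w 2 * h1 - w 1 * h2
  · linear_combination w 0 * h2 - w 2 * h0
  · linear_combination w 1 * h0 - w 0 * h1

theorem exists_tubular_coordinates {U : Set R3} (hU : IsOpen U) {B : R3 → R3}
    (hB : ContDiffOn ℝ ∞ B U) (hB0 : ∀ z ∈ U, B z ≠ 0) {γ : Set R3} (h : IsPeriodicOrbit U B γ) :
    ∃ r > 0, ∃ Φ : R3 → R3, ContDiffOn ℝ ∞ Φ (Dset r) ∧ MapsTo Φ (Dset r) U ∧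
      (∀ q ∈ Dset r, Φ (q + per) = Φ q) ∧ (∀ q ∈ Dset r, (fderiv ℝ Φ q).det ≠ 0) ∧
      (∀ q ∈ Dset r, ∀ q' ∈ Dset r, Φ q = Φ q' → ∃ n : ℤ, q = q' + (n : ℝ) • per) ∧
      range (fun t : ℝ => Φ (t • ez)) = γ ∧
      ∀ (t : ℝ) (v : R3), v 2 = 0 → ⟪fderiv ℝ Φ (t • ez) v, B (Φ (t • ez))⟫ = 0 := by
  obtain ⟨c, T, hT, hcs, hcU, hd, hγ, hcT, hcinj⟩ := exists_minimal_period hU hB hB0 h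
  have hπ := Real.pi_pos
  set a : ℝ := T / (2 * Real.pi) with ha
  have ha0 : 0 < a := by positivity
  have haT : a * (2 * Real.pi) = T := by rw [ha]; field_simp
  have hks : ContDiff ℝ ∞ fun t => c (a * t) := hcs.comp (contDiff_const.mul contDiff_id)
  set b : ℝ → R3 := fun t => B (c (a * t)) with hb
  have hbs : ContDiff ℝ ∞ b := hB.comp_contDiff hks fun t => hcU _
  obtain ⟨v, hv⟩ := exists_not_parallel (hbs.of_le (by exact_mod_cast le_top))
    fun t => hB0 _ (hcU (a * t))
  have hcross : ∀ {u w : ℝ → R3}, ContDiff ℝ ∞ u → ContDiff ℝ ∞ w →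
      ContDiff ℝ ∞ fun t => cross3 (u t) (w t) := by
    intro u w hu hw
    have hu' := fun i => (contDiff_coord i).comp hu
    have hw' := fun i => (contDiff_coord i).comp hw
    rw [← contDiffOn_univ]
    exact ContDiffOn.pt (((hu' 1).mul (hw' 2)).sub ((hu' 2).mul (hw' 1))).contDiffOn
      (((hu' 2).mul (hw' 0)).sub ((hu' 0).mul (hw' 2))).contDiffOn
      (((hu' 0).mul (hw' 1)).sub ((hu' 1).mul (hw' 0))).contDiffOn
  set u₁ : ℝ → R3 := fun t => cross3 v (b t) with hu₁
  set u₂ : ℝ → R3 := fun t => cross3 (b t) (u₁ t) with hu₂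
  have hu₁s : ContDiff ℝ ∞ u₁ := hcross contDiff_const hbs
  have hu₂s : ContDiff ℝ ∞ u₂ := hcross hbs hu₁s
  set Φ : R3 → R3 := fun q => c (a * q 2) + q 0 • u₁ (q 2) + q 1 • u₂ (q 2) with hΦ
  have hΦs : ContDiff ℝ ∞ Φ :=
    ((hks.comp (contDiff_coord 2)).add ((contDiff_coord 0).smul (hu₁s.comp (contDiff_coord 2)))).add
      ((contDiff_coord 1).smul (hu₂s.comp (contDiff_coord 2)))
  have hΦax : ∀ t : ℝ, Φ (t • ez) = c (a * t) := fun t => by simp [hΦ]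
  have hkT : ∀ t, c (a * (t + 2 * Real.pi)) = c (a * t) := fun t => by
    rw [mul_add, haT, hcT]
  have hper : ∀ q, Φ (q + per) = Φ q := fun q => by
    simp only [hΦ, hu₂, hu₁, hb, PiLp.add_apply, per_zero, per_one, per_two, add_zero, hkT]
  have hF : ∀ q, HasFDerivAt Φ (fderiv ℝ Φ q) q := fun q =>
    (hΦs.differentiable (by simp)).differentiableAt.hasFDerivAt
  have hD0 : ∀ t : ℝ, fderiv ℝ Φ (t • ez) (pt 1 0 0) = u₁ t := fun t => by
    refine (hasDerivAt_comp_line (hF _) (pt 1 0 0)).unique ?_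
    have : (fun s : ℝ => Φ (t • ez + s • pt 1 0 0)) = fun s => c (a * t) + s • u₁ t :=
      funext fun s => by simp [hΦ]
    rw [this]
    simpa using ((hasDerivAt_id (0 : ℝ)).smul_const (u₁ t)).const_add (c (a * t))
  have hD1 : ∀ t : ℝ, fderiv ℝ Φ (t • ez) (pt 0 1 0) = u₂ t := fun t => by
    refine (hasDerivAt_comp_line (hF _) (pt 0 1 0)).unique ?_
    have : (fun s : ℝ => Φ (t • ez + s • pt 0 1 0)) = fun s => c (a * t) + s • u₂ t :=
      funext fun s => by simp [hΦ]
    rw [this]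
    simpa using ((hasDerivAt_id (0 : ℝ)).smul_const (u₂ t)).const_add (c (a * t))
  have hD2 : ∀ t : ℝ, fderiv ℝ Φ (t • ez) ez = a • b t := fun t => by
    refine (hasDerivAt_comp_line (hF _) ez).unique ?_
    have : (fun s : ℝ => Φ (t • ez + s • ez)) = fun s => c (a * (t + s)) :=
      funext fun s => by rw [← add_smul, hΦax]
    rw [this]
    have h1 : HasDerivAt (fun s : ℝ => a * (t + s)) a 0 := by
      simpa using ((hasDerivAt_id (0 : ℝ)).const_add t).const_mul a
    have h2 := HasDerivAt.scomp_of_eq (0 : ℝ) (hd (a * t)) h1 (by simp)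
    exact h2
  have hdet : ∀ t : ℝ, (fderiv ℝ Φ (t • ez)).det ≠ 0 := fun t => by
    rw [clm_det_eq_det3, hD0, hD1, show pt 0 0 1 = ez from rfl, hD2]
    simp only [hu₂]
    rw [det3_cross3_frame _ _ (cross3_inner_left v (b t))]
    have h1 := sum_sq_pos (hv t)
    have h2 := sum_sq_pos (hB0 _ (hcU (a * t)))
    positivity
  obtain ⟨r₁, hr₁, -, h₁⟩ := exists_injective_mod_per one_pos hΦs.contDiffOn (fun q _ => hper q)
    hdet (fun s t hst => by
      rw [hΦax, hΦax] at hst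
      obtain ⟨n, hn⟩ := hcinj _ _ hst
      refine ⟨n, mul_left_cancel₀ ha0.ne' ?_⟩
      rw [hn, ← haT]; ring)
  obtain ⟨r₂, hr₂, h21, h₂⟩ := exists_Dset_subset_preimage hr₁ hΦs.continuous.continuousOn
    (fun q _ => hper q) hU (fun t => by rw [hΦax]; exact hcU _)
  obtain ⟨r₃, hr₃, h32, h₃⟩ := exists_Dset_subset_preimage hr₂
    (f := fun q => (fderiv ℝ Φ q).det)
    (ContinuousLinearMap.continuous_det.comp (hΦs.continuous_fderiv (by simp))).continuousOn
    (fun q _ => by rw [fderiv_add_per (r := r₂) (fun q _ => hper q) ‹_›])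
    (O := {x | x ≠ 0}) isOpen_ne hdet
  have s32 := Dset_mono hr₃.le h32
  have s31 := s32.trans (Dset_mono hr₂.le h21)
  refine ⟨r₃, hr₃, Φ, hΦs.contDiffOn, fun q hq => h₂ q (s32 hq), fun q _ => hper q, h₃,
    fun q hq q' hq' => h₁ q (s31 hq) q' (s31 hq'), ?_, fun t w hw => ?_⟩
  · simp only [hΦax]
    rw [← hγ]
    refine subset_antisymm (by rintro _ ⟨t, rfl⟩; exact ⟨_, rfl⟩) ?_
    rintro _ ⟨t, rfl⟩
    exact ⟨t / a, by simp only []; congr 1; field_simp⟩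
  · rw [clm_apply_eq_sum_smul, hD0, hD1, hw, zero_smul, add_zero, hΦax, inner_add_left,
      real_inner_smul_left, real_inner_smul_left]
    rw [show ⟪u₁ t, B (c (a * t))⟫ = 0 from cross3_inner_left v (b t),
      show ⟪u₂ t, B (c (a * t))⟫ = 0 from cross3_inner_right (b t) (u₁ t)]
    simp

theorem hess_eq_fderiv_fderiv (p : R3 → ℝ) (z u v : R3) :
    hess p z u v = fderiv ℝ (fderiv ℝ p) z u v := by
  simp [hess, iteratedFDeriv_two_apply]

theorem fderiv_eq_zero_of_gradient_eq_zero {p : R3 → ℝ} {z : R3} (h : gradient p z = 0) :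
    fderiv ℝ p z = 0 := by
  simpa [gradient] using h

/-- The Hessian of a composition at a critical point. -/
theorem fderiv_fderiv_comp_of_critical {s U : Set R3} (hs : IsOpen s) (hU : IsOpen U)
    {Φ : R3 → R3} {p : R3 → ℝ} (hΦ : ContDiffOn ℝ ∞ Φ s) (hp : ContDiffOn ℝ ∞ p U)
    (hm : MapsTo Φ s U) (σ : ℝ) {q : R3} (hq : q ∈ s) (hcrit : fderiv ℝ p (Φ q) = 0) (v w : R3) :
    fderiv ℝ (fderiv ℝ fun q => σ * p (Φ q)) q v w =
      σ * fderiv ℝ (fderiv ℝ p) (Φ q) (fderiv ℝ Φ q v) (fderiv ℝ Φ q w) := by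
  have hΦd := fun {x} (hx : x ∈ s) => hΦ.hasFDerivAt' hs hx
  have hpd := fun {x} (hx : x ∈ U) => hp.hasFDerivAt' hU hx
  have hev : (fderiv ℝ fun q => σ * p (Φ q)) =ᶠ[𝓝 q]
      fun x => σ • (fderiv ℝ p (Φ x)).comp (fderiv ℝ Φ x) := by
    filter_upwards [hs.mem_nhds hq] with x hx
    exact (((hpd (hm hx)).comp x (hΦd hx)).const_mul σ).fderiv
  rw [hev.fderiv_eq]
  have hDp : HasFDerivAt (fderiv ℝ p) (fderiv ℝ (fderiv ℝ p) (Φ q)) (Φ q) :=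
    ContDiffOn.hasFDerivAt' (hp.fderiv_of_isOpen hU (by simp)) hU (hm hq)
  have hDΦ : HasFDerivAt (fderiv ℝ Φ) (fderiv ℝ (fderiv ℝ Φ) q) q :=
    ContDiffOn.hasFDerivAt' (hΦ.fderiv_of_isOpen hs (by simp)) hs hq
  have h1 := ((hDp.comp q (hΦd hq)).clm_comp hDΦ).const_smul σ
  rw [show fderiv ℝ (fun x => σ • (fderiv ℝ p (Φ x)).comp (fderiv ℝ Φ x)) q = _ from h1.fderiv]
  simp [hcrit]

theorem exists_sign_of_continuous {f : ℝ → ℝ} (hf : Continuous f) (h0 : ∀ t, f t ≠ 0) :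
    ∃ σ : ℝ, (σ = 1 ∨ σ = -1) ∧ ∀ t, 0 < σ * f t := by
  rcases (h0 0).lt_or_gt with h | h
  · refine ⟨-1, Or.inr rfl, fun t => ?_⟩
    by_contra hc
    have : 0 ≤ f t := by linarith
    obtain ⟨s, hs⟩ := mem_range_of_exists_le_of_exists_ge hf ⟨0, h.le⟩ ⟨t, this⟩
    exact h0 s hs
  · refine ⟨1, Or.inl rfl, fun t => ?_⟩
    by_contra hc
    have : f t ≤ 0 := by linarith
    obtain ⟨s, hs⟩ := mem_range_of_exists_le_of_exists_ge hf ⟨t, this⟩ ⟨0, h.le⟩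
    exact h0 s hs

theorem injective_mod_per_comp {r : ℝ} {Ξ : R3 → R3} (hper : ∀ q ∈ Dset r, Ξ (q + per) = Ξ q + per)
    (hinj : InjOn Ξ (Dset r)) {q q' : R3} (h : ∃ n : ℤ, Ξ q = Ξ q' + (n : ℝ) • per)
    (hq : q ∈ Dset r) (hq' : q' ∈ Dset r) : ∃ n : ℤ, q = q' + (n : ℝ) • per := by
  obtain ⟨n, hn⟩ := h
  have hs := apply_add_int_smul_per (r := r) (f := fun q => Ξ q - q)
    (fun q hq => by rw [hper q hq]; abel) n q' hq'
  refine ⟨n, hinj hq (add_smul_per_mem_Dset hq' n) ?_⟩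
  rw [hn, ← sub_eq_zero]
  rw [← sub_eq_zero] at hs
  rw [← neg_eq_zero, ← hs]
  abel

theorem range_axis_comp {X : Type*} {Φ : R3 → X} {Ξ : R3 → R3}
    (h₁ : ∀ t : ℝ, ∃ s : ℝ, Ξ (t • ez) = s • ez) (h₂ : ∀ s : ℝ, ∃ t : ℝ, Ξ (t • ez) = s • ez) :
    range (fun t : ℝ => Φ (Ξ (t • ez))) = range fun t : ℝ => Φ (t • ez) := by
  refine subset_antisymm ?_ ?_
  · rintro _ ⟨t, rfl⟩
    obtain ⟨s, hs⟩ := h₁ t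
    exact ⟨s, by simp only [hs]⟩
  · rintro _ ⟨s, rfl⟩
    obtain ⟨t, ht⟩ := h₂ s
    exact ⟨t, by simp only [ht]⟩

/-- Coordinates near a nondegenerate elliptic axis in which the pressure is a function of the
distance to the axis. -/
theorem exists_pressure_coordinates {U : Set R3} {B J : R3 → R3} {p : R3 → ℝ} {γ : Set R3}
    (hBJp : IntegrableMagneticField U B J p) (hγ : IsNondegenerateEllipticAxis U B p γ) :
    ∃ r > 0, ∃ Φ : R3 → R3, ∃ p₀ σ : ℝ, σ ≠ 0 ∧ ContDiffOn ℝ ∞ Φ (Dset r) ∧ MapsTo Φ (Dset r) U ∧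
      (∀ q ∈ Dset r, Φ (q + per) = Φ q) ∧ (∀ q ∈ Dset r, (fderiv ℝ Φ q).det ≠ 0) ∧
      (∀ q ∈ Dset r, ∀ q' ∈ Dset r, Φ q = Φ q' → ∃ n : ℤ, q = q' + (n : ℝ) • per) ∧
      range (fun t : ℝ => Φ (t • ez)) = γ ∧
      ∀ q ∈ Dset r, p (Φ q) = p₀ + σ * halfSq q := by
  obtain ⟨-, hγU, horb, hgrad, hdef⟩ := hγ
  have hU := hBJp.isOpen_U
  have hps : ContDiffOn ℝ ∞ p U := hBJp.smooth_p
  obtain ⟨r, hr, Φ, hΦ, hm, hper, hdet, hinj, hrange, horth⟩ :=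
    exists_tubular_coordinates hU hBJp.smooth_B hBJp.B_ne_zero horb
  have ho := isOpen_Dset r
  have hax : ∀ t : ℝ, t • ez ∈ Dset r := axis_mem_Dset hr
  have hΦγ : ∀ t : ℝ, Φ (t • ez) ∈ γ := fun t => hrange ▸ mem_range_self t
  have hpc : ∀ t : ℝ, fderiv ℝ p (Φ (t • ez)) = 0 := fun t =>
    fderiv_eq_zero_of_gradient_eq_zero (hgrad _ (hΦγ t))
  have hcomp : ∀ q ∈ Dset r, HasFDerivAt (fun q => p (Φ q))
      ((fderiv ℝ p (Φ q)).comp (fderiv ℝ Φ q)) q := fun q hq =>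
    (hps.hasFDerivAt' hU (hm hq)).comp q (hΦ.hasFDerivAt' ho hq)
  have hconst : ∀ t : ℝ, p (Φ (t • ez)) = p (Φ ((0 : ℝ) • ez)) := by
    have hd : ∀ t : ℝ, HasDerivAt (fun t : ℝ => p (Φ (t • ez))) 0 t := by
      intro t
      have h1 : HasDerivAt (fun t : ℝ => t • ez) ez t := by
        simpa using (hasDerivAt_id t).smul_const ez
      have h2 := (hcomp _ (hax t)).comp_hasDerivAt t h1
      rw [hpc] at h2
      exact h2.congr_deriv (by simp)
    exact fun t => is_const_of_deriv_eq_zero (fun t => (hd t).differentiableAt)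
      (fun t => (hd t).deriv) t 0
  have hker : ∀ (t : ℝ) (v : R3), v ≠ 0 → fderiv ℝ Φ (t • ez) v ≠ 0 := by
    intro t v hv h0
    have hu : IsUnit (fderiv ℝ Φ (t • ez)).toLinearMap :=
      (LinearMap.isUnit_iff_isUnit_det _).2 (isUnit_iff_ne_zero.2 (hdet _ (hax t)))
    exact hv ((LinearMap.ker_eq_bot'.1 ((LinearMap.isUnit_iff_ker_eq_bot _).1 hu)) v h0)
  let H : ℝ → R3 → ℝ := fun t v =>
    fderiv ℝ (fderiv ℝ p) (Φ (t • ez)) (fderiv ℝ Φ (t • ez) v) (fderiv ℝ Φ (t • ez) v)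
  have hHdef : ∀ t : ℝ, (∀ v : R3, v 2 = 0 → v ≠ 0 → 0 < H t v) ∨
      (∀ v : R3, v 2 = 0 → v ≠ 0 → H t v < 0) := by
    intro t
    refine (hdef _ (hΦγ t)).imp (fun h v hv hv0 => ?_) (fun h v hv hv0 => ?_)
    all_goals
      have := h _ (hker t v hv0) (horth t v hv)
      rwa [hess_eq_fderiv_fderiv] at this
  have he : pt 1 0 0 ≠ 0 := fun h => by simpa using congrArg (fun q : R3 => q 0) h
  have hHc : Continuous fun t => H t (pt 1 0 0) := by
    have hz : Continuous fun t : ℝ => t • ez := by fun_prop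
    have h1 : Continuous fun t : ℝ => Φ (t • ez) := hΦ.continuousOn.comp_continuous hz hax
    have h2 : Continuous fun t : ℝ => fderiv ℝ Φ (t • ez) :=
      (hΦ.continuousOn_fderiv_of_isOpen ho (by simp)).comp_continuous hz hax
    have h3 : Continuous fun t : ℝ => fderiv ℝ (fderiv ℝ p) (Φ (t • ez)) :=
      (ContDiffOn.continuousOn_fderiv_of_isOpen (n := ∞)
        (hps.fderiv_of_isOpen hU (by simp)) hU (by simp)).comp_continuous h1
        fun t => hm (hax t)
    exact (h3.clm_apply (h2.clm_apply continuous_const)).clm_apply (h2.clm_apply continuous_const)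
  obtain ⟨σ, hσ, hσp⟩ := exists_sign_of_continuous hHc fun t => by
    rcases hHdef t with h | h
    · exact (h _ (by simp) he).ne'
    · exact (h _ (by simp) he).ne
  have hσ2 : σ * σ = 1 := by rcases hσ with rfl | rfl <;> norm_num
  have hσ0 : σ ≠ 0 := fun h => by simp [h] at hσ2
  obtain ⟨r', hr', Ξ, hΞ, hΞm, hΞper, hΞinj, hΞdet, hΞ1, hΞ2, hΞp⟩ :=
    exists_morse_coordinates hr (h := fun q => σ * p (Φ q)) (p₀ := σ * p (Φ ((0 : ℝ) • ez)))
      (contDiffOn_const.mul (hps.comp hΦ hm)) (fun q hq => by rw [hper q hq])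
      (fun t => by rw [hconst])
      (fun t => by rw [((hcomp _ (hax t)).const_mul σ).fderiv, hpc]; simp)
      (fun t v hv hv0 => by
        rw [fderiv_fderiv_comp_of_critical ho hU hΦ hps hm σ (hax t) (hpc t)]
        have hp := hσp t
        rcases hσ with rfl | rfl
        · rcases hHdef t with h | h
          · simpa using h v hv hv0
          · have := h _ (by simp) he
            linarith
        · rcases hHdef t with h | h
          · have := h _ (by simp) he
            linarith
          · have := h v hv hv0
            simpa using this)
  have ho' := isOpen_Dset r'
  refine ⟨r', hr', fun q => Φ (Ξ q), p (Φ ((0 : ℝ) • ez)), σ, hσ0, hΦ.comp hΞ hΞm,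
    fun q hq => hm (hΞm q hq), fun q hq => by simp only [hΞper q hq, hper _ (hΞm q hq)],
    fun q hq => ?_, fun q hq q' hq' hqq => ?_, ?_, fun q hq => ?_⟩
  · have := (hΦ.hasFDerivAt' ho (hΞm q hq)).comp q (hΞ.hasFDerivAt' ho' hq)
    rw [show fderiv ℝ (fun q => Φ (Ξ q)) q = _ from this.fderiv, clm_det_comp]
    exact mul_ne_zero (hdet _ (hΞm q hq)) (hΞdet q hq)
  · exact injective_mod_per_comp hΞper hΞinj (hinj _ (hΞm q hq) _ (hΞm q' hq') hqq) hq hq'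
  · rw [← hrange]; exact range_axis_comp hΞ1 hΞ2
  · have := hΞp q hq
    linear_combination σ * this + (p (Φ ((0 : ℝ) • ez)) - p (Φ (Ξ q))) * hσ2

theorem exists_smooth_antideriv {b : ℝ} (hb : 0 < b) {k : ℝ → ℝ} (hk : ContDiffOn ℝ ∞ k (Iio b)) :
    ∃ K : ℝ → ℝ, ContDiffOn ℝ ∞ K (Iio b) ∧ ∀ x ∈ Iio b, deriv K x = k x := by
  have hd : ∀ x ∈ Iio b, HasDerivAt (fun x => ∫ t in (0 : ℝ)..x, k t) (k x) x := by
    intro x hx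
    have hsub : uIcc 0 x ⊆ Iio b := ordConnected_Iio.uIcc_subset hb hx
    exact intervalIntegral.integral_hasDerivAt_right
      (hk.continuousOn.mono hsub).intervalIntegrable
      (hk.continuousOn.stronglyMeasurableAtFilter isOpen_Iio x hx)
      (hk.continuousOn.continuousAt (isOpen_Iio.mem_nhds hx))
  refine ⟨_, (contDiffOn_infty_iff_deriv_of_isOpen isOpen_Iio).2
    ⟨fun x hx => (hd x hx).differentiableAt.differentiableWithinAt,
      hk.congr fun x hx => (hd x hx).deriv⟩, fun x hx => (hd x hx).deriv⟩

/-- Coordinates near a nondegenerate elliptic axis in which the pressure and the flux fields depend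
only on the distance to the axis. -/
theorem exists_hamada_coordinates {U : Set R3} {B J : R3 → R3} {p : R3 → ℝ} {γ : Set R3}
    (hBJp : IntegrableMagneticField U B J p) (hγ : IsNondegenerateEllipticAxis U B p γ) :
    ∃ r > 0, ∃ Φ : R3 → R3, ∃ p₀ σ : ℝ, ∃ a₁ c₁ a₂ c₂ : ℝ → ℝ,
      ContDiffOn ℝ ∞ a₁ (Iio (r ^ 2 / 2)) ∧ ContDiffOn ℝ ∞ c₁ (Iio (r ^ 2 / 2)) ∧
      ContDiffOn ℝ ∞ a₂ (Iio (r ^ 2 / 2)) ∧ ContDiffOn ℝ ∞ c₂ (Iio (r ^ 2 / 2)) ∧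
      ContDiffOn ℝ ∞ Φ (Dset r) ∧ MapsTo Φ (Dset r) U ∧
      (∀ q ∈ Dset r, Φ (q + per) = Φ q) ∧ (∀ q ∈ Dset r, (fderiv ℝ Φ q).det ≠ 0) ∧
      (∀ q ∈ Dset r, ∀ q' ∈ Dset r, Φ q = Φ q' → ∃ n : ℤ, q = q' + (n : ℝ) • per) ∧
      range (fun t : ℝ => Φ (t • ez)) = γ ∧
      (∀ q ∈ Dset r, p (Φ q) = p₀ + σ * halfSq q) ∧
      (∀ q ∈ Dset r, fderiv ℝ Φ q (a₁ (halfSq q) • vrot q + c₁ (halfSq q) • ez) =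
        (fderiv ℝ Φ q).det • B (Φ q)) ∧
      ∀ q ∈ Dset r, fderiv ℝ Φ q (a₂ (halfSq q) • vrot q + c₂ (halfSq q) • ez) =
        (fderiv ℝ Φ q).det • J (Φ q) := by
  obtain ⟨r, hr, Φ, p₀, σ, hσ, hΦ, hm, hper, hdet, hinj, hrange, hp⟩ :=
    exists_pressure_coordinates hBJp hγ
  obtain ⟨A₁, C₁, A₂, C₂, h₁, h₂, hB, hJ, hD⟩ :=
    hBJp.exists_fluxPair_pair hΦ hm hper hdet hσ hp
  obtain ⟨r', hr', Ξ, a₁, c₁, a₂, c₂, ha₁, hc₁, ha₂, hc₂, hΞ, hΞm, hΞh, hΞinj, hΞper, hΞ1, hΞ2,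
    hΞdet, hf₁, hf₂⟩ := exists_hamada_angles hr h₁ h₂ hD
  have hfd : ∀ q ∈ Dset r', fderiv ℝ (fun q => Φ (Ξ q)) q =
      (fderiv ℝ Φ (Ξ q)).comp (fderiv ℝ Ξ q) := fun q hq =>
    ((hΦ.hasFDerivAt' (isOpen_Dset r) (hΞm q hq)).comp q
      (hΞ.hasFDerivAt' (isOpen_Dset r') hq)).fderiv
  refine ⟨r', hr', fun q => Φ (Ξ q), p₀, σ, a₁, c₁, a₂, c₂, ha₁, hc₁, ha₂, hc₂, hΦ.comp hΞ hΞm,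
    fun q hq => hm (hΞm q hq), fun q hq => by simp only [hΞper q hq, hper _ (hΞm q hq)],
    fun q hq => ?_, fun q hq q' hq' hqq => ?_, ?_, fun q hq => ?_, fun q hq => ?_, fun q hq => ?_⟩
  · rw [hfd q hq, clm_det_comp]
    exact mul_ne_zero (hdet _ (hΞm q hq)) (hΞdet q hq)
  · exact injective_mod_per_comp hΞper hΞinj (hinj _ (hΞm q hq) _ (hΞm q' hq') hqq) hq hq'
  · rw [← hrange]; exact range_axis_comp hΞ1 hΞ2
  · rw [hp _ (hΞm q hq), hΞh q hq]
  · rw [hfd q hq, clm_det_comp, ContinuousLinearMap.comp_apply, hf₁ q hq, map_smul,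
      hB _ (hΞm q hq), smul_smul, mul_comm]
  · rw [hfd q hq, clm_det_comp, ContinuousLinearMap.comp_apply, hf₂ q hq, map_smul,
      hJ _ (hΞm q hq), smul_smul, mul_comm]

theorem pt_eq_smul_vrot_add (a c : ℝ) (q : R3) :
    pt (-a * q 1) (a * q 0) c = a • vrot q + c • ez :=
  R3.ext (by simp) (by simp) (by simp)

theorem pt_eq_smul_ez (t : ℝ) : pt 0 0 t = t • ez := R3.ext (by simp) (by simp) (by simp)

theorem pt_add_two_pi (x y t : ℝ) : pt x y (t + 2 * Real.pi) = pt x y t + per :=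
  R3.ext (by simp [per]) (by simp [per]) (by simp [per])

theorem eq_add_smul_per_iff (q q' : R3) (n : ℤ) : q = q' + (n : ℝ) • per ↔
    q 0 = q' 0 ∧ q 1 = q' 1 ∧ q 2 - q' 2 = 2 * Real.pi * (n : ℝ) := by
  constructor
  · intro h
    have h0 := congrArg (fun q : R3 => q 0) h
    have h1 := congrArg (fun q : R3 => q 1) h
    have h2 := congrArg (fun q : R3 => q 2) h
    simp only [PiLp.add_apply, PiLp.smul_apply, smul_eq_mul, per_zero, per_one, per_two] at h0 h1 h2
    exact ⟨by linarith, by linarith, by linarith⟩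
  · rintro ⟨h0, h1, h2⟩
    refine R3.ext ?_ ?_ ?_ <;>
      simp only [PiLp.add_apply, PiLp.smul_apply, smul_eq_mul, per_zero, per_one, per_two] <;>
      linarith

theorem add_per_mem_Dset_iff {r : ℝ} {q : R3} : q + per ∈ Dset r ↔ q ∈ Dset r := by
  simp [mem_Dset]

end

/-- **Near-axis Hamada coordinates** (Theorem 2). -/
theorem near_axis_hamada
    (U : Set R3) (B J : R3 → R3) (p : R3 → ℝ) (γ : Set R3)
    (hBJp : IntegrableMagneticField U B J p)
    (hγ : IsNondegenerateEllipticAxis U B p γ) :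
    ∃ (r δ : ℝ) (Φ : R3 → R3) (P F G K L : ℝ → ℝ),
      0 < r ∧ 0 < δ ∧
      -- Φ is C^∞ on D_r × ℝ, with values in U
      ContDiffOn ℝ (⊤ : ℕ∞) Φ (Dset r) ∧ (∀ q ∈ Dset r, Φ q ∈ U) ∧
      -- P, F, G, K, L are C^∞ on (−δ, r²/2)
      ContDiffOn ℝ (⊤ : ℕ∞) P (Set.Ioo (-δ) (r ^ 2 / 2)) ∧
      ContDiffOn ℝ (⊤ : ℕ∞) F (Set.Ioo (-δ) (r ^ 2 / 2)) ∧
      ContDiffOn ℝ (⊤ : ℕ∞) G (Set.Ioo (-δ) (r ^ 2 / 2)) ∧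
      ContDiffOn ℝ (⊤ : ℕ∞) K (Set.Ioo (-δ) (r ^ 2 / 2)) ∧
      ContDiffOn ℝ (⊤ : ℕ∞) L (Set.Ioo (-δ) (r ^ 2 / 2)) ∧
      -- (i) periodicity in φ
      (∀ x y φ : ℝ, Φ (pt x y (φ + 2 * Real.pi)) = Φ (pt x y φ)) ∧
      -- (ii) everywhere invertible differential …
      (∀ q ∈ Dset r, LinearMap.det (fderiv ℝ Φ q).toLinearMap ≠ 0) ∧
      IsOpen (Φ '' Dset r) ∧ γ ⊆ Φ '' Dset r ∧
      Set.range (fun φ : ℝ => Φ (pt 0 0 φ)) = γ ∧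
      (∀ q ∈ Dset r, ∀ q' ∈ Dset r,
        (Φ q = Φ q' ↔ (q 0 = q' 0 ∧ q 1 = q' 1 ∧
          ∃ n : ℤ, q 2 - q' 2 = 2 * Real.pi * (n : ℝ)))) ∧
      -- (iii) with ψ = (x² + y²)/2: p ∘ Φ = P(ψ), and the pulled-back flux fields of
      -- B and J are (−G′(ψ)·y, G′(ψ)·x, F′(ψ)) and (−L′(ψ)·y, L′(ψ)·x, K′(ψ)),
      -- expressed as DΦ(w) = det(DΦ) • (X ∘ Φ)
      (∀ q ∈ Dset r,
        p (Φ q) = P (((q 0) ^ 2 + (q 1) ^ 2) / 2) ∧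
        (fderiv ℝ Φ q
            (pt (-(deriv G (((q 0) ^ 2 + (q 1) ^ 2) / 2)) * q 1)
                ((deriv G (((q 0) ^ 2 + (q 1) ^ 2) / 2)) * q 0)
                (deriv F (((q 0) ^ 2 + (q 1) ^ 2) / 2)))
          = LinearMap.det (fderiv ℝ Φ q).toLinearMap • B (Φ q)) ∧
        (fderiv ℝ Φ q
            (pt (-(deriv L (((q 0) ^ 2 + (q 1) ^ 2) / 2)) * q 1)
                ((deriv L (((q 0) ^ 2 + (q 1) ^ 2) / 2)) * q 0)
                (deriv K (((q 0) ^ 2 + (q 1) ^ 2) / 2)))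
          = LinearMap.det (fderiv ℝ Φ q).toLinearMap • J (Φ q))) := by
  classical
  obtain ⟨r, hr, Φ, p₀, σ, a₁, c₁, a₂, c₂, ha₁, hc₁, ha₂, hc₂, hΦ, hm, hper, hdet, hinj, hrange,
    hp, hB, hJ⟩ := exists_hamada_coordinates hBJp hγ
  have hb : 0 < r ^ 2 / 2 := by positivity
  obtain ⟨G, hG, hG'⟩ := exists_smooth_antideriv hb ha₁
  obtain ⟨F, hF, hF'⟩ := exists_smooth_antideriv hb hc₁
  obtain ⟨L, hL, hL'⟩ := exists_smooth_antideriv hb ha₂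
  obtain ⟨K, hK, hK'⟩ := exists_smooth_antideriv hb hc₂
  have hsub : Set.Ioo (-1) (r ^ 2 / 2) ⊆ Set.Iio (r ^ 2 / 2) := fun x hx => hx.2
  have ho := isOpen_Dset r
  have hE : Set.EqOn ((Dset r).indicator Φ) Φ (Dset r) := fun q hq => Set.indicator_of_mem hq Φ
  have hfd : ∀ q ∈ Dset r, fderiv ℝ ((Dset r).indicator Φ) q = fderiv ℝ Φ q := fun q hq =>
    (hE.eventuallyEq_of_mem (ho.mem_nhds hq)).fderiv_eq
  have hax : ∀ t : ℝ, (Dset r).indicator Φ (t • ez) = Φ (t • ez) := fun t =>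
    hE (axis_mem_Dset hr t)
  refine ⟨r, 1, (Dset r).indicator Φ, fun u => p₀ + σ * u, F, G, K, L, hr, one_pos, hΦ.congr hE,
    fun q hq => by rw [hE hq]; exact hm hq,
    (contDiff_const.add (contDiff_const.mul contDiff_id)).contDiffOn, hF.mono hsub, hG.mono hsub,
    hK.mono hsub, hL.mono hsub, fun x y φ => ?_, fun q hq => ?_, ?_, ?_, ?_,
    fun q hq q' hq' => ?_, fun q hq => ⟨?_, ?_, ?_⟩⟩
  · rw [pt_add_two_pi]
    by_cases hq : pt x y φ ∈ Dset r
    · rw [hE (add_per_mem_Dset hq), hE hq, hper _ hq]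
    · rw [Set.indicator_of_notMem hq, Set.indicator_of_notMem (mt add_per_mem_Dset_iff.1 hq)]
  · rw [hfd q hq]; exact hdet q hq
  · rw [hE.image_eq]; exact isOpen_image_of_det_ne_zero ho hΦ hdet
  · rw [hE.image_eq, ← hrange]
    rintro _ ⟨t, rfl⟩
    exact ⟨_, axis_mem_Dset hr t, rfl⟩
  · simp only [pt_eq_smul_ez, hax, hrange]
  · rw [hE hq, hE hq']
    constructor
    · intro h
      obtain ⟨n, hn⟩ := hinj q hq q' hq' h
      obtain ⟨h0, h1, h2⟩ := (eq_add_smul_per_iff q q' n).1 hn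
      exact ⟨h0, h1, n, h2⟩
    · rintro ⟨h0, h1, n, h2⟩
      rw [(eq_add_smul_per_iff q q' n).2 ⟨h0, h1, h2⟩]
      exact apply_add_int_smul_per hper n q' hq'
  · rw [hE hq]; exact hp q hq
  · have hψ : ((q 0) ^ 2 + (q 1) ^ 2) / 2 ∈ Set.Iio (r ^ 2 / 2) := halfSq_mem_Iio hq
    rw [hfd q hq, hE hq, hG' _ hψ, hF' _ hψ, pt_eq_smul_vrot_add]
    exact hB q hq
  · have hψ : ((q 0) ^ 2 + (q 1) ^ 2) / 2 ∈ Set.Iio (r ^ 2 / 2) := halfSq_mem_Iio hq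
    rw [hfd q hq, hE hq, hL' _ hψ, hK' _ hψ, pt_eq_smul_vrot_add]
    exact hJ q hq
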